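/- arXiv:2011.11427 — 4 statements merged into one kernel-verified Lean document; each statement's English description precedes it below -/
import Mathlib

section
/- For every integer k ≥ 2 and every real ε > 0, there exist a real δ > 0 and a positive integer N such that for every n ≥ N, every maximal C_{2k+1}-free graph G on n vertices with at least n²/4 − δ·n^{3/2} edges contains an induced complete bipartite subgraph on at least (1−ε)n vertices. -/
open SimpleGraph

/-- `G` contains a copy of `H` as a (not necessarily induced) subgraph. -/
def HasSubCopy {α β : Type*} (H : SimpleGraph α) (G : SimpleGraph β) : Prop :=
  ∃ f : H →g G, Function.Injective f

/-- `G` is `C_m`-free: it contains no copy of the cycle on `m` vertices. -/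
def CycleFree (m : ℕ) {β : Type*} (G : SimpleGraph β) : Prop :=
  ¬ HasSubCopy (cycleGraph m) G

/-- `G` is a maximal `C_m`-free graph: it is `C_m`-free and adding any edge of the
complement creates a copy of `C_m`. -/
def MaximalCycleFree (m : ℕ) {β : Type*} (G : SimpleGraph β) : Prop :=
  CycleFree m G ∧
    ∀ v w : β, v ≠ w → ¬ G.Adj v w →
      HasSubCopy (cycleGraph m) (G ⊔ fromEdgeSet {s(v, w)})

/-- The induced subgraph of `G` on `S` is a complete bipartite graph: `S` splits into
two disjoint parts such that two vertices of `S` are adjacent iff they lie in different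
parts. -/
def IsInducedCompleteBipartiteOn {β : Type*} (G : SimpleGraph β) (S : Set β) : Prop :=
  ∃ A B : Set β, Disjoint A B ∧ A ∪ B = S ∧
    ∀ u ∈ S, ∀ v ∈ S, (G.Adj u v ↔ ((u ∈ A ∧ v ∈ B) ∨ (u ∈ B ∧ v ∈ A)))


/-- Any two vertices of `A` have a common neighbour in `B` outside any prescribed set of at most
`L` vertices. -/
def ManyCommonNeighbors {V : Type*} (G : SimpleGraph V) (L : ℕ) (A B : Set V) : Prop :=
  ∀ a ∈ A, ∀ a' ∈ A, ∀ F : Finset V, F.card ≤ L → ∃ b ∈ B, b ∉ F ∧ G.Adj a b ∧ G.Adj a' b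

section Paths

variable {V : Type*} {G : SimpleGraph V}

theorem hasSubCopy_cycleGraph_iff {m : ℕ} (hm : 2 < m) :
    HasSubCopy (cycleGraph m) G ↔ ∃ (v : V) (p : G.Walk v v), p.IsCycle ∧ p.length = m := by
  rw [← cycleGraph_isContained_iff hm]
  exact ⟨fun ⟨f, hf⟩ ↦ ⟨⟨f, hf⟩⟩, fun ⟨f⟩ ↦ ⟨f.toHom, f.injective⟩⟩

theorem CycleFree.length_add_length_ne {m : ℕ} (hm : 2 < m) (hG : CycleFree m G) {u v : V}
    {p : G.Walk u v} {q : G.Walk v u} (hp : p.IsPath) (hq : q.IsPath)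
    (hd : ∀ x ∈ p.support, x ∈ q.support → x = u ∨ x = v) : p.length + q.length ≠ m := by
  intro h
  refine hG ((hasSubCopy_cycleGraph_iff hm).2 ⟨u, p.append q, ?_, by simpa using h⟩)
  refine hp.isCycle_append hq ?_ (by lia)
  intro x hxp hxq
  have hp' := hp.support_nodup
  have hq' := hq.support_nodup
  rw [← p.cons_tail_support] at hp'
  rw [← q.cons_tail_support] at hq'
  rcases hd x (List.mem_of_mem_tail hxp) (List.mem_of_mem_tail hxq) with rfl | rfl
  · exact (List.nodup_cons.1 hp').1 hxp
  · exact (List.nodup_cons.1 hq').1 hxq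

theorem MaximalCycleFree.exists_isPath {m : ℕ} (hm : 2 < m) (hG : MaximalCycleFree m G) {x y : V}
    (hxy : x ≠ y) (hadj : ¬ G.Adj x y) : ∃ p : G.Walk x y, p.IsPath ∧ p.length + 1 = m := by
  classical
  have hcopy := hG.2 x y hxy hadj
  generalize hH : G ⊔ fromEdgeSet {s(x, y)} = H at hcopy
  obtain ⟨v, c, hc, hcl⟩ := (hasSubCopy_cycleGraph_iff hm).1 hcopy
  have edge_mem : ∀ {a b : V} (p : H.Walk a b), s(x, y) ∉ p.edges →
      ∀ e ∈ p.edges, e ∈ G.edgeSet := by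
    intro a b p hp e he
    have h1 := p.edges_subset_edgeSet he
    rw [← hH, edgeSet_sup, edgeSet_fromEdgeSet] at h1
    rcases h1 with h1 | h1
    · exact h1
    · exact absurd he (by rw [h1.1]; exact hp)
  have hmem : s(x, y) ∈ c.edges := by
    by_contra hn
    refine hG.1 ((hasSubCopy_cycleGraph_iff hm).2
      ⟨v, c.transfer G (edge_mem c hn), hc.transfer _, by simpa using hcl⟩)
  have finish : ∀ c : H.Walk x x, c.IsCycle → c.length = m → c.snd = y →
      ∃ p : G.Walk x y, p.IsPath ∧ p.length + 1 = m := by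
    intro c hc hcl hy
    cases c with
    | nil => simp at hc
    | @cons _ b _ h q =>
      have hb : b = y := by simpa using hy
      subst hb
      rw [Walk.cons_isCycle_iff] at hc
      refine ⟨(q.transfer G (edge_mem q hc.2)).reverse, (hc.1.transfer _).reverse, ?_⟩
      simpa using hcl
  have hxc : x ∈ c.support := c.fst_mem_support_of_mem_edges hmem
  have hc' : (c.rotate x hxc).IsCycle := hc.rotate hxc
  have hl' : (c.rotate x hxc).length = m := by simpa using hcl
  have hmem' : s(x, y) ∈ (c.rotate x hxc).edges := (c.rotate_edges x hxc).mem_iff.2 hmem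
  by_cases h : (c.rotate x hxc).snd = y
  · exact finish _ hc' hl' h
  · refine finish (c.rotate x hxc).reverse hc'.reverse (by simpa using hl') ?_
    generalize c.rotate x hxc = d at *
    cases d with
    | nil => simp at hc'
    | @cons _ b _ h q =>
      rw [Walk.cons_isCycle_iff] at hc'
      have hb : b ≠ y := by simpa using h
      have hq : s(x, y) ∈ q.edges := by
        simp only [Walk.edges_cons, List.mem_cons] at hmem'
        rcases hmem' with h1 | h1
        · simp at h1; grind
        · exact h1
      have := hc'.1.eq_penultimate_of_mem_edges hq
      rw [Walk.snd_reverse]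
      rw [Walk.penultimate_cons_of_not_nil, this]
      intro hnil
      cases q <;> simp_all

variable {L : ℕ} {A B : Set V}

theorem ManyCommonNeighbors.exists_path_even (hA : ManyCommonNeighbors G L A B)
    (hB : ManyCommonNeighbors G L B A) (j : ℕ) (F : Finset V) {a a' : V} (ha : a ∈ A) (ha' : a' ∈ A)
    (hne : a ≠ a') (haF : a ∉ F) (haF' : a' ∉ F) (hL : F.card + 2 * j + 3 ≤ L) :
    ∃ p : G.Walk a a', p.IsPath ∧ p.length = 2 * (j + 1) ∧ ∀ x ∈ p.support, x ∈ A ∪ B ∧ x ∉ F := by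
  classical
  induction j generalizing F a with
  | zero =>
    obtain ⟨b, hb, hbF, h1, h2⟩ := hA a ha a' ha' F (by lia)
    refine ⟨.cons h1 (.cons h2.symm .nil), ?_, by simp, ?_⟩
    · simp [Walk.cons_isPath_iff, h1.ne, h2.ne', hne]
    · simp [ha, ha', hb, haF, haF', hbF]
  | succ j ih =>
    obtain ⟨b, hb, hbF, h1, -⟩ := hA a ha a ha (insert a' F)
      ((Finset.card_insert_le _ _).trans (by lia))
    obtain ⟨c, hc, hcF, h2, -⟩ := hB b hb b hb (insert a (insert a' F))
      ((Finset.card_insert_le _ _).trans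
        ((Nat.add_le_add_right (Finset.card_insert_le _ _) 1).trans (by lia)))
    simp only [Finset.mem_insert, not_or] at hbF hcF
    obtain ⟨p, hp, hpl, hps⟩ := ih (insert a (insert b F)) hc hcF.2.1
      (by simp [hcF, h2.ne']) (by simp [hne.symm, Ne.symm hbF.1, haF'])
      (by
        have := Finset.card_insert_le a (insert b F)
        have := Finset.card_insert_le b F
        lia)
    have hbp : b ∉ p.support := fun h ↦ (hps b h).2 (by simp)
    have hap : a ∉ p.support := fun h ↦ (hps a h).2 (by simp)
    refine ⟨.cons h1 (.cons h2 p), ?_, by simp [hpl]; lia, ?_⟩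
    · simp [Walk.cons_isPath_iff, hp, hbp, hap, h1.ne]
    · intro x hx
      simp only [Walk.support_cons, List.mem_cons] at hx
      rcases hx with rfl | rfl | hx
      · exact ⟨.inl ha, haF⟩
      · exact ⟨.inr hb, hbF.2⟩
      · exact ⟨(hps x hx).1, fun h ↦ (hps x hx).2 (by simp [h])⟩

theorem ManyCommonNeighbors.exists_path_odd (hA : ManyCommonNeighbors G L A B)
    (hB : ManyCommonNeighbors G L B A) (j : ℕ) {a b : V} (ha : a ∈ A) (hb : b ∈ B)
    (hne : a ≠ b) (hL : 2 * j + 4 ≤ L) :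
    ∃ p : G.Walk a b, p.IsPath ∧ p.length = 2 * (j + 1) + 1 ∧ ∀ x ∈ p.support, x ∈ A ∪ B := by
  classical
  obtain ⟨c, hc, hcF, h1, -⟩ := hA a ha a ha {b} (by simp; lia)
  obtain ⟨p, hp, hpl, hps⟩ := hB.exists_path_even hA j {a} hc hb (by simpa using hcF)
    (by simpa using h1.ne') (by simpa using hne.symm) (by simp; lia)
  refine ⟨.cons h1 p, ?_, by simp [hpl], ?_⟩
  · rw [Walk.cons_isPath_iff]
    exact ⟨hp, fun h ↦ (hps a h).2 (by simp)⟩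
  · intro x hx
    simp only [Walk.support_cons, List.mem_cons] at hx
    rcases hx with rfl | hx
    · exact .inl ha
    · exact (hps x hx).1.symm

/-- In a `C_{2k+1}`-free graph, short paths between vertices of a robustly connected bipartite
pair have the parity dictated by the sides of their end vertices. -/
theorem CycleFree.mem_iff_mem_iff_even {k : ℕ} (hk : 1 ≤ k) (hG : CycleFree (2 * k + 1) G)
    (hL : 2 * k + 4 ≤ L) (hA : ManyCommonNeighbors G L A B) (hB : ManyCommonNeighbors G L B A)
    {s t : V} (p : G.Walk s t) (hp : p.IsPath) (h1 : 1 ≤ p.length)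
    (h2 : p.length + 1 ≤ 2 * k) (hs : s ∈ A ∪ B) (ht : t ∈ A ∪ B) :
    (s ∈ A ↔ t ∈ A) ↔ Even p.length := by
  classical
  induction hn : p.length using Nat.strong_induction_on generalizing s t with
  | _ n ih =>
    subst hn
    have hst : s ≠ t := by
      rintro rfl
      have := Walk.length_eq_zero_iff.2 (Walk.isPath_iff_nil.1 hp)
      lia
    by_cases hz : ∃ z ∈ p.support, z ≠ s ∧ z ≠ t ∧ z ∈ A ∪ B
    · obtain ⟨z, hz, hzs, hzt, hzAB⟩ := hz
      have hsum : (p.takeUntil z hz).length + (p.dropUntil z hz).length = p.length := by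
        rw [← Walk.length_append, p.take_spec hz]
      have l1 : 1 ≤ (p.takeUntil z hz).length := by
        by_contra h
        exact hzs (Walk.eq_of_length_eq_zero (p := p.takeUntil z hz) (by lia)).symm
      have l2 : 1 ≤ (p.dropUntil z hz).length := by
        by_contra h
        exact hzt (Walk.eq_of_length_eq_zero (p := p.dropUntil z hz) (by lia))
      have e1 := ih _ (by lia) (p.takeUntil z hz) (hp.takeUntil hz) l1 (by lia) hs hzAB rfl
      have e2 := ih _ (by lia) (p.dropUntil z hz) (hp.dropUntil hz) l2 (by lia) hzAB ht rfl
      rw [← hsum, Nat.even_add, ← e1, ← e2]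
      tauto
    · push Not at hz
      have close : ∀ q : G.Walk t s, q.IsPath → (∀ x ∈ q.support, x ∈ A ∪ B) →
          p.length + q.length ≠ 2 * k + 1 := by
        intro q hq hqs
        refine hG.length_add_length_ne (by lia) hp hq fun x hx hxq ↦ ?_
        by_contra! h
        exact hz x hx h.1 h.2 (hqs x hxq)
      have even_of : (s ∈ A ↔ t ∈ A) → Even p.length := by
        intro h
        by_contra hodd
        obtain ⟨i, hi⟩ := Nat.not_even_iff_odd.1 hodd
        by_cases hsA : s ∈ A
        · obtain ⟨q, hq, hql, hqs⟩ := hA.exists_path_even hB (k - i - 1) ∅ (h.1 hsA) hsA hst.symm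
            (by simp) (by simp) (by simp; lia)
          exact close q hq (fun x hx ↦ (hqs x hx).1) (by lia)
        · have hsB := hs.resolve_left hsA
          have htB := ht.resolve_left (fun h' ↦ hsA (h.2 h'))
          obtain ⟨q, hq, hql, hqs⟩ := hB.exists_path_even hA (k - i - 1) ∅ htB hsB hst.symm
            (by simp) (by simp) (by simp; lia)
          exact close q hq (fun x hx ↦ (hqs x hx).1.symm) (by lia)
      have of_even : Even p.length → (s ∈ A ↔ t ∈ A) := by
        rintro ⟨i, hi⟩
        by_contra h
        by_cases hsA : s ∈ A
        · have htB := ht.resolve_left (fun h' ↦ h (by simp [hsA, h']))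
          obtain ⟨q, hq, hql, hqs⟩ := hB.exists_path_odd hA (k - i - 1) htB hsA hst.symm (by lia)
          exact close q hq (fun x hx ↦ (hqs x hx).symm) (by lia)
        · have htA : t ∈ A := by tauto
          obtain ⟨q, hq, hql, hqs⟩ := hA.exists_path_odd hB (k - i - 1) htA
            (hs.resolve_left hsA) hst.symm (by lia)
          exact close q hq hqs (by lia)
      exact ⟨even_of, of_even⟩

theorem CycleFree.not_adj_of_mem {k : ℕ} (hk : 1 ≤ k) (hG : CycleFree (2 * k + 1) G)
    (hL : 2 * k + 4 ≤ L) (hA : ManyCommonNeighbors G L A B) (hB : ManyCommonNeighbors G L B A)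
    {a a' : V} (ha : a ∈ A) (ha' : a' ∈ A) : ¬ G.Adj a a' := by
  intro h
  have := hG.mem_iff_mem_iff_even hk hL hA hB h.toWalk h.isPath_toWalk (by simp)
    (by simp; lia) (.inl ha) (.inl ha')
  simp [ha, ha'] at this

/-- The interior of a path of length `2 * k` joining the two sides avoids both sides. -/
theorem CycleFree.notMem_of_mem_support {k : ℕ} (hk : 1 ≤ k) (hG : CycleFree (2 * k + 1) G)
    (hL : 2 * k + 4 ≤ L) (hA : ManyCommonNeighbors G L A B) (hB : ManyCommonNeighbors G L B A)
    (hAB : Disjoint A B) {a b z : V} (ha : a ∈ A) (hb : b ∈ B) (p : G.Walk a b) (hp : p.IsPath)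
    (hpl : p.length = 2 * k) (hz : z ∈ p.support) (hza : z ≠ a) (hzb : z ≠ b) : z ∉ A ∪ B := by
  classical
  intro hzAB
  have hsum : (p.takeUntil z hz).length + (p.dropUntil z hz).length = p.length := by
    rw [← Walk.length_append, p.take_spec hz]
  have l1 : 1 ≤ (p.takeUntil z hz).length := by
    by_contra h
    exact hza (Walk.eq_of_length_eq_zero (p := p.takeUntil z hz) (by lia)).symm
  have l2 : 1 ≤ (p.dropUntil z hz).length := by
    by_contra h
    exact hzb (Walk.eq_of_length_eq_zero (p := p.dropUntil z hz) (by lia))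
  have e1 := hG.mem_iff_mem_iff_even hk hL hA hB (p.takeUntil z hz) (hp.takeUntil hz) l1
    (by lia) (.inl ha) hzAB
  have e2 := hG.mem_iff_mem_iff_even hk hL hA hB (p.dropUntil z hz) (hp.dropUntil hz) l2
    (by lia) hzAB (.inr hb)
  have hbA : b ∉ A := fun h ↦ Set.disjoint_left.1 hAB h hb
  have hev : Even ((p.takeUntil z hz).length + (p.dropUntil z hz).length) := by
    rw [hsum, hpl]; exact even_two_mul k
  rw [Nat.even_add, ← e1, ← e2] at hev
  tauto

end Paths

section Density

variable {V : Type*} [DecidableEq V] {G : SimpleGraph V} [DecidableRel G.Adj]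

/-- The number of ordered pairs of adjacent vertices of `T`. -/
def adjPairCount (G : SimpleGraph V) [DecidableRel G.Adj] (T : Finset V) : ℕ :=
  ∑ t ∈ T, (T.filter (G.Adj t)).card

theorem adjPairCount_erase {T : Finset V} {v : V} (hv : v ∈ T) :
    adjPairCount G T = adjPairCount G (T.erase v) + 2 * (T.filter (G.Adj v)).card := by
  have hsplit : ∀ t, (T.filter (G.Adj t)).card =
      ((T.erase v).filter (G.Adj t)).card + if G.Adj t v then 1 else 0 := by
    intro t
    rw [Finset.filter_erase]
    split_ifs with h
    · rw [Finset.card_erase_add_one]; simp [hv, h]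
    · rw [Finset.erase_eq_of_notMem]; · simp
      simp [h]
  have h1 : ∑ t ∈ T.erase v, (if G.Adj t v then 1 else 0) = (T.filter (G.Adj v)).card := by
    rw [← Finset.card_filter]
    congr 1
    ext x
    simp only [Finset.mem_filter, Finset.mem_erase, G.adj_comm x v]
    exact ⟨fun h ↦ ⟨h.1.2, h.2⟩, fun h ↦ ⟨⟨h.2.ne', h.1⟩, h.2⟩⟩
  unfold adjPairCount
  rw [← Finset.add_sum_erase _ _ hv, Finset.sum_congr rfl (fun t _ ↦ hsplit t),
    Finset.sum_add_distrib, h1]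
  ring

theorem exists_path_of_minDegree {D : ℕ} {T : Finset V} (hT : T.Nonempty)
    (hD : ∀ t ∈ T, D ≤ (T.filter (G.Adj t)).card) {l : ℕ} (hl : l ≤ D) :
    ∃ (a b : V) (p : G.Walk a b), p.IsPath ∧ p.length = l ∧ ∀ x ∈ p.support, x ∈ T := by
  induction l with
  | zero =>
    obtain ⟨a, ha⟩ := hT
    exact ⟨a, a, .nil, by simp, rfl, by simpa using ha⟩
  | succ l ih =>
    obtain ⟨a, b, p, hp, hpl, hps⟩ := ih (by lia)
    have ha := hps a p.start_mem_support
    have : ∃ c ∈ T.filter (G.Adj a), c ∉ p.support.toFinset.erase a := by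
      apply Finset.exists_mem_notMem_of_card_lt_card
      rw [Finset.card_erase_of_mem (by simp)]
      have := p.support.toFinset_card_le
      rw [p.length_support] at this
      have := hD a ha
      lia
    obtain ⟨c, hc, hcp⟩ := this
    rw [Finset.mem_filter] at hc
    have hcp' : c ∉ p.support := fun h ↦ hcp (by simp [h, hc.2.ne'])
    refine ⟨c, b, .cons hc.2.symm p, ?_, by simp [hpl], ?_⟩
    · simp [Walk.cons_isPath_iff, hp, hcp']
    · intro x hx
      rw [Walk.support_cons, List.mem_cons] at hx
      rcases hx with rfl | hx
      · exact hc.1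
      · exact hps x hx

theorem CycleFree.adjPairCount_le {k : ℕ} (hk : 1 ≤ k) (hG : CycleFree (2 * k + 1) G) {v : V}
    {T : Finset V} (hT : ∀ t ∈ T, G.Adj v t) : adjPairCount G T ≤ 4 * k * T.card := by
  by_contra! hlt
  obtain ⟨U, hU, hmax⟩ := T.powerset.exists_max_image
    (fun U ↦ (adjPairCount G U : ℤ) - 4 * k * U.card) ⟨T, by simp⟩
  rw [Finset.mem_powerset] at hU
  have hpos : (0 : ℤ) < (adjPairCount G U : ℤ) - 4 * k * U.card := by
    have := hmax T (by simp)
    zify at hlt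
    lia
  have hne : U.Nonempty := by
    rw [Finset.nonempty_iff_ne_empty]
    rintro rfl
    simp [adjPairCount] at hpos
  have hdeg : ∀ u ∈ U, 2 * k ≤ (U.filter (G.Adj u)).card := by
    intro u hu
    have h1 := hmax (U.erase u) (by
      rw [Finset.mem_powerset]; exact (Finset.erase_subset _ _).trans hU)
    have h2 := adjPairCount_erase (G := G) hu
    have h3 := Finset.card_erase_add_one hu
    zify at h2 h3 ⊢
    simp only [h2] at h1
    rw [← h3] at h1
    lia
  obtain ⟨a, b, p, hp, hpl, hps⟩ := exists_path_of_minDegree hne hdeg (l := 2 * k - 1) (by lia)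
  have hab : a ≠ b := by
    rintro rfl
    have := Walk.length_eq_zero_iff.2 (Walk.isPath_iff_nil.1 hp)
    lia
  have hva := hT a (hU (hps a p.start_mem_support))
  have hvb := hT b (hU (hps b p.end_mem_support))
  have hvp : v ∉ p.support := fun h ↦ G.irrefl (hT v (hU (hps v h)))
  refine hG.length_add_length_ne (by lia) hp (q := .cons hvb.symm (.cons hva .nil)) ?_ ?_ ?_
  · simp [Walk.cons_isPath_iff, hva.ne, hvb.ne', hab.symm]
  · intro x hx hxq
    simp only [Walk.support_cons, Walk.support_nil, List.mem_cons, List.not_mem_nil,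
      or_false] at hxq
    rcases hxq with rfl | rfl | rfl
    · exact .inr rfl
    · exact absurd hx hvp
    · exact .inl rfl
  · simp [hpl]; lia

theorem manyCommonNeighbors_of_card {L q : ℕ} {A B : Finset V}
    (h : ∀ a ∈ A, (B.filter (fun b ↦ ¬ G.Adj a b)).card ≤ q) (hq : 2 * q + L < B.card) :
    ManyCommonNeighbors G L (A : Set V) (B : Set V) := by
  intro a ha a' ha' F hF
  have : ∃ b ∈ B, b ∉ B.filter (fun b ↦ ¬ G.Adj a b) ∪ B.filter (fun b ↦ ¬ G.Adj a' b) ∪ F := by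
    apply Finset.exists_mem_notMem_of_card_lt_card
    have := h a ha
    have := h a' ha'
    have := Finset.card_union_le (B.filter (fun b ↦ ¬ G.Adj a b))
      (B.filter (fun b ↦ ¬ G.Adj a' b))
    have := Finset.card_union_le (B.filter (fun b ↦ ¬ G.Adj a b) ∪
      B.filter (fun b ↦ ¬ G.Adj a' b)) F
    lia
  obtain ⟨b, hb, hbn⟩ := this
  simp only [Finset.mem_union, Finset.mem_filter, not_or, not_and, not_not] at hbn
  exact ⟨b, hb, hbn.2, hbn.1.1 hb, hbn.1.2 hb⟩

theorem card_adj_add_card_not_adj_le {S T C : Finset V} (hT : T ⊆ S) (hC : C ⊆ S)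
    (hTC : Disjoint T C) (a : V) :
    (S.filter (G.Adj a)).card + (C.filter (fun b ↦ ¬ G.Adj a b)).card + T.card ≤
      (T.filter (G.Adj a)).card + S.card := by
  have h1 := Finset.card_sdiff_add_card_eq_card hT
  have h2 : (S.filter (G.Adj a) ∪ C.filter (fun b ↦ ¬ G.Adj a b)).card =
      (S.filter (G.Adj a)).card + (C.filter (fun b ↦ ¬ G.Adj a b)).card := by
    apply Finset.card_union_of_disjoint
    rw [Finset.disjoint_left]
    intro x hx hx'
    exact (Finset.mem_filter.1 hx').2 (Finset.mem_filter.1 hx).2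
  have h3 : S.filter (G.Adj a) ∪ C.filter (fun b ↦ ¬ G.Adj a b) ⊆ T.filter (G.Adj a) ∪ S \ T := by
    intro x hx
    rw [Finset.disjoint_left] at hTC
    simp only [Finset.mem_union, Finset.mem_filter, Finset.mem_sdiff] at hx ⊢
    rcases hx with hx | hx
    · by_cases hxT : x ∈ T
      · exact .inl ⟨hxT, hx.2⟩
      · exact .inr ⟨hx.1, hxT⟩
    · exact .inr ⟨hC hx.1, fun h ↦ hTC h hx.1⟩
  have h4 := (Finset.card_le_card h3).trans (Finset.card_union_le _ _)
  lia

theorem CycleFree.card_filter_large_degree_le {k : ℕ} (hk : 1 ≤ k) (hG : CycleFree (2 * k + 1) G)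
    {v : V} {T : Finset V} (hT : ∀ t ∈ T, G.Adj v t) {m : ℕ} (hm : 0 < m) (hTm : T.card ≤ m) :
    T.card ≤ (T.filter (fun t ↦ 100 * (T.filter (G.Adj t)).card ≤ m)).card + 400 * k := by
  have h1 := hG.adjPairCount_le hk hT
  have h2 := Finset.card_filter_add_card_filter_not (s := T)
    (fun t ↦ 100 * (T.filter (G.Adj t)).card ≤ m)
  set Z := T.filter (fun t ↦ ¬ 100 * (T.filter (G.Adj t)).card ≤ m) with hZ
  have h3 : Z.card * m ≤ ∑ t ∈ Z, 100 * (T.filter (G.Adj t)).card := by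
    rw [← smul_eq_mul]
    exact Finset.card_nsmul_le_sum _ _ _ fun t ht ↦ (not_le.1 (Finset.mem_filter.1 ht).2).le
  have h4 : ∑ t ∈ Z, 100 * (T.filter (G.Adj t)).card ≤ 100 * adjPairCount G T := by
    rw [← Finset.mul_sum]
    exact Nat.mul_le_mul_left _ (Finset.sum_le_sum_of_subset (Finset.filter_subset _ _))
  have h5 : Z.card * m ≤ 400 * k * m := by nlinarith
  have := Nat.le_of_mul_le_mul_right h5 hm
  lia

/-- A large set with minimum degree close to half its size in a `C_{2k+1}`-free graph splits into
two sides forming a robustly connected bipartite pair. -/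
theorem CycleFree.exists_bipartition {k : ℕ} (hk : 2 ≤ k) (hG : CycleFree (2 * k + 1) G)
    {S : Finset V} (hS : 10000 * k ≤ S.card)
    (hdeg : ∀ v ∈ S, 49 * S.card ≤ 100 * (S.filter (G.Adj v)).card) :
    ∃ X Y : Finset V, X ∪ Y = S ∧ Disjoint X Y ∧
      ManyCommonNeighbors G (2 * k + 4) (X : Set V) (Y : Set V) ∧
      ManyCommonNeighbors G (2 * k + 4) (Y : Set V) (X : Set V) := by
  obtain ⟨v, hv⟩ : S.Nonempty := Finset.card_pos.1 (by lia)
  set A₀ := S.filter (G.Adj v) with hA₀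
  have hA₀v : ∀ t ∈ A₀, G.Adj v t := fun t ht ↦ (Finset.mem_filter.1 ht).2
  have hA₀S : A₀ ⊆ S := Finset.filter_subset _ _
  have hA₀c := hdeg v hv
  obtain ⟨u, hu, hud⟩ : ∃ u ∈ A₀, (A₀.filter (G.Adj u)).card ≤ 4 * k := by
    by_contra! h
    have h1 := hG.adjPairCount_le (by lia) hA₀v
    have h2 : A₀.card * (4 * k + 1) ≤ adjPairCount G A₀ := by
      rw [← smul_eq_mul]
      exact Finset.card_nsmul_le_sum _ _ _ fun t ht ↦ h t ht
    have h3 : 0 < A₀.card := by lia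
    nlinarith
  set B₀ := S.filter (G.Adj u) \ A₀ with hB₀
  have hB₀u : ∀ t ∈ B₀, G.Adj u t := fun t ht ↦ (Finset.mem_filter.1 (Finset.mem_sdiff.1 ht).1).2
  have hB₀S : B₀ ⊆ S := Finset.sdiff_subset.trans (Finset.filter_subset _ _)
  have hB₀c : (S.filter (G.Adj u)).card ≤ B₀.card + 4 * k := by
    have h1 := Finset.card_sdiff_add_card_inter (S.filter (G.Adj u)) A₀
    have h2 : S.filter (G.Adj u) ∩ A₀ ⊆ A₀.filter (G.Adj u) := by
      intro x hx
      simp only [Finset.mem_inter, Finset.mem_filter] at hx ⊢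
      exact ⟨hx.2, hx.1.2⟩
    have := Finset.card_le_card h2
    lia
  have hud' := hdeg u (hA₀S hu)
  have hAB₀ : Disjoint A₀ B₀ := Finset.disjoint_sdiff
  have hSpos : 0 < S.card := by lia
  have hAc := hG.card_filter_large_degree_le (by lia) hA₀v hSpos (Finset.card_le_card hA₀S)
  have hBc := hG.card_filter_large_degree_le (by lia) hB₀u hSpos (Finset.card_le_card hB₀S)
  set A := A₀.filter (fun t ↦ 100 * (A₀.filter (G.Adj t)).card ≤ S.card) with hA
  set B := B₀.filter (fun t ↦ 100 * (B₀.filter (G.Adj t)).card ≤ S.card) with hB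
  have hAA : A ⊆ A₀ := Finset.filter_subset _ _
  have hBB : B ⊆ B₀ := Finset.filter_subset _ _
  have hABcn : ManyCommonNeighbors G (2 * k + 4) (A : Set V) (B : Set V) := by
    refine manyCommonNeighbors_of_card (q := S.card / 10) (fun a ha ↦ ?_) (by lia)
    have h1 := card_adj_add_card_not_adj_le (G := G) hA₀S (hBB.trans hB₀S)
      (hAB₀.mono_right hBB) a
    have h2 := hdeg a (hA₀S (hAA ha))
    have h3 := (Finset.mem_filter.1 ha).2
    lia
  have hBAcn : ManyCommonNeighbors G (2 * k + 4) (B : Set V) (A : Set V) := by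
    refine manyCommonNeighbors_of_card (q := S.card / 10) (fun a ha ↦ ?_) (by lia)
    have h1 := card_adj_add_card_not_adj_le (G := G) hB₀S (hAA.trans hA₀S)
      (hAB₀.symm.mono_right hAA) a
    have h2 := hdeg a (hB₀S (hBB ha))
    have h3 := (Finset.mem_filter.1 ha).2
    lia
  have hAB : Disjoint A B := hAB₀.mono hAA hBB
  have hone : ∀ s a b, a ∈ A → b ∈ B → G.Adj s a → G.Adj s b → False := by
    intro s a b ha hb hsa hsb
    have hab : a ≠ b := fun h ↦ Finset.disjoint_left.1 hAB ha (h ▸ hb)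
    have := hG.mem_iff_mem_iff_even (by lia) le_rfl hABcn hBAcn
      (.cons hsa.symm (.cons hsb .nil)) (by
        simp [Walk.cons_isPath_iff, hsa.ne', hsb.ne, hab]) (by simp) (by simp; lia)
      (.inl ha) (.inr hb)
    have hbA : b ∉ A := fun h ↦ Finset.disjoint_left.1 hAB h hb
    simp [ha, hbA] at this
  have hAind : ∀ a ∈ A, ∀ a' ∈ A, ¬ G.Adj a a' := fun a ha a' ha' ↦
    hG.not_adj_of_mem (by lia) le_rfl hABcn hBAcn ha ha'
  have hBind : ∀ a ∈ B, ∀ a' ∈ B, ¬ G.Adj a a' := fun a ha a' ha' ↦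
    hG.not_adj_of_mem (by lia) le_rfl hBAcn hABcn ha ha'
  set X := S.filter (fun s ↦ ∃ b ∈ B, G.Adj s b) with hX
  set Y := S.filter (fun s ↦ ∃ a ∈ A, G.Adj s a) with hY
  have hAX : A ⊆ X := by
    intro a ha
    obtain ⟨b, hb, -, hab, -⟩ := hABcn a ha a ha ∅ (by simp)
    exact Finset.mem_filter.2 ⟨hA₀S (hAA ha), b, hb, hab⟩
  have hBY : B ⊆ Y := by
    intro a ha
    obtain ⟨b, hb, -, hab, -⟩ := hBAcn a ha a ha ∅ (by simp)
    exact Finset.mem_filter.2 ⟨hB₀S (hBB ha), b, hb, hab⟩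
  have hAXc := Finset.card_le_card hAX
  have hBYc := Finset.card_le_card hBY
  refine ⟨X, Y, ?_, ?_, ?_, ?_⟩
  · apply (Finset.union_subset (Finset.filter_subset _ _) (Finset.filter_subset _ _)).antisymm
    intro s hs
    by_contra hn
    have h1 : S.filter (G.Adj s) ⊆ S \ (A ∪ B) := by
      intro x hx
      rw [Finset.mem_filter] at hx
      rw [Finset.mem_sdiff, Finset.mem_union]
      refine ⟨hx.1, ?_⟩
      rintro (h | h)
      · exact hn (Finset.mem_union_right _ (Finset.mem_filter.2 ⟨hs, x, h, hx.2⟩))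
      · exact hn (Finset.mem_union_left _ (Finset.mem_filter.2 ⟨hs, x, h, hx.2⟩))
    have h2 := Finset.card_le_card h1
    have h3 := Finset.card_sdiff_add_card_eq_card
      (Finset.union_subset (hAA.trans hA₀S) (hBB.trans hB₀S))
    rw [Finset.card_union_of_disjoint hAB] at h3
    have h4 := hdeg s hs
    lia
  · rw [Finset.disjoint_left]
    intro s hs hs'
    obtain ⟨-, b, hb, hsb⟩ := Finset.mem_filter.1 hs
    obtain ⟨-, a, ha, hsa⟩ := Finset.mem_filter.1 hs'
    exact hone s a b ha hb hsa hsb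
  · refine manyCommonNeighbors_of_card (q := S.card / 10) (fun x hx ↦ ?_) (by lia)
    have h1 := card_adj_add_card_not_adj_le (G := G) (hAA.trans hA₀S)
      (C := Y) (Finset.filter_subset _ _) (by
        rw [Finset.disjoint_left]
        intro a ha haY
        obtain ⟨-, a', ha', haa⟩ := Finset.mem_filter.1 haY
        exact hAind a ha a' ha' haa) x
    obtain ⟨hxS, b, hb, hxb⟩ := Finset.mem_filter.1 hx
    have h2 := hdeg x hxS
    have h3 : (A.filter (G.Adj x)).card = 0 := by
      rw [Finset.card_eq_zero, Finset.filter_eq_empty_iff]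
      exact fun a ha hxa ↦ hone x a b ha hb hxa hxb
    lia
  · refine manyCommonNeighbors_of_card (q := S.card / 10) (fun x hx ↦ ?_) (by lia)
    have h1 := card_adj_add_card_not_adj_le (G := G) (hBB.trans hB₀S)
      (C := X) (Finset.filter_subset _ _) (by
        rw [Finset.disjoint_left]
        intro a ha haY
        obtain ⟨-, a', ha', haa⟩ := Finset.mem_filter.1 haY
        exact hBind a ha a' ha' haa) x
    obtain ⟨hxS, b, hb, hxb⟩ := Finset.mem_filter.1 hx
    have h2 := hdeg x hxS
    have h3 : (B.filter (G.Adj x)).card = 0 := by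
      rw [Finset.card_eq_zero, Finset.filter_eq_empty_iff]
      exact fun a ha hxa ↦ hone x b a hb ha hxb hxa
    lia

end Density

section Cover

/-- A bipartite relation that is a union of bicliques indexed by `R` either has many pairs or has
a small vertex cover. -/
theorem exists_small_vertexCover {V ι : Type*} [DecidableEq V] {M : V → V → Prop}
    [∀ x, DecidablePred (M x)] {P : V → ι → Prop} {Q : ι → V → Prop} {X Y : Finset V} {R : Finset ι}
    (hM : ∀ x ∈ X, ∀ y ∈ Y, M x y → ∃ r ∈ R, P x r ∧ Q r y)
    (hPQ : ∀ x ∈ X, ∀ y ∈ Y, ∀ r ∈ R, P x r → Q r y → M x y) :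
    ∃ (T : Finset V) (c : ℕ), T.card ≤ 2 * c ∧
      c ^ 2 ≤ R.card * ((X ×ˢ Y).filter (fun p ↦ M p.1 p.2)).card ∧
      ∀ x ∈ X, ∀ y ∈ Y, M x y → x ∈ T ∨ y ∈ T := by
  classical
  set E := (X ×ˢ Y).filter (fun p ↦ M p.1 p.2) with hE
  have memE : ∀ p, p ∈ E ↔ (p.1 ∈ X ∧ p.2 ∈ Y) ∧ M p.1 p.2 := by simp [hE]
  obtain ⟨W, hW, hmax⟩ := (E.powerset.filter (fun W : Finset (V × V) ↦ Set.InjOn Prod.fst (W : Set (V × V)) ∧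
    Set.InjOn Prod.snd (W : Set (V × V)))).exists_max_image Finset.card ⟨∅, by simp⟩
  simp only [Finset.mem_filter, Finset.mem_powerset] at hW hmax
  obtain ⟨hWE, hW1, hW2⟩ := hW
  refine ⟨W.image Prod.fst ∪ W.image Prod.snd, W.card, ?_, ?_, ?_⟩
  · have h1 := Finset.card_union_le (W.image Prod.fst) (W.image Prod.snd)
    have h2 := Finset.card_image_le (s := W) (f := Prod.fst)
    have h3 := Finset.card_image_le (s := W) (f := Prod.snd)
    lia
  · have hr : ∀ p : W, ∃ r ∈ R, P p.1.1 r ∧ Q r p.1.2 := fun p ↦ by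
      have := (memE p).1 (hWE p.2)
      exact hM _ this.1.1 _ this.1.2 this.2
    choose ρ hρR hρP hρQ using hr
    have h1 : W.card = ∑ r ∈ R, ((Finset.univ : Finset W).filter (fun p ↦ ρ p = r)).card := by
      rw [← Finset.card_eq_sum_card_fiberwise (fun p _ ↦ hρR p), Finset.card_univ,
        Fintype.card_coe]
    have h2 : ∑ r ∈ R, ((Finset.univ : Finset W).filter (fun p ↦ ρ p = r)).card ^ 2 ≤ E.card := by
      simp_rw [sq, ← Finset.card_product]
      rw [← Finset.card_sigma]
      refine Finset.card_le_card_of_injOn (fun t ↦ (t.2.1.1.1, t.2.2.1.2)) ?_ ?_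
      · rintro ⟨r, p, q⟩ h
        simp only [Finset.coe_sigma, Set.mem_sigma_iff, Finset.mem_coe, Finset.mem_product,
          Finset.mem_filter, Finset.mem_univ, true_and] at h
        have hp := (memE p).1 (hWE p.2)
        have hq := (memE q).1 (hWE q.2)
        refine (memE _).2 ⟨⟨hp.1.1, hq.1.2⟩, hPQ _ hp.1.1 _ hq.1.2 r h.1 ?_ ?_⟩
        · exact h.2.1 ▸ hρP p
        · exact h.2.2 ▸ hρQ q
      · rintro ⟨r, p, q⟩ h ⟨r', p', q'⟩ h' heq
        simp only [Finset.coe_sigma, Set.mem_sigma_iff, Finset.mem_coe, Finset.mem_product,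
          Finset.mem_filter, Finset.mem_univ, true_and] at h h'
        simp only [Prod.mk.injEq] at heq
        obtain rfl : p = p' := Subtype.ext (hW1 p.2 p'.2 heq.1)
        obtain rfl : q = q' := Subtype.ext (hW2 q.2 q'.2 heq.2)
        obtain rfl : r = r' := h.2.1.symm.trans h'.2.1
        rfl
    calc W.card ^ 2 ≤ R.card * ∑ r ∈ R,
          ((Finset.univ : Finset W).filter (fun p ↦ ρ p = r)).card ^ 2 := by
          rw [h1]; exact sq_sum_le_card_mul_sum_sq
      _ ≤ R.card * E.card := Nat.mul_le_mul_left _ h2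
  · intro x hx y hy hxy
    by_contra! hn
    simp only [Finset.mem_union, Finset.mem_image, not_or, not_exists, not_and] at hn
    have hnW : (x, y) ∉ W := fun h ↦ hn.1.1 _ h rfl
    have := hmax (insert (x, y) W) ⟨?_, ?_, ?_⟩
    · rw [Finset.card_insert_of_notMem hnW] at this
      lia
    · intro p hp
      rcases Finset.mem_insert.1 hp with rfl | hp
      · exact (memE _).2 ⟨⟨hx, hy⟩, hxy⟩
      · exact hWE hp
    · rw [Finset.coe_insert, Set.injOn_insert (by simpa using hnW)]
      exact ⟨hW1, fun ⟨p, hp, h⟩ ↦ hn.1.1 p hp h⟩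
    · rw [Finset.coe_insert, Set.injOn_insert (by simpa using hnW)]
      exact ⟨hW2, fun ⟨p, hp, h⟩ ↦ hn.2.2 p hp h⟩

end Cover

section Main

variable {V : Type*} {G : SimpleGraph V} [DecidableRel G.Adj]

theorem adjPairCount_union_add [DecidableEq V] {X Y : Finset V} (hXY : Disjoint X Y)
    (hX : ∀ x ∈ X, ∀ x' ∈ X, ¬ G.Adj x x') (hY : ∀ y ∈ Y, ∀ y' ∈ Y, ¬ G.Adj y y') :
    adjPairCount G (X ∪ Y) + 2 * ((X ×ˢ Y).filter (fun p ↦ ¬ G.Adj p.1 p.2)).card =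
      2 * (X.card * Y.card) := by
  have h1 : ∀ x ∈ X, (X ∪ Y).filter (G.Adj x) = Y.filter (G.Adj x) := by
    intro x hx
    rw [Finset.filter_union, Finset.filter_eq_empty_iff.2 (fun x' hx' ↦ hX x hx x' hx'),
      Finset.empty_union]
  have h2 : ∀ y ∈ Y, (X ∪ Y).filter (G.Adj y) = X.filter (G.Adj y) := by
    intro y hy
    rw [Finset.filter_union, Finset.filter_eq_empty_iff.2 (fun y' hy' ↦ hY y hy y' hy'),
      Finset.union_empty]
  have h3 : ∑ x ∈ X, (Y.filter (G.Adj x)).card =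
      ((X ×ˢ Y).filter (fun p ↦ G.Adj p.1 p.2)).card := by
    simp_rw [Finset.card_filter, Finset.sum_product]
  have h4 : ∑ y ∈ Y, (X.filter (G.Adj y)).card =
      ((X ×ˢ Y).filter (fun p ↦ G.Adj p.1 p.2)).card := by
    simp_rw [Finset.card_filter, Finset.sum_product_right, G.adj_comm]
  have h5 := Finset.card_filter_add_card_filter_not (s := X ×ˢ Y) (fun p ↦ G.Adj p.1 p.2)
  rw [Finset.card_product] at h5
  have h6 : ∑ x ∈ X, ((X ∪ Y).filter (G.Adj x)).card = ∑ x ∈ X, (Y.filter (G.Adj x)).card :=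
    Finset.sum_congr rfl fun x hx ↦ by rw [h1 x hx]
  have h7 : ∑ y ∈ Y, ((X ∪ Y).filter (G.Adj y)).card = ∑ y ∈ Y, (X.filter (G.Adj y)).card :=
    Finset.sum_congr rfl fun y hy ↦ by rw [h2 y hy]
  rw [adjPairCount, Finset.sum_union hXY, h6, h7, h3, h4]
  lia

theorem adjPairCount_le_sq (T : Finset V) : adjPairCount G T ≤ T.card ^ 2 := by
  rw [sq, ← smul_eq_mul]
  exact Finset.sum_le_card_nsmul _ _ _ fun t _ ↦ Finset.card_filter_le _ _

theorem adjPairCount_univ [Fintype V] : adjPairCount G Finset.univ = 2 * G.edgeSet.ncard := by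
  rw [← coe_edgeFinset, Set.ncard_coe_finset, ← sum_degrees_eq_twice_card_edges]
  refine Finset.sum_congr rfl fun v _ ↦ ?_
  rw [← card_neighborFinset_eq_degree, neighborFinset_eq_filter]

/-- In a maximal `C_{2k+1}`-free graph, the nonadjacent pairs of a robustly connected bipartite
pair can be covered by few vertices. -/
theorem MaximalCycleFree.exists_small_vertexCover [Fintype V] [DecidableEq V] {k : ℕ} (hk : 1 ≤ k)
    (hG : MaximalCycleFree (2 * k + 1) G) {X Y : Finset V} (hXY : Disjoint X Y)
    (hX : ManyCommonNeighbors G (2 * k + 4) (X : Set V) (Y : Set V))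
    (hY : ManyCommonNeighbors G (2 * k + 4) (Y : Set V) (X : Set V)) :
    ∃ (T : Finset V) (c : ℕ), T.card ≤ 2 * c ∧
      c ^ 2 ≤ (X ∪ Y)ᶜ.card * ((X ×ˢ Y).filter (fun p ↦ ¬ G.Adj p.1 p.2)).card ∧
      ∀ x ∈ X, ∀ y ∈ Y, ¬ G.Adj x y → x ∈ T ∨ y ∈ T := by
  refine _root_.exists_small_vertexCover (M := fun x y ↦ ¬ G.Adj x y) (P := G.Adj)
    (Q := fun r y ↦ ∃ p : G.Walk r y, p.IsPath ∧ p.length + 1 = 2 * k ∧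
      ∀ z ∈ p.support, z ≠ y → z ∉ X ∪ Y) (R := (X ∪ Y)ᶜ) ?_ ?_
  · intro x hx y hy hxy
    have hne : x ≠ y := fun h ↦ Finset.disjoint_left.1 hXY hx (h ▸ hy)
    obtain ⟨p, hp, hpl⟩ := hG.exists_isPath (by lia) hne hxy
    have hout : ∀ z ∈ p.support, z ≠ x → z ≠ y → z ∉ X ∪ Y := by
      intro z hz hzx hzy
      have := hG.1.notMem_of_mem_support hk le_rfl hX hY (Finset.disjoint_coe.2 hXY) hx hy p hp
        (by lia) hz hzx hzy
      rwa [← Finset.coe_union, Finset.mem_coe] at this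
    cases p with
    | nil => exact absurd rfl hne
    | @cons _ r _ h q =>
      rw [Walk.cons_isPath_iff] at hp
      have hlen : q.length + 1 = 2 * k := by simpa using hpl
      have hq : ∀ z ∈ q.support, z ≠ y → z ∉ X ∪ Y := fun z hz hzy ↦
        hout z (by simp [hz]) (fun h' ↦ hp.2 (h' ▸ hz)) hzy
      have hry : r ≠ y := by
        rintro rfl
        have := Walk.length_eq_zero_iff.2 (Walk.isPath_iff_nil.1 hp.1)
        lia
      exact ⟨r, by simpa using hq r q.start_mem_support hry, h, q, hp.1, hlen, hq⟩
  · rintro x hx y hy r - hxr ⟨p, hp, hpl, hps⟩ hxy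
    have hxp : x ∉ p.support := fun h ↦ hps x h hxy.ne (Finset.mem_union_left _ hx)
    refine hG.1.length_add_length_ne (by lia) (p := .cons hxr p) (q := hxy.symm.toWalk)
      (by simp [Walk.cons_isPath_iff, hp, hxp]) hxy.symm.isPath_toWalk ?_ ?_
    · intro z _ hz
      simpa [or_comm] using hz
    · simp [hpl]

/-- A subset maximising `e(S)` penalised quadratically in the size. -/
theorem exists_penalized_max [Fintype V] (γ : ℝ) :
    ∃ S : Finset V, (∀ v ∈ S, γ * (2 * S.card - 1) ≤ 2 * (S.filter (G.Adj v)).card) ∧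
      2 * (G.edgeSet.ncard : ℝ) - γ * (Fintype.card V : ℝ) ^ 2 ≤
        adjPairCount G S - γ * (S.card : ℝ) ^ 2 := by
  classical
  obtain ⟨S, -, hmax⟩ := (Finset.univ : Finset (Finset V)).exists_max_image
    (fun S ↦ (adjPairCount G S : ℝ) - γ * (S.card : ℝ) ^ 2) ⟨∅, by simp⟩
  refine ⟨S, fun v hv ↦ ?_, ?_⟩
  · have h1 := hmax (S.erase v) (by simp)
    have h2 : (S.card : ℝ) = (S.erase v).card + 1 := by
      exact_mod_cast (Finset.card_erase_add_one hv).symm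
    rw [adjPairCount_erase hv] at h1
    push_cast at h1
    rw [h2] at h1 ⊢
    nlinarith
  · have h1 := hmax Finset.univ (by simp)
    rw [adjPairCount_univ, Finset.card_univ] at h1
    push_cast at h1
    exact h1

end Main

theorem stmt_0 (k : ℕ) (hk : 2 ≤ k) (ε : ℝ) (hε : 0 < ε) :
    ∃ (δ : ℝ) (N : ℕ), 0 < δ ∧ 0 < N ∧
      ∀ n : ℕ, N ≤ n → ∀ G : SimpleGraph (Fin n),
        MaximalCycleFree (2 * k + 1) G →
        (n : ℝ) ^ 2 / 4 - δ * (n : ℝ) ^ ((3 : ℝ) / 2) ≤ (G.edgeSet.ncard : ℝ) →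
        ∃ S : Set (Fin n), IsInducedCompleteBipartiteOn G S ∧
          (1 - ε) * (n : ℝ) ≤ (S.ncard : ℝ) := by
  classical
  have hδ1 : min (ε / 440) (1 / 800) ≤ ε / 440 := min_le_left _ _
  have hδ2 : min (ε / 440) (1 / 800) ≤ 1 / 800 := min_le_right _ _
  have hδ0 : 0 < min (ε / 440) (1 / 800) := by positivity
  generalize min (ε / 440) (1 / 800) = δ at hδ0 hδ1 hδ2
  refine ⟨δ, 200000 * k, hδ0, by lia, fun n hn G hG hE ↦ ?_⟩
  obtain ⟨S, hSdeg, hSE⟩ := exists_penalized_max (G := G) (99 / 200)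
  rw [Fintype.card_fin] at hSE
  obtain ⟨s, hs, hs0⟩ : ∃ s : ℝ, (n : ℝ) = s ^ 2 ∧ 0 ≤ s :=
    ⟨√n, (Real.sq_sqrt n.cast_nonneg).symm, Real.sqrt_nonneg _⟩
  have hpow : (n : ℝ) ^ ((3 : ℝ) / 2) = s ^ 3 := by
    rw [hs, ← Real.rpow_natCast s 2, ← Real.rpow_mul hs0, ← Real.rpow_natCast s 3]
    norm_num
  rw [hpow] at hE
  have hn' : (200000 : ℝ) * k ≤ n := by exact_mod_cast hn
  have hk' : (2 : ℝ) ≤ k := by exact_mod_cast hk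
  have hs1 : 1 ≤ s := by
    by_contra! h
    have := pow_le_one₀ hs0 h.le (n := 2)
    linarith
  have hs3 : s ^ 3 ≤ n ^ 2 := by
    rw [hs, ← pow_mul]
    exact pow_le_pow_right₀ hs1 (by norm_num)
  have hδs : δ * s ^ 3 ≤ (n : ℝ) ^ 2 / 800 := by
    have := mul_le_mul hδ2 hs3 (by positivity) (by norm_num)
    linarith
  have hSn : S.card ≤ n := by simpa using S.card_le_univ
  have hSlow : (n : ℝ) / 20 ≤ S.card := by
    have h1 : (adjPairCount G S : ℝ) ≤ (S.card : ℝ) ^ 2 := by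
      exact_mod_cast adjPairCount_le_sq S
    refine le_of_sq_le_sq ?_ (by positivity)
    nlinarith
  have hSk : 10000 * k ≤ S.card := by
    have : (10000 : ℝ) * k ≤ S.card := by linarith
    exact_mod_cast this
  have hdeg : ∀ v ∈ S, 49 * S.card ≤ 100 * (S.filter (G.Adj v)).card := by
    intro v hv
    have h1 := hSdeg v hv
    have : (49 : ℝ) * S.card ≤ 100 * (S.filter (G.Adj v)).card := by linarith
    exact_mod_cast this
  obtain ⟨X, Y, rfl, hXY, hX, hY⟩ := hG.1.exists_bipartition hk hSk hdeg
  obtain ⟨T, c, hTc, hc, hT⟩ := hG.exists_small_vertexCover (by lia) hXY hX hY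
  have hXind : ∀ x ∈ X, ∀ x' ∈ X, ¬ G.Adj x x' := fun x hx x' hx' ↦
    hG.1.not_adj_of_mem (by lia) le_rfl hX hY hx hx'
  have hYind : ∀ y ∈ Y, ∀ y' ∈ Y, ¬ G.Adj y y' := fun y hy y' hy' ↦
    hG.1.not_adj_of_mem (by lia) le_rfl hY hX hy hy'
  have hcount := adjPairCount_union_add hXY hXind hYind
  have hR : ((X ∪ Y)ᶜ.card : ℝ) = n - (X ∪ Y).card := by
    rw [Finset.card_compl, Nat.cast_sub (by simpa using hSn), Fintype.card_fin]
  have hm : ((X ∪ Y).card : ℝ) = X.card + Y.card := by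
    exact_mod_cast Finset.card_union_of_disjoint hXY
  have hloss : ((((X ∪ Y) \ T).card : ℕ) : ℝ) ≥ (X ∪ Y).card - 2 * c := by
    have h1 := Finset.le_card_sdiff T (X ∪ Y)
    have : (X ∪ Y).card ≤ ((X ∪ Y) \ T).card + 2 * c := by lia
    have : ((X ∪ Y).card : ℝ) ≤ ((X ∪ Y) \ T).card + 2 * c := by exact_mod_cast this
    linarith
  refine ⟨(((X ∪ Y) \ T : Finset (Fin n)) : Set (Fin n)), ?_, ?_⟩
  · refine ⟨((X \ T : Finset (Fin n)) : Set (Fin n)), ((Y \ T : Finset (Fin n)) : Set (Fin n)),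
      Finset.disjoint_coe.2 (hXY.mono Finset.sdiff_subset Finset.sdiff_subset), ?_, ?_⟩
    · rw [Finset.union_sdiff_distrib, Finset.coe_union]
    · intro u hu v hv
      simp only [Finset.mem_coe, Finset.mem_sdiff, Finset.mem_union] at hu hv ⊢
      have hT' : ∀ x ∈ X, ∀ y ∈ Y, x ∉ T → y ∉ T → G.Adj x y := by
        intro x hx y hy hxT hyT
        by_contra h
        exact (hT x hx y hy h).elim hxT hyT
      constructor
      · intro h
        rcases hu with ⟨hu | hu, huT⟩ <;> rcases hv with ⟨hv | hv, hvT⟩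
        · exact absurd h (hXind u hu v hv)
        · exact .inl ⟨⟨hu, huT⟩, hv, hvT⟩
        · exact .inr ⟨⟨hu, huT⟩, hv, hvT⟩
        · exact absurd h (hYind u hu v hv)
      · rintro (⟨h1, h2⟩ | ⟨h1, h2⟩)
        · exact hT' u h1.1 v h2.1 h1.2 h2.2
        · exact (hT' v h2.1 u h1.1 h2.2 h1.2).symm
  · rw [Set.ncard_coe_finset]
    set h := ((X ×ˢ Y).filter (fun p ↦ ¬ G.Adj p.1 p.2)).card
    have hcount' : (adjPairCount G (X ∪ Y) : ℝ) + 2 * h = 2 * (X.card * Y.card) := by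
      exact_mod_cast hcount
    have hc' : (c : ℝ) ^ 2 ≤ (n - (X ∪ Y).card) * h := by
      rw [← hR]
      exact_mod_cast hc
    have hmn : ((X ∪ Y).card : ℝ) ≤ n := by exact_mod_cast hSn
    generalize ((X ∪ Y).card : ℝ) = m at *
    have hm0 : 0 ≤ m := le_trans (by positivity) hSlow
    have hmain : (n : ℝ) ^ 2 + 400 * h ≤ m ^ 2 + 400 * (δ * s ^ 3) := by
      have h4 : 4 * ((X.card : ℝ) * Y.card) ≤ m ^ 2 := by
        have := sq_nonneg ((X.card : ℝ) - Y.card)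
        rw [hm]
        linarith
      linarith
    have hh0 : (0 : ℝ) ≤ h := by positivity
    have hmn2 : m ^ 2 ≤ (n : ℝ) ^ 2 := pow_le_pow_left₀ hm0 hmn 2
    have hh : (h : ℝ) ≤ δ * s ^ 3 := by linarith
    have hRs : n - m ≤ 400 * δ * s := by
      have h1 : (n - m) * n ≤ 400 * (δ * s ^ 3) := by
        have : 0 ≤ (n - m) * m := mul_nonneg (by linarith) hm0
        linarith
      have h2 : (n - m) * s ^ 2 ≤ (400 * δ * s) * s ^ 2 := by
        rw [← hs]; calc _ ≤ _ := h1
          _ = _ := by rw [hs]; ring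
      exact le_of_mul_le_mul_right h2 (by positivity)
    have hcs : (c : ℝ) ≤ 20 * δ * n := by
      refine le_of_sq_le_sq ?_ (by positivity)
      calc (c : ℝ) ^ 2 ≤ (n - m) * h := hc'
        _ ≤ (400 * δ * s) * (δ * s ^ 3) := mul_le_mul hRs hh hh0 (by positivity)
        _ = (20 * δ * n) ^ 2 := by rw [hs]; ring
    have hsn : s ≤ n := hs ▸ le_self_pow₀ hs1 two_ne_zero
    have h1 : 400 * δ * s ≤ 400 * δ * n := by gcongr
    have h2 : 440 * δ * n ≤ ε * n := by gcongr; linarith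
    linarith
end

section
/- Let k ≥ 2 and n ≥ (2k)^{9k²} be integers and let ε be a real number with 0 < ε < 1/(2000k²). If G is a maximal C_{2k+1}-free graph on n vertices with e(G) ≥ n²/4 − ε·n^{3/2}, then G contains an induced complete bipartite subgraph on at least (1 − 250k²ε)n vertices. -/
open SimpleGraph

/-- `l` is the list of inner vertices of a path of `G` from `a` to `b`. -/
def IsLink {V : Type*} (G : SimpleGraph V) (a b : V) (l : List V) : Prop :=
  (a :: (l ++ [b])).Nodup ∧ (a :: (l ++ [b])).IsChain G.Adj

theorem hasSubCopy_of_closed_chain {V : Type*} {G : SimpleGraph V} {a : V} {t : List V} {m : ℕ}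
    (hn : (a :: t).Nodup) (hc : (a :: (t ++ [a])).IsChain G.Adj) (hm : t.length + 1 = m) :
    HasSubCopy (cycleGraph m) G := by
  subst hm
  have key : ∀ u v : Fin (t.length + 1), (v - u).val = 1 →
      G.Adj ((a :: t)[u.val]'u.isLt) ((a :: t)[v.val]'v.isLt) := by
    intro u v huv
    rw [List.isChain_iff_getElem] at hc
    have h1 := hc u.val (by simpa using u.isLt)
    have hu : (a :: (t ++ [a]))[u.val]'(by simp) = (a :: t)[u.val]'u.isLt := by
      have : a :: (t ++ [a]) = (a :: t) ++ [a] := by simp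
      simp only [this]
      rw [List.getElem_append_left]
    have hv : (a :: (t ++ [a]))[u.val + 1]'(by simpa using u.isLt) = (a :: t)[v.val]'v.isLt := by
      have : a :: (t ++ [a]) = (a :: t) ++ [a] := by simp
      simp only [this]
      rcases Nat.lt_or_ge (u.val + 1) (t.length + 1) with h | h
      · rw [List.getElem_append_left (by simpa using h)]
        have : v.val = u.val + 1 := by
          have := Fin.sub_def v u
          rw [this] at huv
          simp only at huv
          have h2 := v.isLt
          have h3 : t.length + 1 - u.val + v.val = t.length + 1 + 1 ∨
              t.length + 1 - u.val + v.val = 1 := by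
            rcases Nat.lt_or_ge (t.length + 1 - u.val + v.val) (t.length + 1) with h4 | h4
            · rw [Nat.mod_eq_of_lt h4] at huv; omega
            · rw [Nat.mod_eq_sub_mod h4, Nat.mod_eq_of_lt (by omega)] at huv; omega
          omega
        simp [this]
      · have h2 := u.isLt
        rw [List.getElem_append_right (by simpa using h)]
        have : v.val = 0 := by
          have := Fin.sub_def v u
          rw [this] at huv
          simp only at huv
          have h5 : u.val = t.length := by omega
          have h3 := v.isLt
          rcases Nat.lt_or_ge (t.length + 1 - u.val + v.val) (t.length + 1) with h4 | h4
          · rw [Nat.mod_eq_of_lt h4] at huv; omega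
          · rw [Nat.mod_eq_sub_mod h4, Nat.mod_eq_of_lt (by omega)] at huv; omega
        simp [this]
    rw [hu, hv] at h1
    exact h1
  refine ⟨⟨fun i => (a :: t)[i.val]'i.isLt, ?_⟩, ?_⟩
  · intro u v huv
    rw [cycleGraph_adj'] at huv
    rcases huv with h | h
    · exact (key v u h).symm
    · exact key u v h
  · intro u v huv
    exact Fin.ext ((List.Nodup.getElem_inj_iff hn).1 huv)

theorem IsLink.hasSubCopy {V : Type*} {G : SimpleGraph V} {a b : V} {l : List V} {m : ℕ}
    (h : IsLink G a b l) (hba : G.Adj b a) (hm : l.length + 2 = m) :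
    HasSubCopy (cycleGraph m) G := by
  refine hasSubCopy_of_closed_chain (t := l ++ [b]) h.1 ?_ (by simpa using hm)
  have := h.2
  simp only [List.append_assoc, List.cons_append, List.nil_append]
  rw [List.isChain_cons_append_cons_cons]
  exact ⟨this, hba, by simp⟩

theorem IsLink.append {V : Type*} {G : SimpleGraph V} {a b c : V} {l l' : List V}
    (h : IsLink G a b l) (h' : IsLink G b c l') (hd : ∀ v ∈ a :: l, v ∉ l' ++ [c]) :
    IsLink G a c (l ++ b :: l') := by
  refine ⟨?_, ?_⟩
  · have e : a :: (l ++ b :: l' ++ [c]) = (a :: l) ++ (b :: (l' ++ [c])) := by simp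
    rw [e, List.nodup_append']
    have h1 := h.1
    rw [← List.cons_append, List.nodup_append'] at h1
    refine ⟨h1.1, h'.1, ?_⟩
    intro v hv hv'
    rcases List.mem_cons.1 hv' with rfl | h2
    · exact h1.2.2 hv (by simp)
    · exact hd v hv h2
  · have e : a :: (l ++ b :: l' ++ [c]) = (a :: l) ++ (b :: (l' ++ [c])) := by simp
    rw [e, List.isChain_split]
    exact ⟨h.2, h'.2⟩

theorem IsLink.hasSubCopy_of_disjoint {V : Type*} {G : SimpleGraph V} {a b : V} {l l' : List V}
    {m : ℕ} (h : IsLink G a b l) (h' : IsLink G b a l') (hd : ∀ v ∈ l, v ∉ l')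
    (hm : l.length + l'.length + 2 = m) : HasSubCopy (cycleGraph m) G := by
  have ha := h.1
  have ha' := h'.1
  rw [← List.cons_append, List.nodup_append'] at ha ha'
  refine hasSubCopy_of_closed_chain (a := a) (t := l ++ b :: l') ?_ ?_ (by simp; omega)
  · rw [← List.cons_append, List.nodup_append']
    refine ⟨ha.1, ha'.1, ?_⟩
    intro v hv hv'
    rcases List.mem_cons.1 hv' with rfl | h2
    · exact ha.2.2 hv (by simp)
    · rcases List.mem_cons.1 hv with rfl | h3
      · exact ha'.2.2 (List.mem_cons_of_mem _ h2) (by simp)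
      · exact hd v h3 h2
  · have e : a :: (l ++ b :: l' ++ [a]) = (a :: l) ++ (b :: (l' ++ [a])) := by simp
    rw [e, List.isChain_split]
    exact ⟨h.2, h'.2⟩

/-- An injective sequence of consecutively adjacent vertices gives links. -/
theorem isLink_of_path {V : Type*} {G : SimpleGraph V} {g : ℕ → V} {N : ℕ}
    (hinj : Set.InjOn g (Set.Iic N)) (hadj : ∀ i < N, G.Adj (g i) (g (i + 1)))
    {i j : ℕ} (hij : i < j) (hj : j ≤ N) :
    IsLink G (g i) (g j) ((List.range' (i + 1) (j - i - 1)).map g) := by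
  have e : g i :: ((List.range' (i + 1) (j - i - 1)).map g ++ [g j])
      = (List.range' i (j - i + 1)).map g := by
    obtain ⟨d, rfl⟩ : ∃ d, j = i + 1 + d := ⟨j - i - 1, by omega⟩
    have e1 : i + 1 + d - i - 1 = d := by omega
    have e2 : i + 1 + d - i + 1 = (d + 1) + 1 := by omega
    rw [e1, e2, List.range'_succ, List.range'_concat]
    simp
  rw [IsLink, e]
  refine ⟨?_, ?_⟩
  · refine List.Nodup.map_on ?_ List.nodup_range'
    intro x hx y hy hxy
    rw [List.mem_range'_1] at hx hy
    exact hinj (by simp only [Set.mem_Iic]; omega) (by simp only [Set.mem_Iic]; omega) hxy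
  · rw [List.isChain_iff_getElem]
    intro n hn
    simp only [List.length_map, List.length_range'] at hn
    simp only [List.getElem_map, List.getElem_range', one_mul]
    rw [← add_assoc]
    exact hadj _ (by omega)

open scoped Fin.CommRing in
theorem exists_path_of_hasSubCopy_sup {V : Type*} {G : SimpleGraph V} {N : ℕ} {v w : V}
    (hfree : CycleFree (N + 1) G)
    (h : HasSubCopy (cycleGraph (N + 1)) (G ⊔ fromEdgeSet {s(v, w)})) (hN : 2 ≤ N) :
    ∃ g : ℕ → V, Set.InjOn g (Set.Iic N) ∧ (∀ i < N, G.Adj (g i) (g (i + 1))) ∧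
      g 0 = v ∧ g N = w := by
  obtain ⟨f, hf⟩ := h
  have hsucc : ∀ i : Fin (N + 1), (cycleGraph (N + 1)).Adj i (i + 1) := by
    intro i
    rw [cycleGraph_adj']
    right
    obtain ⟨M, rfl⟩ : ∃ M, N = M + 1 := ⟨N - 1, by omega⟩
    simp
  have hstep : ∀ i : Fin (N + 1), G.Adj (f i) (f (i + 1)) ∨
      (f i = v ∧ f (i + 1) = w) ∨ (f i = w ∧ f (i + 1) = v) := by
    intro i
    have := f.map_adj (hsucc i)
    simp only [sup_adj, fromEdgeSet_adj, Set.mem_singleton_iff, Sym2.eq_iff] at this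
    tauto
  have hcast : ∀ j : ℕ, ((j + 1 : ℕ) : Fin (N + 1)) = (j : Fin (N + 1)) + 1 := by
    intro j; push_cast; rfl
  have hcinj : ∀ x ≤ N, ∀ y ≤ N, ((x : ℕ) : Fin (N + 1)) = (y : Fin (N + 1)) → x = y := by
    intro x hx y hy hxy
    have := congrArg Fin.val hxy
    rwa [Fin.val_natCast, Fin.val_natCast, Nat.mod_eq_of_lt (by omega),
      Nat.mod_eq_of_lt (by omega)] at this
  have hNc : ((N : ℕ) : Fin (N + 1)) + 1 = 0 := by
    rw [← hcast]; simp
  -- the other edges of the cycle lie in `G`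
  have hmain : ∀ i : Fin (N + 1), ¬ G.Adj (f i) (f (i + 1)) →
      ∃ g : ℕ → V, Set.InjOn g (Set.Iic N) ∧ (∀ i < N, G.Adj (g i) (g (i + 1))) ∧
      g 0 = f (i + 1) ∧ g N = f i := by
    intro i hi
    refine ⟨fun j => f (i + 1 + (j : Fin (N + 1))), ?_, ?_, by simp, ?_⟩
    · intro x hx y hy hxy
      exact hcinj x hx y hy (add_left_cancel (hf hxy))
    · intro j hj
      have hs := hstep (i + 1 + (j : Fin (N + 1)))
      have hi' := (hstep i).resolve_left hi
      simp only [hcast, ← add_assoc]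
      rcases hs with hs | hs
      · exact hs
      · exfalso
        have h0 : f (i + 1 + (j : Fin (N + 1))) ≠ f i := by
          intro he
          have h3 := hf he
          have h4 : ((j + 1 : ℕ) : Fin (N + 1)) = ((0 : ℕ) : Fin (N + 1)) := by
            rw [hcast]
            have : i + (1 + (j : Fin (N + 1))) = i + 0 := by rw [← add_assoc, h3, add_zero]
            exact (add_comm _ _).trans ((add_left_cancel this).trans (by simp))
          have := hcinj _ (by omega) _ (by omega) h4
          omega
        have h1 : f (i + 1 + (j : Fin (N + 1))) = f (i + 1) := by
          rcases hs with hs | hs <;> rcases hi' with hi' | hi' <;>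
            first
            | exact absurd (hs.1.trans hi'.1.symm) h0
            | exact hs.1.trans hi'.2.symm
        have h2 : f (i + 1 + (j : Fin (N + 1)) + 1) = f i := by
          rcases hs with hs | hs <;> rcases hi' with hi' | hi' <;>
            first
            | exact absurd (hs.1.trans hi'.1.symm) h0
            | exact hs.2.trans hi'.1.symm
        have h3 : (j : Fin (N + 1)) = ((0 : ℕ) : Fin (N + 1)) := by
          have := hf h1
          simpa using this
        have hj0 := hcinj _ (by omega) _ (by omega) h3
        subst hj0
        have h4 := hf h2
        have h5 : ((2 : ℕ) : Fin (N + 1)) = ((0 : ℕ) : Fin (N + 1)) := by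
          have : i + (1 + 1) = i + 0 := by
            rw [← add_assoc]; simpa using h4
          have := add_left_cancel this
          rw [hcast, hcast]; simpa using this
        have := hcinj _ (by omega) _ (by omega) h5
        omega
    · have : i + 1 + (N : Fin (N + 1)) = i := by
        rw [add_assoc, add_comm 1, hNc, add_zero]
      simp only [this]
  by_cases hall : ∀ i, G.Adj (f i) (f (i + 1))
  · exfalso
    apply hfree
    have hsub : ∀ a b : Fin (N + 1), (b - a).val = 1 → G.Adj (f a) (f b) := by
      intro a b hab
      have : b = a + 1 := by
        obtain ⟨M, rfl⟩ : ∃ M, N = M + 1 := ⟨N - 1, by omega⟩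
        have h1 : b - a = 1 := Fin.ext (by rw [hab]; simp)
        rw [← h1]; abel
      rw [this]; exact hall a
    refine ⟨⟨f, ?_⟩, hf⟩
    intro a b hab
    rw [cycleGraph_adj'] at hab
    rcases hab with hab | hab
    · exact (hsub _ _ hab).symm
    · exact hsub _ _ hab
  · push Not at hall
    obtain ⟨i, hi⟩ := hall
    obtain ⟨g, h1, h2, h3, h4⟩ := hmain i hi
    rcases (hstep i).resolve_left hi with h5 | h5
    · refine ⟨fun j => g (N - j), ?_, ?_, ?_, ?_⟩
      · intro x hx y hy hxy
        simp only [Set.mem_Iic] at hx hy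
        have := h1 (Set.mem_Iic.2 (Nat.sub_le N x)) (Set.mem_Iic.2 (Nat.sub_le N y)) hxy
        omega
      · intro j hj
        have := h2 (N - (j + 1)) (by omega)
        rw [show N - (j + 1) + 1 = N - j by omega] at this
        exact this.symm
      · simp [h4, h5.1]
      · simp [h3, h5.2]
    · exact ⟨g, h1, h2, h3.trans h5.2, h4.trans h5.1⟩

/-- In a graph without three pairwise unrelated vertices, large vertex sets span long paths. -/
theorem exists_isChain_of_three {V : Type*} [DecidableEq V] {R : V → V → Prop} (C : Finset V)
    (h3 : ∀ a ∈ C, ∀ b ∈ C, ∀ c ∈ C, a ≠ b → a ≠ c → b ≠ c → R a b ∨ R a c ∨ R b c) (j : ℕ)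
    (hC : 2 * j ≤ C.card + 1) :
    ∃ l : List V, l.length = j ∧ l.Nodup ∧ (∀ v ∈ l, v ∈ C) ∧ l.IsChain R := by
  induction j with
  | zero => exact ⟨[], by simp⟩
  | succ j ih =>
    obtain ⟨l, hl, hn, hlC, hc⟩ := ih (by omega)
    cases l with
    | nil =>
      obtain ⟨x, hx⟩ : C.Nonempty := Finset.card_pos.1 (by simp at hl; omega)
      exact ⟨[x], by simp at hl ⊢; omega, by simp, by simpa using hx, by simp⟩
    | cons p l =>
      by_cases hr : ∃ r ∈ C, r ∉ p :: l ∧ R r p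
      · obtain ⟨r, hrC, hrl, hrp⟩ := hr
        refine ⟨r :: p :: l, by simp at hl ⊢; omega, List.nodup_cons.2 ⟨hrl, hn⟩, ?_, ?_⟩
        · intro v hv
          rcases List.mem_cons.1 hv with rfl | hv
          · exact hrC
          · exact hlC v hv
        · exact List.isChain_cons_cons.2 ⟨hrp, hc⟩
      · push Not at hr
        have hcard : j + 1 ≤ (C \ (p :: l).toFinset).card := by
          have h1 := Finset.le_card_sdiff (p :: l).toFinset C
          have h2 := List.toFinset_card_le (p :: l)
          omega
        obtain ⟨D, hD, hDc⟩ := Finset.exists_subset_card_eq hcard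
        refine ⟨D.toList, by simpa using hDc, D.nodup_toList, ?_, ?_⟩
        · intro v hv
          exact (Finset.mem_sdiff.1 (hD (Finset.mem_toList.1 hv))).1
        · refine List.Pairwise.isChain (List.Nodup.pairwise_of_forall_ne D.nodup_toList ?_)
          intro a ha b hb hab
          have ha' := Finset.mem_sdiff.1 (hD (Finset.mem_toList.1 ha))
          have hb' := Finset.mem_sdiff.1 (hD (Finset.mem_toList.1 hb))
          have hal : a ∉ p :: l := fun h => ha'.2 (List.mem_toFinset.2 h)
          have hbl : b ∉ p :: l := fun h => hb'.2 (List.mem_toFinset.2 h)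
          rcases h3 a ha'.1 b hb'.1 p (hlC p (by simp)) hab
            (fun h => hal (by simp [h])) (fun h => hbl (by simp [h])) with h | h | h
          · exact h
          · exact absurd h (hr a ha'.1 hal)
          · exact absurd h (hr b hb'.1 hbl)

/-- The common neighbours of `a` and `b` in `S`. -/
def commonNbrs {V : Type*} (G : SimpleGraph V) [DecidableRel G.Adj] (S : Finset V) (a b : V) :
    Finset V :=
  S.filter fun w => G.Adj a w ∧ G.Adj b w

/-- In `S`, degrees are large and among three vertices two have many common neighbours. -/
structure IsWellLinked {V : Type*} (G : SimpleGraph V) [DecidableRel G.Adj] (S : Finset V)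
    (k : ℕ) : Prop where
  deg : ∀ v ∈ S, 4 * k ≤ (commonNbrs G S v v).card
  three : ∀ a ∈ S, ∀ b ∈ S, ∀ c ∈ S, a ≠ b → a ≠ c → b ≠ c →
    4 * k ≤ (commonNbrs G S a b).card ∨ 4 * k ≤ (commonNbrs G S a c).card ∨
      4 * k ≤ (commonNbrs G S b c).card

section Linked

variable {V : Type*} {G : SimpleGraph V} [DecidableRel G.Adj] {S : Finset V} {k : ℕ}

theorem mem_commonNbrs {a b w : V} :
    w ∈ commonNbrs G S a b ↔ w ∈ S ∧ G.Adj a w ∧ G.Adj b w := by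
  simp [commonNbrs]

theorem commonNbrs_comm (a b : V) : commonNbrs G S a b = commonNbrs G S b a := by
  ext w; simp only [mem_commonNbrs]; tauto

variable [DecidableEq V]

theorem exists_isLink_of_isChain {L : ℕ} {b : V} (ps : List V) :
    ∀ (p : V) (F : Finset V), (p :: ps).Nodup →
      (p :: ps).IsChain (fun x y => L ≤ (commonNbrs G S x y).card) →
      (∀ v ∈ p :: ps, v ∈ S ∧ v ∉ F ∧ G.Adj v b) → b ∈ F → F.card + 2 * ps.length ≤ L →
      ∃ l : List V, l.length = 2 * ps.length ∧ IsLink G p b l ∧ ∀ v ∈ l, v ∈ S ∧ v ∉ F := by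
  induction ps with
  | nil =>
    intro p F _ _ hp _ _
    have := (hp p (by simp)).2.2
    exact ⟨[], by simp, ⟨by simpa using this.ne, by simpa using this⟩, by simp⟩
  | cons p' ps ih =>
    intro p F hn hc hp hb hL
    rw [List.isChain_cons_cons] at hc
    rw [List.nodup_cons] at hn
    simp only [List.length_cons] at hL
    have hpF : p ∉ F := (hp p (by simp)).2.1
    obtain ⟨l, hl, hlink, hlF⟩ := ih p' (insert p F) hn.2 hc.2
      (fun v hv => by
        have h1 := hp v (List.mem_cons_of_mem _ hv)
        refine ⟨h1.1, ?_, h1.2.2⟩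
        rw [Finset.mem_insert, not_or]
        exact ⟨fun h => hn.1 (h ▸ hv), h1.2.1⟩)
      (Finset.mem_insert_of_mem hb) (by rw [Finset.card_insert_of_notMem hpF]; omega)
    obtain ⟨q, hq, hqn⟩ : ∃ q ∈ commonNbrs G S p p', q ∉ F ∪ l.toFinset := by
      apply Finset.exists_mem_notMem_of_card_lt_card
      have h1 := Finset.card_union_le F l.toFinset
      have h2 := List.toFinset_card_le l
      have := hc.1
      omega
    rw [mem_commonNbrs] at hq
    rw [Finset.mem_union, not_or, List.mem_toFinset] at hqn
    refine ⟨q :: p' :: l, by simp; omega, ?_, ?_⟩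
    · have h1 : IsLink G p p' [q] := by
        refine ⟨?_, ?_⟩
        · have h2 : p ≠ p' := fun h => hn.1 (by simp [h])
          simp [hq.2.1.ne, h2, hq.2.2.ne']
        · simp [hq.2.1, hq.2.2.symm]
      refine h1.append hlink ?_
      intro v hv
      simp only [List.mem_cons, List.not_mem_nil, or_false] at hv
      rw [List.mem_append, List.mem_singleton, not_or]
      rcases hv with rfl | rfl
      · exact ⟨fun h => (hlF _ h).2 (by simp), fun h => hpF (h ▸ hb)⟩
      · exact ⟨hqn.2, fun h => hqn.1 (h ▸ hb)⟩
    · intro v hv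
      simp only [List.mem_cons] at hv
      rcases hv with rfl | rfl | hv
      · exact ⟨hq.1, hqn.1⟩
      · exact ⟨(hp v (by simp)).1, (hp v (by simp)).2.1⟩
      · exact ⟨(hlF v hv).1, fun h => (hlF v hv).2 (Finset.mem_insert_of_mem h)⟩

namespace IsWellLinked

theorem exists_even_link (h : IsWellLinked G S k) (hk : 2 ≤ k) {a b : V} (hab : a ≠ b)
    (hcn : 4 * k ≤ (commonNbrs G S a b).card) (F : Finset V) (hF : F.card ≤ 2) {j : ℕ}
    (hj : 1 ≤ j) (hjk : j ≤ k) :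
    ∃ l : List V, l.length + 1 = 2 * j ∧ IsLink G a b l ∧ ∀ v ∈ l, v ∈ S ∧ v ∉ F := by
  have hCS : ∀ v ∈ commonNbrs G S a b \ F, v ∈ S := fun v hv =>
    (mem_commonNbrs.1 (Finset.mem_sdiff.1 hv).1).1
  obtain ⟨ps, hps, hn, hpsC, hc⟩ := exists_isChain_of_three
    (R := fun x y => 4 * k ≤ (commonNbrs G S x y).card) (commonNbrs G S a b \ F)
    (fun x hx y hy z hz => h.three x (hCS x hx) y (hCS y hy) z (hCS z hz)) j
    (by have := Finset.le_card_sdiff F (commonNbrs G S a b); omega)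
  cases ps with
  | nil => simp at hps; omega
  | cons p ps =>
    simp only [List.length_cons] at hps
    have hp : ∀ v ∈ p :: ps, v ∈ S ∧ v ∉ F ∧ G.Adj a v ∧ G.Adj b v := fun v hv => by
      have h1 := Finset.mem_sdiff.1 (hpsC v hv)
      have h2 := mem_commonNbrs.1 h1.1
      exact ⟨h2.1, h1.2, h2.2⟩
    obtain ⟨l, hl, hlink, hlF⟩ := exists_isLink_of_isChain (L := 4 * k) (b := b) ps p
      (insert a (insert b F)) hn hc
      (fun v hv => by
        have h1 := hp v hv
        refine ⟨h1.1, ?_, h1.2.2.2.symm⟩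
        rw [Finset.mem_insert, Finset.mem_insert, not_or, not_or]
        exact ⟨h1.2.2.1.ne', h1.2.2.2.ne', h1.2.1⟩) (by simp)
      (by
        have h1 := Finset.card_insert_le a (insert b F)
        have h2 := Finset.card_insert_le b F
        omega)
    have hp0 := hp p (by simp)
    have h0 : IsLink G a p [] := ⟨by simpa using hp0.2.2.1.ne, by simpa using hp0.2.2.1⟩
    refine ⟨p :: l, by simp; omega, h0.append hlink ?_, ?_⟩
    · intro v hv
      simp only [List.mem_cons, List.not_mem_nil, or_false] at hv
      subst hv
      rw [List.mem_append, List.mem_singleton, not_or]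
      exact ⟨fun h => (hlF _ h).2 (by simp), hab⟩
    · intro v hv
      rcases List.mem_cons.1 hv with rfl | hv
      · exact ⟨hp0.1, hp0.2.1⟩
      · exact ⟨(hlF v hv).1, fun h => (hlF v hv).2 (by simp [h])⟩

theorem card_lt_of_adj (h : IsWellLinked G S k) (hk : 2 ≤ k) (hG : CycleFree (2 * k + 1) G)
    {u w : V} (huw : G.Adj u w) : (commonNbrs G S u w).card < 4 * k := by
  by_contra! hcn
  obtain ⟨l, hl, hlink, -⟩ := h.exists_even_link hk huw.ne hcn ∅ (by simp)
    (j := k) (by omega) le_rfl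
  exact hG (hlink.hasSubCopy huw.symm (by omega))

theorem not_both_of_adj (h : IsWellLinked G S k) (hk : 2 ≤ k) (hG : CycleFree (2 * k + 1) G)
    {u w x : V} (huw : G.Adj u w) (hu : 4 * k ≤ (commonNbrs G S x u).card)
    (hw : 4 * k ≤ (commonNbrs G S x w).card) : False := by
  have hA := h.card_lt_of_adj hk hG huw
  have hxu : x ≠ u := by rintro rfl; omega
  have hxw : x ≠ w := by rintro rfl; rw [commonNbrs_comm] at hA; omega
  obtain ⟨p, hp, hpw⟩ : ∃ p ∈ commonNbrs G S x u, p ∉ ({w} : Finset V) := by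
    apply Finset.exists_mem_notMem_of_card_lt_card
    simp; omega
  rw [mem_commonNbrs] at hp
  rw [Finset.mem_singleton] at hpw
  obtain ⟨l, hl, hlink, hlF⟩ := h.exists_even_link hk hxw hw {u, p} Finset.card_le_two
    (j := k - 1) (by omega) (by omega)
  have h1 : IsLink G u x [p] :=
    ⟨by simp [hp.2.2.ne, hxu.symm, hp.2.1.ne'], by simp [hp.2.2, hp.2.1.symm]⟩
  have h2 : IsLink G u w ([p] ++ x :: l) := by
    refine h1.append hlink ?_
    intro v hv
    simp only [List.mem_cons, List.not_mem_nil, or_false] at hv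
    rw [List.mem_append, List.mem_singleton, not_or]
    refine ⟨fun h => (hlF v h).2 (by simpa using hv), ?_⟩
    rcases hv with rfl | rfl
    · exact huw.ne
    · exact hpw
  exact hG (h2.hasSubCopy huw.symm (by simp; omega))

theorem exists_bipartition (h : IsWellLinked G S k) (hk : 2 ≤ k)
    (hG : CycleFree (2 * k + 1) G) (hS : S.Nonempty) :
    ∃ X Y : Finset V, Disjoint X Y ∧ X ∪ Y = S ∧ (∀ a ∈ X, ∀ b ∈ X, ¬ G.Adj a b) ∧
      (∀ a ∈ Y, ∀ b ∈ Y, ¬ G.Adj a b) := by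
  obtain ⟨u, hu⟩ := hS
  obtain ⟨w, hw⟩ : (commonNbrs G S u u).Nonempty :=
    Finset.card_pos.1 (by have := h.deg u hu; omega)
  rw [mem_commonNbrs] at hw
  have hor : ∀ x ∈ S, 4 * k ≤ (commonNbrs G S x u).card ∨ 4 * k ≤ (commonNbrs G S x w).card := by
    intro x hx
    by_cases hxu : x = u
    · left; rw [hxu]; exact h.deg u hu
    by_cases hxw : x = w
    · right; rw [hxw]; exact h.deg w hw.1
    rcases h.three x hx u hu w hw.1 hxu hxw hw.2.1.ne with h1 | h1 | h1
    · exact Or.inl h1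
    · exact Or.inr h1
    · have := h.card_lt_of_adj hk hG hw.2.1
      omega
  refine ⟨S.filter fun x => 4 * k ≤ (commonNbrs G S x u).card,
    S.filter fun x => ¬ 4 * k ≤ (commonNbrs G S x u).card,
    Finset.disjoint_filter_filter_not _ _ _, Finset.filter_union_filter_not_eq _ _, ?_, ?_⟩
  · intro a ha b hb hab
    rw [Finset.mem_filter, commonNbrs_comm] at ha hb
    exact h.not_both_of_adj hk hG hab ha.2 hb.2
  · intro a ha b hb hab
    rw [Finset.mem_filter] at ha hb
    have ha' := (hor a ha.1).resolve_left ha.2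
    have hb' := (hor b hb.1).resolve_left hb.2
    rw [commonNbrs_comm] at ha' hb'
    exact h.not_both_of_adj hk hG hab ha' hb'

variable {X Y : Finset V}

theorem card_commonNbrs_of_same_side (h : IsWellLinked G S k) (hk : 2 ≤ k) (hXY : X ∪ Y = S)
    (hX : ∀ a ∈ X, ∀ b ∈ X, ¬ G.Adj a b) (hY : ∀ a ∈ Y, ∀ b ∈ Y, ¬ G.Adj a b)
    {a b : V} (ha : a ∈ X) (hb : b ∈ X) (hab : a ≠ b) :
    4 * k ≤ (commonNbrs G S a b).card := by
  have hXS : ∀ v ∈ X, v ∈ S := fun v hv => hXY ▸ Finset.mem_union_left _ hv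
  obtain ⟨y, hy⟩ : (commonNbrs G S a a).Nonempty :=
    Finset.card_pos.1 (by have := h.deg a (hXS a ha); omega)
  rw [mem_commonNbrs] at hy
  have hyY : y ∈ Y := by
    rcases Finset.mem_union.1 (hXY.symm ▸ hy.1 : y ∈ X ∪ Y) with h1 | h1
    · exact absurd hy.2.1 (hX a ha y h1)
    · exact h1
  have hempty : ∀ c ∈ X, commonNbrs G S c y = ∅ := by
    intro c hc
    rw [Finset.eq_empty_iff_forall_notMem]
    intro v hv
    rw [mem_commonNbrs] at hv
    rcases Finset.mem_union.1 (hXY.symm ▸ hv.1 : v ∈ X ∪ Y) with h1 | h1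
    · exact hX c hc v h1 hv.2.1
    · exact hY y hyY v h1 hv.2.2
  have hby : b ≠ y := by rintro rfl; exact hX a ha b hb hy.2.1
  rcases h.three a (hXS a ha) b (hXS b hb) y hy.1 hab hy.2.1.ne hby with h1 | h1 | h1
  · exact h1
  · rw [hempty a ha] at h1; simp at h1; omega
  · rw [hempty b hb] at h1; simp at h1; omega

theorem exists_odd_link (h : IsWellLinked G S k) (hk : 2 ≤ k) (hXY : X ∪ Y = S)
    (hX : ∀ a ∈ X, ∀ b ∈ X, ¬ G.Adj a b) (hY : ∀ a ∈ Y, ∀ b ∈ Y, ¬ G.Adj a b)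
    {a b : V} (ha : a ∈ X) (hb : b ∈ Y) (hab : a ≠ b) {j : ℕ} (hj : 1 ≤ j) (hjk : j ≤ k) :
    ∃ l : List V, l.length = 2 * j ∧ IsLink G a b l ∧ ∀ v ∈ l, v ∈ S := by
  have hbS : b ∈ S := hXY ▸ Finset.mem_union_right _ hb
  obtain ⟨x, hx, hxa⟩ : ∃ x ∈ commonNbrs G S b b, x ∉ ({a} : Finset V) := by
    apply Finset.exists_mem_notMem_of_card_lt_card
    have := h.deg b hbS
    simp; omega
  rw [mem_commonNbrs] at hx
  rw [Finset.mem_singleton] at hxa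
  have hxX : x ∈ X := by
    rcases Finset.mem_union.1 (hXY.symm ▸ hx.1 : x ∈ X ∪ Y) with h1 | h1
    · exact h1
    · exact absurd hx.2.1 (hY b hb x h1)
  obtain ⟨l, hl, hlink, hlF⟩ := h.exists_even_link hk (Ne.symm hxa)
    (h.card_commonNbrs_of_same_side hk hXY hX hY ha hxX (Ne.symm hxa)) {b} (by simp) hj hjk
  have h1 : IsLink G x b [] := ⟨by simpa using hx.2.1.ne', by simpa using hx.2.1.symm⟩
  refine ⟨l ++ x :: [], by simp; omega, hlink.append h1 ?_, ?_⟩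
  · intro v hv
    simp only [List.nil_append, List.mem_singleton]
    rcases List.mem_cons.1 hv with rfl | hv
    · exact hab
    · exact fun h => (hlF v hv).2 (by simp [h])
  · intro v hv
    simp only [List.mem_append, List.mem_singleton] at hv
    rcases hv with hv | rfl
    · exact (hlF v hv).1
    · exact hx.1

end IsWellLinked

end Linked

section Core

variable {V : Type*} [DecidableEq V] {G : SimpleGraph V} [DecidableRel G.Adj] {S X Y : Finset V}
  {k : ℕ}

theorem IsWellLinked.exists_link (h : IsWellLinked G S k) (hk : 2 ≤ k) (hXY : X ∪ Y = S)
    (hX : ∀ a ∈ X, ∀ b ∈ X, ¬ G.Adj a b) (hY : ∀ a ∈ Y, ∀ b ∈ Y, ¬ G.Adj a b)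
    {a b : V} (ha : a ∈ S) (hb : b ∈ S) (hab : a ≠ b) {m : ℕ} (hm : 1 ≤ m) (hmk : m < 2 * k)
    (hpar : (a ∈ X ↔ b ∈ X) ↔ Odd m) :
    ∃ l : List V, l.length = m ∧ IsLink G a b l ∧ ∀ v ∈ l, v ∈ S := by
  have hYX : Y ∪ X = S := by rw [Finset.union_comm, hXY]
  have hS : ∀ v ∈ S, v ∉ X → v ∈ Y := fun v hv hvX =>
    (Finset.mem_union.1 (hXY.symm ▸ hv : v ∈ X ∪ Y)).resolve_left hvX
  rcases Nat.even_or_odd' m with ⟨j, rfl | rfl⟩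
  · have hne : ¬ (a ∈ X ↔ b ∈ X) := fun h1 => by
      have := hpar.1 h1
      rw [← Nat.not_even_iff_odd] at this
      exact this (even_two_mul j)
    by_cases haX : a ∈ X
    · have hbX : b ∉ X := fun hb' => hne ⟨fun _ => hb', fun _ => haX⟩
      exact h.exists_odd_link hk hXY hX hY haX (hS b hb hbX) hab (by omega) (by omega)
    · have hbX : b ∈ X := by
        by_contra hb'
        exact hne ⟨fun h1 => absurd h1 haX, fun h1 => absurd h1 hb'⟩
      exact h.exists_odd_link hk hYX hY hX (hS a ha haX) hbX hab (by omega) (by omega)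
  · have heq : a ∈ X ↔ b ∈ X := hpar.2 (odd_two_mul_add_one j)
    have hcn : 4 * k ≤ (commonNbrs G S a b).card := by
      by_cases haX : a ∈ X
      · exact h.card_commonNbrs_of_same_side hk hXY hX hY haX (heq.1 haX) hab
      · exact h.card_commonNbrs_of_same_side hk hYX hY hX (hS a ha haX)
          (hS b hb fun hb' => haX (heq.2 hb')) hab
    obtain ⟨l, hl, hlink, hlS⟩ := h.exists_even_link hk hab hcn ∅ (by simp) (j := j + 1)
      (by omega) (by omega)
    exact ⟨l, by omega, hlink, fun v hv => (hlS v hv).1⟩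

theorem IsWellLinked.parity_of_path (h : IsWellLinked G S k) (hk : 2 ≤ k)
    (hG : CycleFree (2 * k + 1) G) (hXY : X ∪ Y = S)
    (hX : ∀ a ∈ X, ∀ b ∈ X, ¬ G.Adj a b) (hY : ∀ a ∈ Y, ∀ b ∈ Y, ¬ G.Adj a b)
    {g : ℕ → V} (hinj : Set.InjOn g (Set.Iic (2 * k)))
    (hadj : ∀ i < 2 * k, G.Adj (g i) (g (i + 1))) (d : ℕ) :
    ∀ i, 0 < d → d < 2 * k → i + d ≤ 2 * k → g i ∈ S → g (i + d) ∈ S →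
      ((g i ∈ X ↔ g (i + d) ∈ X) ↔ Even d) := by
  have hS : ∀ v ∈ S, v ∉ X → v ∈ Y := fun v hv hvX =>
    (Finset.mem_union.1 (hXY.symm ▸ hv : v ∈ X ∪ Y)).resolve_left hvX
  induction d using Nat.strong_induction_on with
  | _ d ih =>
    intro i hd0 hd hid hi hj
    by_cases hmid : ∃ e, 0 < e ∧ e < d ∧ g (i + e) ∈ S
    · obtain ⟨e, he0, hed, heS⟩ := hmid
      obtain ⟨c, rfl⟩ : ∃ c, d = e + c := ⟨d - e, by omega⟩
      have h1 := ih e hed i he0 (by omega) (by omega) hi heS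
      have h2 := ih c (by omega) (i + e) (by omega) (by omega) (by omega) heS
        (by rwa [add_assoc])
      rw [add_assoc] at h2
      rw [Nat.even_add, ← h1, ← h2]
      tauto
    · push Not at hmid
      rcases Nat.lt_or_ge 1 d with h1 | h1
      · by_contra hne
        have hgij : g (i + d) ≠ g i := fun he => by
          have := hinj (by simp only [Set.mem_Iic]; omega) (by simp only [Set.mem_Iic]; omega) he
          omega
        have hpar : Odd (2 * k - d) ↔ ¬ Even d := by
          rw [← Nat.not_even_iff_odd, Nat.even_sub (by omega)]
          simp
        obtain ⟨l, hl, hlink, hlS⟩ := h.exists_link hk hXY hX hY hj hi hgij (m := 2 * k - d)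
          (by omega) (by omega) (by rw [hpar]; tauto)
        have hpath := isLink_of_path hinj hadj (i := i) (j := i + d) (by omega) hid
        refine hG (hpath.hasSubCopy_of_disjoint hlink ?_ (by simp; omega))
        intro v hv hvl
        rw [List.mem_map] at hv
        obtain ⟨t, ht, rfl⟩ := hv
        rw [List.mem_range'_1] at ht
        have := hmid (t - i) (by omega) (by omega)
        rw [show i + (t - i) = t by omega] at this
        exact this (hlS _ hvl)
      · obtain rfl : d = 1 := by omega
        have h2 := hadj i (by omega)
        have h3 : ¬ (g i ∈ X ↔ g (i + 1) ∈ X) := by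
          intro h4
          by_cases h5 : g i ∈ X
          · exact hX _ h5 _ (h4.1 h5) h2
          · exact hY _ (hS _ hi h5) _ (hS _ hj fun h6 => h5 (h4.2 h6)) h2
        simp [h3]

theorem IsWellLinked.notMem_of_path (h : IsWellLinked G S k) (hk : 2 ≤ k)
    (hG : CycleFree (2 * k + 1) G) (hXY : X ∪ Y = S)
    (hX : ∀ a ∈ X, ∀ b ∈ X, ¬ G.Adj a b) (hY : ∀ a ∈ Y, ∀ b ∈ Y, ¬ G.Adj a b)
    {g : ℕ → V} (hinj : Set.InjOn g (Set.Iic (2 * k)))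
    (hadj : ∀ i < 2 * k, G.Adj (g i) (g (i + 1))) (h0 : g 0 ∈ S) (h1 : g (2 * k) ∈ S)
    (hside : ¬ (g 0 ∈ X ↔ g (2 * k) ∈ X)) {i : ℕ} (hi0 : 0 < i) (hi : i < 2 * k) :
    g i ∉ S := by
  intro hS
  have h2 := h.parity_of_path hk hG hXY hX hY hinj hadj i 0 hi0 hi (by omega) h0 (by simpa)
  have h3 := h.parity_of_path hk hG hXY hX hY hinj hadj (2 * k - i) i (by omega) (by omega)
    (by omega) hS (by rwa [show i + (2 * k - i) = 2 * k by omega])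
  rw [show i + (2 * k - i) = 2 * k by omega, Nat.even_sub (by omega)] at h3
  rw [zero_add] at h2
  simp only [even_two, Even.mul_right, true_iff] at h3
  exact hside (by tauto)

end Core

/-- If a bipartite relation `M` is a union of `#T` bicliques, then it has a vertex cover of size
at most `2 * √(#T * #M)`. -/
theorem exists_cover_of_bicliques {V : Type*} [DecidableEq V] (T : Finset V) (M : Finset (V × V))
    (R Q : V → V → Prop) (hM : ∀ p ∈ M, ∃ z ∈ T, R p.1 z ∧ Q z p.2)
    (hRQ : ∀ p ∈ M, ∀ q ∈ M, ∀ z ∈ T, R p.1 z → Q z q.2 → (p.1, q.2) ∈ M) :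
    ∃ (U : Finset V) (s : ℕ), (∀ p ∈ M, p.1 ∈ U ∨ p.2 ∈ U) ∧ U.card ≤ 2 * s ∧
      s ^ 2 ≤ T.card * M.card := by
  classical
  obtain ⟨P, hP, hmax⟩ := Finset.exists_max_image
    (M.powerset.filter fun P : Finset (V × V) => Set.InjOn Prod.fst (P : Set (V × V)) ∧
      Set.InjOn Prod.snd (P : Set (V × V))) Finset.card ⟨∅, by simp⟩
  rw [Finset.mem_filter, Finset.mem_powerset] at hP
  obtain ⟨hPM, hfst, hsnd⟩ := hP
  have hM' : ∀ p, ∃ z, p ∈ M → z ∈ T ∧ R p.1 z ∧ Q z p.2 := fun p => by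
    by_cases hp : p ∈ M
    · exact (hM p hp).imp fun z hz _ => hz
    · exact ⟨p.1, fun h => absurd h hp⟩
  choose ζ hζ using hM'
  refine ⟨P.image Prod.fst ∪ P.image Prod.snd, P.card, ?_, ?_, ?_⟩
  · intro p hp
    by_contra! hcon
    rw [Finset.mem_union, not_or, Finset.mem_union, not_or] at hcon
    have h1 : ∀ q ∈ P, q.1 ≠ p.1 := fun q hq he =>
      hcon.1.1 (he ▸ Finset.mem_image_of_mem Prod.fst hq)
    have h2 : ∀ q ∈ P, q.2 ≠ p.2 := fun q hq he =>
      hcon.2.2 (he ▸ Finset.mem_image_of_mem Prod.snd hq)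
    have hpP : p ∉ P := fun h => h1 p h rfl
    have := hmax (insert p P) (by
      rw [Finset.mem_filter, Finset.mem_powerset, Finset.coe_insert,
        Set.injOn_insert (by simpa using hpP), Set.injOn_insert (by simpa using hpP)]
      refine ⟨Finset.insert_subset hp hPM, ⟨hfst, ?_⟩, hsnd, ?_⟩
      · rintro ⟨q, hq, he⟩; exact h1 q hq he
      · rintro ⟨q, hq, he⟩; exact h2 q hq he)
    rw [Finset.card_insert_of_notMem hpP] at this
    omega
  · have h1 := Finset.card_union_le (P.image Prod.fst) (P.image Prod.snd)
    have h2 := Finset.card_image_le (s := P) (f := Prod.fst)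
    have h3 := Finset.card_image_le (s := P) (f := Prod.snd)
    omega
  · have hsum : P.card = ∑ z ∈ T, (P.filter fun p => ζ p = z).card :=
      Finset.card_eq_sum_card_fiberwise fun p hp => (hζ p (hPM hp)).1
    have hsq : ∑ z ∈ T, (P.filter fun p => ζ p = z).card ^ 2 ≤ M.card := by
      have h1 : ∑ z ∈ T, (P.filter fun p => ζ p = z).card ^ 2 =
          (T.sigma fun z => (P.filter fun p => ζ p = z) ×ˢ (P.filter fun p => ζ p = z)).card := by
        rw [Finset.card_sigma]
        simp [sq]
      rw [h1]
      refine Finset.card_le_card_of_injOn (fun x => (x.2.1.1, x.2.2.2)) ?_ ?_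
      · rintro ⟨z, p, q⟩ hx
        simp only [Finset.coe_sigma, Set.mem_sigma_iff, Finset.mem_coe, Finset.mem_product,
          Finset.mem_filter] at hx
        obtain ⟨hz, ⟨hp, hpz⟩, hq, hqz⟩ := hx
        exact hRQ p (hPM hp) q (hPM hq) z hz (hpz ▸ (hζ p (hPM hp)).2.1) (hqz ▸ (hζ q (hPM hq)).2.2)
      · rintro ⟨z, p, q⟩ hx ⟨z', p', q'⟩ hx' he
        simp only [Finset.coe_sigma, Set.mem_sigma_iff, Finset.mem_coe, Finset.mem_product,
          Finset.mem_filter] at hx hx'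
        simp only [Prod.mk.injEq] at he
        obtain ⟨hz, ⟨hp, hpz⟩, hq, hqz⟩ := hx
        obtain ⟨hz', ⟨hp', hpz'⟩, hq', hqz'⟩ := hx'
        obtain rfl := hfst hp hp' he.1
        obtain rfl := hsnd hq hq' he.2
        obtain rfl := hpz.symm.trans hpz'
        rfl
    calc P.card ^ 2 = (∑ z ∈ T, (P.filter fun p => ζ p = z).card) ^ 2 := by rw [← hsum]
      _ ≤ T.card * ∑ z ∈ T, (P.filter fun p => ζ p = z).card ^ 2 := sq_sum_le_card_mul_sum_sq
      _ ≤ T.card * M.card := Nat.mul_le_mul_left _ hsq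

/-- The ordered pairs of adjacent vertices of `S`. -/
def adjPairs {V : Type*} (G : SimpleGraph V) [DecidableRel G.Adj] (S : Finset V) :
    Finset (V × V) :=
  (S ×ˢ S).filter fun p => G.Adj p.1 p.2

section Counting

variable {V : Type*} {G : SimpleGraph V} [DecidableRel G.Adj]

theorem mem_adjPairs {S : Finset V} {p : V × V} :
    p ∈ adjPairs G S ↔ (p.1 ∈ S ∧ p.2 ∈ S) ∧ G.Adj p.1 p.2 := by
  simp [adjPairs]

theorem card_adjPairs_le (S : Finset V) : (adjPairs G S).card ≤ S.card ^ 2 := by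
  rw [sq, ← Finset.card_product]
  exact Finset.card_filter_le _ _

theorem card_adjPairs_univ [Fintype V] :
    (adjPairs G Finset.univ).card = 2 * G.edgeSet.ncard := by
  have h1 : (adjPairs G Finset.univ).card = ∑ v, G.degree v := by
    rw [adjPairs, Finset.card_filter, Finset.sum_product]
    refine Finset.sum_congr rfl fun v _ => ?_
    rw [← Finset.card_filter, ← card_neighborFinset_eq_degree, neighborFinset_eq_filter]
  rw [h1, sum_degrees_eq_twice_card_edges, ← coe_edgeFinset, Set.ncard_coe_finset]

variable [DecidableEq V]

theorem card_adjPairs_le_erase {S : Finset V} {v : V} :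
    (adjPairs G S).card ≤ (adjPairs G (S.erase v)).card + 2 * (commonNbrs G S v v).card := by
  have hsub : adjPairs G S ⊆ adjPairs G (S.erase v) ∪
      ((commonNbrs G S v v).image (fun w => (v, w)) ∪
        (commonNbrs G S v v).image (fun w => (w, v))) := by
    rintro ⟨a, b⟩ hab
    rw [mem_adjPairs] at hab
    simp only at hab
    simp only [Finset.mem_union, Finset.mem_image, mem_adjPairs, mem_commonNbrs, Finset.mem_erase,
      Prod.mk.injEq]
    by_cases ha : a = v
    · subst ha
      exact Or.inr (Or.inl ⟨b, by tauto, rfl, rfl⟩)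
    by_cases hb : b = v
    · subst hb
      exact Or.inr (Or.inr ⟨a, ⟨hab.1.1, hab.2.symm, hab.2.symm⟩, rfl, rfl⟩)
    · exact Or.inl (by tauto)
  have h1 := Finset.card_le_card hsub
  have h2 := Finset.card_union_le (adjPairs G (S.erase v))
    ((commonNbrs G S v v).image (fun w => (v, w)) ∪ (commonNbrs G S v v).image (fun w => (w, v)))
  have h3 := Finset.card_union_le ((commonNbrs G S v v).image (fun w => (v, w)))
    ((commonNbrs G S v v).image (fun w => (w, v)))
  have h4 := Finset.card_image_le (s := commonNbrs G S v v) (f := fun w => (v, w))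
  have h5 := Finset.card_image_le (s := commonNbrs G S v v) (f := fun w => (w, v))
  omega

theorem card_adjPairs_univ_le [Fintype V] (S : Finset V) :
    (adjPairs G Finset.univ).card ≤ (adjPairs G S).card + 2 * (Sᶜ.card * Fintype.card V) := by
  have hsub : adjPairs G Finset.univ ⊆ adjPairs G S ∪
      (Sᶜ ×ˢ Finset.univ ∪ Finset.univ ×ˢ Sᶜ) := by
    rintro ⟨a, b⟩ hab
    rw [mem_adjPairs] at hab
    simp only [Finset.mem_union, Finset.mem_product, Finset.mem_compl, mem_adjPairs,
      Finset.mem_univ] at hab ⊢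
    tauto
  have h1 := Finset.card_le_card hsub
  have h2 := Finset.card_union_le (adjPairs G S) (Sᶜ ×ˢ Finset.univ ∪ Finset.univ ×ˢ Sᶜ)
  have h3 := Finset.card_union_le (Sᶜ ×ˢ (Finset.univ : Finset V)) (Finset.univ ×ˢ Sᶜ)
  rw [Finset.card_product, Finset.card_product, Finset.card_univ, mul_comm (Fintype.card V)] at h3
  omega

theorem card_adjPairs_le_of_bipartition {X Y : Finset V}
    (hX : ∀ a ∈ X, ∀ b ∈ X, ¬ G.Adj a b) (hY : ∀ a ∈ Y, ∀ b ∈ Y, ¬ G.Adj a b) :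
    (adjPairs G (X ∪ Y)).card ≤ 2 * ((X ×ˢ Y).filter fun p => G.Adj p.1 p.2).card := by
  have hsub : adjPairs G (X ∪ Y) ⊆ ((X ×ˢ Y).filter fun p => G.Adj p.1 p.2) ∪
      ((X ×ˢ Y).filter fun p => G.Adj p.1 p.2).image Prod.swap := by
    rintro ⟨a, b⟩ hab
    rw [mem_adjPairs] at hab
    simp only [Finset.mem_union] at hab
    simp only [Finset.mem_union, Finset.mem_filter, Finset.mem_product, Finset.mem_image,
      Prod.exists, Prod.swap_prod_mk, Prod.mk.injEq]
    obtain ⟨⟨ha | ha, hb | hb⟩, hadj⟩ := hab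
    · exact absurd hadj (hX a ha b hb)
    · exact Or.inl ⟨⟨ha, hb⟩, hadj⟩
    · exact Or.inr ⟨b, a, ⟨⟨hb, ha⟩, hadj.symm⟩, rfl, rfl⟩
    · exact absurd hadj (hY a ha b hb)
  have h1 := Finset.card_le_card hsub
  have h2 := Finset.card_union_le ((X ×ˢ Y).filter fun p => G.Adj p.1 p.2)
    (((X ×ˢ Y).filter fun p => G.Adj p.1 p.2).image Prod.swap)
  have h3 := Finset.card_image_le (s := (X ×ˢ Y).filter fun p => G.Adj p.1 p.2) (f := Prod.swap)
  omega

/-- A vertex set that maximizes the surplus of edges over density `9 / 20` has large minimum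
degree. -/
theorem exists_large_minDegree [Fintype V] (G : SimpleGraph V) [DecidableRel G.Adj] :
    ∃ S : Finset V, (∀ v ∈ S, 18 * S.card ≤ 40 * (commonNbrs G S v v).card + 9) ∧
      20 * (adjPairs G Finset.univ).card + 9 * S.card ^ 2 ≤
        20 * (adjPairs G S).card + 9 * Fintype.card V ^ 2 := by
  obtain ⟨S, -, hmax⟩ := Finset.exists_max_image (Finset.univ : Finset (Finset V))
    (fun S => 20 * ((adjPairs G S).card : ℤ) - 9 * (S.card : ℤ) ^ 2) ⟨∅, Finset.mem_univ _⟩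
  refine ⟨S, ?_, ?_⟩
  · intro v hv
    have h1 := hmax (S.erase v) (Finset.mem_univ _)
    have h2 := card_adjPairs_le_erase (G := G) (S := S) (v := v)
    have h3 : ((S.erase v).card : ℤ) = S.card - 1 := by
      rw [Finset.card_erase_of_mem hv, Nat.cast_sub (Finset.card_pos.2 ⟨v, hv⟩)]; simp
    simp only [h3] at h1
    zify at h2 ⊢
    nlinarith
  · have h1 := hmax Finset.univ (Finset.mem_univ _)
    simp only [Finset.card_univ] at h1
    zify
    linarith

theorem isWellLinked_of_minDegree {S : Finset V} {k : ℕ} (hS : 100 * k ≤ S.card)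
    (hdeg : ∀ v ∈ S, 18 * S.card ≤ 40 * (commonNbrs G S v v).card + 9) :
    IsWellLinked G S k := by
  refine ⟨fun v hv => by have := hdeg v hv; omega, fun a ha b hb c hc _ _ _ => ?_⟩
  have hinter : ∀ x y, commonNbrs G S x x ∩ commonNbrs G S y y = commonNbrs G S x y := by
    intro x y; ext w; simp only [Finset.mem_inter, mem_commonNbrs]; tauto
  have h1 := Finset.card_union_add_card_inter (commonNbrs G S a a) (commonNbrs G S b b)
  have h2 := Finset.card_union_add_card_inter (commonNbrs G S a a ∪ commonNbrs G S b b)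
    (commonNbrs G S c c)
  rw [Finset.union_inter_distrib_right, hinter, hinter] at h2
  rw [hinter] at h1
  have h3 := Finset.card_union_le (commonNbrs G S a c) (commonNbrs G S b c)
  have h4 : (commonNbrs G S a a ∪ commonNbrs G S b b ∪ commonNbrs G S c c).card ≤ S.card :=
    Finset.card_le_card (Finset.union_subset (Finset.union_subset (Finset.filter_subset _ _)
      (Finset.filter_subset _ _)) (Finset.filter_subset _ _))
  have := hdeg a ha
  have := hdeg b hb
  have := hdeg c hc
  omega

end Counting

/-- The vertices outside a well linked bipartite set `S` account for all missing edges of `S`, and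
few vertices of `S` meet all of them. -/
theorem exists_cover_of_maximalCycleFree {V : Type*} [Fintype V] [DecidableEq V]
    {G : SimpleGraph V} [DecidableRel G.Adj] {S X Y : Finset V} {k : ℕ} (h : IsWellLinked G S k)
    (hk : 2 ≤ k) (hG : MaximalCycleFree (2 * k + 1) G) (hdisj : Disjoint X Y) (hXY : X ∪ Y = S)
    (hX : ∀ a ∈ X, ∀ b ∈ X, ¬ G.Adj a b) (hY : ∀ a ∈ Y, ∀ b ∈ Y, ¬ G.Adj a b) :
    ∃ (U : Finset V) (s : ℕ), (∀ x ∈ X, ∀ y ∈ Y, ¬ G.Adj x y → x ∈ U ∨ y ∈ U) ∧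
      U.card ≤ 2 * s ∧
      s ^ 2 ≤ Sᶜ.card * ((X ×ˢ Y).filter fun p => ¬ G.Adj p.1 p.2).card := by
  have hcover := exists_cover_of_bicliques Sᶜ
    ((X ×ˢ Y).filter fun p => ¬ G.Adj p.1 p.2) (fun x z => G.Adj x z)
    (fun z y => ∃ l : List V, l.length + 2 = 2 * k ∧ IsLink G z y l ∧ ∀ v ∈ l, v ∉ S) ?_ ?_
  · obtain ⟨U, s, hU, hUs, hs⟩ := hcover
    refine ⟨U, s, fun x hx y hy hxy => hU (x, y) ?_, hUs, hs⟩
    rw [Finset.mem_filter, Finset.mem_product]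
    exact ⟨⟨hx, hy⟩, hxy⟩
  · rintro ⟨x, y⟩ hp
    rw [Finset.mem_filter, Finset.mem_product] at hp
    obtain ⟨⟨hx, hy⟩, hxy⟩ := hp
    simp only at hx hy hxy
    have hyX : y ∉ X := Finset.disjoint_right.1 hdisj hy
    obtain ⟨g, hinj, hadj, h0, h1⟩ := exists_path_of_hasSubCopy_sup hG.1
      (hG.2 x y (fun he => hyX (he ▸ hx)) hxy) (by omega)
    have hout : ∀ i, 0 < i → i < 2 * k → g i ∉ S := fun i hi0 hi =>
      h.notMem_of_path hk hG.1 hXY hX hY hinj hadj (h0 ▸ hXY ▸ Finset.mem_union_left _ hx)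
        (h1 ▸ hXY ▸ Finset.mem_union_right _ hy) (by rw [h0, h1]; tauto) hi0 hi
    refine ⟨g 1, Finset.mem_compl.2 (hout 1 (by omega) (by omega)), ?_, ?_⟩
    · have := hadj 0 (by omega)
      rwa [h0] at this
    · have hl := isLink_of_path hinj hadj (i := 1) (j := 2 * k) (by omega) le_rfl
      rw [h1] at hl
      refine ⟨_, by simp; omega, hl, ?_⟩
      intro v hv
      rw [List.mem_map] at hv
      obtain ⟨t, ht, rfl⟩ := hv
      rw [List.mem_range'_1] at ht
      exact hout t (by omega) (by omega)
  · rintro ⟨x, y'⟩ hp ⟨x', y⟩ hq z hz hxz ⟨l, hl, hlink, hlS⟩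
    rw [Finset.mem_filter, Finset.mem_product] at hp hq ⊢
    refine ⟨⟨hp.1.1, hq.1.2⟩, fun hadj => hG.1 ?_⟩
    simp only at hp hq hadj hxz hlink
    have hxS : x ∈ S := hXY ▸ Finset.mem_union_left _ hp.1.1
    have h0 : IsLink G x z [] := ⟨by simpa using hxz.ne, by simpa using hxz⟩
    refine (h0.append hlink ?_).hasSubCopy hadj.symm (by simp; omega)
    intro v hv
    simp only [List.mem_cons, List.not_mem_nil, or_false] at hv
    subst hv
    rw [List.mem_append, List.mem_singleton, not_or]
    exact ⟨fun hv => hlS _ hv hxS, hadj.ne⟩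

theorem isInducedCompleteBipartiteOn_sdiff {V : Type*} [DecidableEq V] {G : SimpleGraph V}
    {X Y U : Finset V} (hdisj : Disjoint X Y) (hX : ∀ a ∈ X, ∀ b ∈ X, ¬ G.Adj a b)
    (hY : ∀ a ∈ Y, ∀ b ∈ Y, ¬ G.Adj a b)
    (hU : ∀ x ∈ X, ∀ y ∈ Y, ¬ G.Adj x y → x ∈ U ∨ y ∈ U) :
    IsInducedCompleteBipartiteOn G (((X ∪ Y) \ U : Finset V) : Set V) := by
  refine ⟨((X \ U : Finset V) : Set V), ((Y \ U : Finset V) : Set V), ?_, ?_, ?_⟩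
  · rw [Finset.disjoint_coe]
    exact hdisj.mono Finset.sdiff_subset Finset.sdiff_subset
  · rw [← Finset.coe_union, ← Finset.union_sdiff_distrib]
  · intro u hu v hv
    simp only [Finset.mem_coe, Finset.mem_sdiff, Finset.mem_union] at hu hv ⊢
    constructor
    · intro hadj
      rcases hu.1 with h1 | h1 <;> rcases hv.1 with h2 | h2
      · exact absurd hadj (hX u h1 v h2)
      · exact Or.inl ⟨⟨h1, hu.2⟩, h2, hv.2⟩
      · exact Or.inr ⟨⟨h1, hu.2⟩, h2, hv.2⟩
      · exact absurd hadj (hY u h1 v h2)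
    · rintro (⟨h1, h2⟩ | ⟨h1, h2⟩)
      · by_contra hadj
        exact (hU u h1.1 v h2.1 hadj).elim h1.2 h2.2
      · by_contra hadj
        exact (hU v h2.1 u h1.1 fun h => hadj h.symm).elim h2.2 h1.2

section Bounds

variable {r ε e p σ : ℝ}

theorem sq_le_four_mul_of_surplus (hr : 1 ≤ r) (hε : ε * 8000 < 1)
    (he : r ^ 4 / 4 - ε * r ^ 3 ≤ e) (hsur : 20 * (2 * e) + 9 * σ ^ 2 ≤ 20 * p + 9 * r ^ 4)
    (hp : p ≤ σ ^ 2) (hσ : 0 ≤ σ) : r ^ 2 ≤ 4 * σ := by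
  have h1 : r ^ 3 ≤ r ^ 4 := pow_le_pow_right₀ hr (by norm_num)
  have h2 : ε * 8000 * r ^ 3 ≤ 1 * r ^ 3 := mul_le_mul_of_nonneg_right hε.le (by positivity)
  refine (abs_le_of_sq_le_sq' ?_ (by positivity)).2
  have h3 : (r ^ 2) ^ 2 = r ^ 4 := by ring
  have h4 : 0 ≤ r ^ 4 := by positivity
  linarith

theorem bounds_of_surplus {t x y a m : ℝ} (hr : 1 ≤ r)
    (he : r ^ 4 / 4 - ε * r ^ 3 ≤ e) (hsur : 20 * (2 * e) + 9 * σ ^ 2 ≤ 20 * p + 9 * r ^ 4)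
    (hp : p ≤ 2 * a) (ham : a + m = x * y) (hxy : x + y = σ) (ht : t + σ = r ^ 2)
    (hep : 2 * e ≤ p + 2 * (t * r ^ 2)) (hσ : 0 ≤ σ) (ht0 : 0 ≤ t) (hm : 0 ≤ m) :
    t ≤ 40 * ε * r ∧ m ≤ 41 * ε * r ^ 3 := by
  have hxy4 : 4 * (x * y) ≤ σ ^ 2 := by
    rw [← hxy]
    linarith [sq_nonneg (x - y)]
  have h1 : r ^ 4 - σ ^ 2 = t * r ^ 2 + t * σ := by
    linear_combination (-r ^ 2 - σ) * ht
  have h2 : 0 ≤ t * σ := mul_nonneg ht0 hσ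
  have h3 : t * r ^ 2 ≤ 40 * (ε * r ^ 3) := by linarith
  have h4 : 0 ≤ t * r ^ 2 := by positivity
  refine ⟨le_of_mul_le_mul_right ?_ (by positivity : 0 < r ^ 2), by linarith⟩
  linarith

end Bounds

theorem stmt_1 (k : ℕ) (hk : 2 ≤ k) (n : ℕ) (hn : (2 * k) ^ (9 * k ^ 2) ≤ n)
    (ε : ℝ) (hε : 0 < ε) (hε' : ε < 1 / (2000 * (k : ℝ) ^ 2))
    (G : SimpleGraph (Fin n)) (hG : MaximalCycleFree (2 * k + 1) G)
    (he : (n : ℝ) ^ 2 / 4 - ε * (n : ℝ) ^ ((3 : ℝ) / 2) ≤ (G.edgeSet.ncard : ℝ)) :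
    ∃ S : Set (Fin n), IsInducedCompleteBipartiteOn G S ∧
      (1 - 250 * (k : ℝ) ^ 2 * ε) * (n : ℝ) ≤ (S.ncard : ℝ) := by
  classical
  obtain ⟨r, hr0, hr⟩ : ∃ r : ℝ, 0 ≤ r ∧ (n : ℝ) = r ^ 2 :=
    ⟨√n, Real.sqrt_nonneg _, (Real.sq_sqrt (Nat.cast_nonneg n)).symm⟩
  have hnk : 400 * k ≤ n := by
    refine le_trans ?_ hn
    calc 400 * k ≤ 4 ^ 8 * (2 * k) := by omega
      _ ≤ (2 * k) ^ 8 * (2 * k) := Nat.mul_le_mul_right _ (Nat.pow_le_pow_left (by omega) 8)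
      _ = (2 * k) ^ 9 := by ring
      _ ≤ (2 * k) ^ (9 * k ^ 2) := Nat.pow_le_pow_right (by omega) (by nlinarith)
  have hk4 : (4 : ℝ) ≤ (k : ℝ) ^ 2 := by exact_mod_cast Nat.pow_le_pow_left hk 2
  have hε1 : ε * 8000 < 1 := by
    rw [lt_div_iff₀ (by positivity)] at hε'
    linarith [mul_le_mul_of_nonneg_left hk4 hε.le]
  have hr1 : 1 ≤ r := by
    rw [← one_le_sq_iff₀ hr0, ← hr]
    exact_mod_cast (by omega : 1 ≤ n)
  have he4 : r ^ 4 / 4 - ε * r ^ 3 ≤ (G.edgeSet.ncard : ℝ) := by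
    have h3 : (n : ℝ) ^ ((3 : ℝ) / 2) = r ^ 3 := by
      rw [hr, ← Real.rpow_natCast r 2, ← Real.rpow_mul hr0, ← Real.rpow_natCast r 3]
      norm_num
    rw [h3, hr] at he
    linarith
  have hn2 : (n : ℝ) ^ 2 = r ^ 4 := by rw [hr]; ring
  obtain ⟨S, hdeg, hsur⟩ := exists_large_minDegree G
  rw [Fintype.card_fin, card_adjPairs_univ] at hsur
  have hsurR : 20 * (2 * (G.edgeSet.ncard : ℝ)) + 9 * (S.card : ℝ) ^ 2 ≤
      20 * ((adjPairs G S).card : ℝ) + 9 * r ^ 4 := by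
    rw [← hn2]
    exact_mod_cast hsur
  have hSk : 100 * k ≤ S.card := by
    have h1 : (n : ℝ) ≤ 4 * S.card := by
      rw [hr]
      exact sq_le_four_mul_of_surplus hr1 hε1 he4 hsurR
        (by exact_mod_cast card_adjPairs_le (G := G) S) (Nat.cast_nonneg _)
    have h2 : n ≤ 4 * S.card := by exact_mod_cast h1
    omega
  have hlink := isWellLinked_of_minDegree hSk hdeg
  obtain ⟨X, Y, hdisj, hXY, hX, hY⟩ := hlink.exists_bipartition hk hG.1
    (Finset.card_pos.1 (by omega))
  obtain ⟨U, s, hU, hUs, hs⟩ := exists_cover_of_maximalCycleFree hlink hk hG hdisj hXY hX hY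
  have hES := card_adjPairs_le_of_bipartition hX hY
  rw [hXY] at hES
  have hEV := card_adjPairs_univ_le (G := G) S
  rw [Fintype.card_fin, card_adjPairs_univ] at hEV
  have hsplit := Finset.card_filter_add_card_filter_not (s := X ×ˢ Y) (fun p => G.Adj p.1 p.2)
  rw [Finset.card_product] at hsplit
  have hXYc : X.card + Y.card = S.card := by rw [← hXY, Finset.card_union_of_disjoint hdisj]
  have hT : Sᶜ.card + S.card = n := by
    rw [add_comm, Finset.card_add_card_compl, Fintype.card_fin]
  generalize ((X ×ˢ Y).filter fun p => ¬ G.Adj p.1 p.2).card = m at hs hsplit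
  generalize ((X ×ˢ Y).filter fun p => G.Adj p.1 p.2).card = a at hES hsplit
  generalize Sᶜ.card = t at hs hEV hT
  have hTR : (t : ℝ) + S.card = r ^ 2 := by
    rw [← hr]
    exact_mod_cast hT
  have hEVR : 2 * (G.edgeSet.ncard : ℝ) ≤ (adjPairs G S).card + 2 * (t * r ^ 2) := by
    rw [← hr]
    exact_mod_cast hEV
  obtain ⟨ht, hm⟩ := bounds_of_surplus (t := t) (x := X.card) (y := Y.card) (a := a) (m := m)
    hr1 he4 hsurR (by exact_mod_cast hES) (by exact_mod_cast hsplit) (by exact_mod_cast hXYc) hTR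
    hEVR (Nat.cast_nonneg _) (Nat.cast_nonneg _) (Nat.cast_nonneg _)
  have hsb : (s : ℝ) ≤ 41 * ε * r ^ 2 := by
    refine (abs_le_of_sq_le_sq' ?_ (by positivity)).2
    calc (s : ℝ) ^ 2 ≤ t * m := by exact_mod_cast hs
      _ ≤ (40 * ε * r) * (41 * ε * r ^ 3) := by gcongr
      _ ≤ (41 * ε * r ^ 2) ^ 2 := by linarith [sq_nonneg (ε * r ^ 2)]
  refine ⟨_, isInducedCompleteBipartiteOn_sdiff hdisj hX hY hU, ?_⟩
  rw [Set.ncard_coe_finset, hXY]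
  have h1 := Finset.le_card_sdiff U S
  have h2 : (S.card : ℝ) ≤ (S \ U).card + 2 * s := by
    exact_mod_cast (by omega : S.card ≤ (S \ U).card + 2 * s)
  have h3 : ε * r ≤ ε * r ^ 2 := mul_le_mul_of_nonneg_left (le_self_pow₀ hr1 two_ne_zero) hε.le
  have h5 : 0 ≤ ε * r ^ 2 := by positivity
  have h4 : 4 * (ε * r ^ 2) ≤ (k : ℝ) ^ 2 * (ε * r ^ 2) := mul_le_mul_of_nonneg_right hk4 h5
  rw [hr]
  linarith
end

section
/- Let k ≥ 2 be an integer and let G be a C_{2k+1}-free graph containing a cycle C = v_1 v_2 … v_{2k} v_1 of length 2k. Then there do not exist three distinct vertices x, y, z ∈ V(G) \ {v_1,…,v_{2k}} such that x is adjacent to both y and z, y is adjacent to v_{2i−1} for every i = 1,…,k, and z is adjacent to v_{2i} for every i = 1,…,k. -/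
open SimpleGraph

/-- An injective map on `{0, …, n - 1}` sending cyclically consecutive numbers to adjacent
vertices gives a copy of the cycle on `n` vertices. -/
theorem hasSubCopy_cycleGraph_of_nat {V : Type*} {G : SimpleGraph V} {n : ℕ} (f : ℕ → V)
    (hinj : ∀ i < n, ∀ j < n, f i = f j → i = j)
    (hstep : ∀ i, i + 1 < n → G.Adj (f i) (f (i + 1)))
    (hlast : G.Adj (f (n - 1)) (f 0)) :
    HasSubCopy (cycleGraph n) G := by
  have key : ∀ a b : Fin n, (a - b).val = 1 → G.Adj (f b) (f a) := by
    intro a b h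
    have ha := a.isLt
    have hb := b.isLt
    rw [Fin.val_sub] at h
    have hab : a.val = b.val + 1 ∨ (a.val = 0 ∧ b.val = n - 1) := by
      by_cases hlt : n - b.val + a.val < n
      · rw [Nat.mod_eq_of_lt hlt] at h
        omega
      · rw [Nat.mod_eq_sub_mod (by omega), Nat.mod_eq_of_lt (by omega)] at h
        omega
    rcases hab with hab | ⟨ha0, hbn⟩
    · rw [hab]
      exact hstep _ (by omega)
    · rw [ha0, hbn]
      exact hlast
  refine ⟨⟨fun i => f i, ?_⟩, fun i j hij => Fin.ext (hinj _ i.isLt _ j.isLt hij)⟩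
  intro a b hab
  rcases cycleGraph_adj'.mp hab with h | h
  · exact (key a b h).symm
  · exact key b a h

/-- In a `C_{2k+1}`-free graph with a cycle `v 0, v 1, …, v (2k-1), v 0` of length `2k`
(`v i` here is `v_{i+1}` in 1-indexed notation, so `v_{2i-1}` for `i = 1, …, k` are
`v 0, v 2, …, v (2k-2)` and `v_{2i}` for `i = 1, …, k` are `v 1, v 3, …, v (2k-1)`),
there are no three distinct outside vertices `x, y, z` with `x` adjacent to both `y`
and `z`, `y` adjacent to all of `v 0, v 2, …, v (2k-2)`, and `z` adjacent to all of
`v 1, v 3, …, v (2k-1)`. -/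
theorem stmt_10 {V : Type*} (k : ℕ) (hk : 2 ≤ k)
    (G : SimpleGraph V) (hG : CycleFree (2 * k + 1) G)
    (v : ℕ → V)
    (hinj : ∀ i < 2 * k, ∀ j < 2 * k, v i = v j → i = j)
    (hcyc : ∀ i < 2 * k, G.Adj (v i) (v ((i + 1) % (2 * k)))) :
    ¬ ∃ x y z : V,
        x ≠ y ∧ x ≠ z ∧ y ≠ z ∧
        (∀ i < 2 * k, x ≠ v i) ∧ (∀ i < 2 * k, y ≠ v i) ∧ (∀ i < 2 * k, z ≠ v i) ∧
        G.Adj x y ∧ G.Adj x z ∧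
        (∀ i < k, G.Adj y (v (2 * i))) ∧ (∀ i < k, G.Adj z (v (2 * i + 1))) := by
  rintro ⟨x, y, z, hxy, hxz, hyz, hx, hy, hz, axy, axz, ay, az⟩
  obtain ⟨m, rfl⟩ : ∃ m, k = m + 2 := ⟨k - 2, by omega⟩
  -- the cycle `v 0, v 1, …, v (2k-3), z, x, y`
  refine hG (hasSubCopy_cycleGraph_of_nat
    (fun i => if i < 2 * m + 2 then v i else if i = 2 * m + 2 then z
      else if i = 2 * m + 3 then x else y) ?_ ?_ ?_)
  · intro i hi j hj hij
    have hv : i < 2 * (m + 2) → j < 2 * (m + 2) → v i = v j → i = j :=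
      fun h h' => hinj i h j h'
    have hxi := hx i
    have hxj := hx j
    have hyi := hy i
    have hyj := hy j
    have hzi := hz i
    have hzj := hz j
    grind
  · intro i hi
    obtain h | rfl | rfl | rfl : i < 2 * m + 1 ∨ i = 2 * m + 1 ∨ i = 2 * m + 2 ∨ i = 2 * m + 3 := by
      omega
    · have hadj := hcyc i (by omega)
      rw [Nat.mod_eq_of_lt (by omega)] at hadj
      simpa [show i < 2 * m + 2 by omega, show i + 1 < 2 * m + 2 by omega] using hadj
    · simpa using (az m (by omega)).symm
    · simpa using axz.symm
    · simpa using axy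
  · have h0 := ay 0 (by omega)
    have e : 2 * (m + 2) + 1 - 1 = 2 * m + 4 := by omega
    simpa [e] using h0
end

section
/- For all integers k ≥ 2 and n ≥ 4k, the maximum number of edges of a C_{2k+1}-free graph on n vertices equals ⌊n²/4⌋; moreover, the unique extremal graph is the balanced complete bipartite graph: every C_{2k+1}-free graph on n vertices with exactly ⌊n²/4⌋ edges is isomorphic to the complete bipartite graph K_{⌈n/2⌉,⌊n/2⌋}. -/
open SimpleGraph

section Cycles

variable {V : Type*} {G : SimpleGraph V} {m c : ℕ} {f : ℕ → V}

/-- `f` runs periodically around a cycle of length `m` in `G`; for `m = 2` it runs back and forth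
along an edge. -/
structure IsCyc (G : SimpleGraph V) (m : ℕ) (f : ℕ → V) : Prop where
  two_le : 2 ≤ m
  adj : ∀ i, G.Adj (f i) (f (i + 1))
  per : ∀ i, f (i + m) = f i
  inj : ∀ i j, i < m → j < m → f i = f j → i = j

theorem IsCyc.of_injOn {g : ℕ → V} (hm : 2 ≤ m)
    (hadj : ∀ i, i + 1 < m → G.Adj (g i) (g (i + 1))) (hclose : G.Adj (g (m - 1)) (g 0))
    (hinj : ∀ i j, i < j → j < m → g i ≠ g j) : IsCyc G m (fun i => g (i % m)) where
  two_le := hm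
  adj i := by
    have hi : i % m < m := Nat.mod_lt _ (by omega)
    rcases Nat.lt_or_ge (i % m + 1) m with h | h
    · have : (i + 1) % m = i % m + 1 := by
        rw [Nat.add_mod, Nat.mod_eq_of_lt (a := 1) (by omega), Nat.mod_eq_of_lt h]
      simpa [this] using hadj _ h
    · have h1 : i % m = m - 1 := by omega
      have h2 : (i + 1) % m = 0 := by
        rw [← Nat.mod_add_mod, h1, Nat.sub_add_cancel (by omega), Nat.mod_self]
      simpa [h1, h2] using hclose
  per i := by simp
  inj i j hi hj h := by
    simp only [Nat.mod_eq_of_lt hi, Nat.mod_eq_of_lt hj] at h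
    rcases Nat.lt_trichotomy i j with h1 | h1 | h1
    · exact absurd h (hinj _ _ h1 hj)
    · exact h1
    · exact absurd h.symm (hinj _ _ h1 hi)

theorem IsCyc.of_list {l : List V} (hl : 2 ≤ l.length) (hnd : l.Nodup) (hch : l.IsChain G.Adj)
    (hne : l ≠ []) (hclose : G.Adj (l.getLast hne) (l.head hne)) :
    ∃ f, IsCyc G l.length f := by
  have hget (i : ℕ) (hi : i < l.length) : l.getD i (l.head hne) = l[i] := by
    simp [List.getD, hi]
  refine ⟨_, IsCyc.of_injOn (g := fun i => l.getD i (l.head hne)) hl ?_ ?_ ?_⟩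
  · intro i hi
    simp only [hget i (by omega), hget (i + 1) hi]
    exact List.isChain_iff_getElem.1 hch i hi
  · simp only [hget (l.length - 1) (by omega), hget 0 (by omega)]
    rwa [List.getLast_eq_getElem, List.head_eq_getElem] at hclose
  · intro i j hij hj h
    simp only [hget i (by omega), hget j hj] at h
    have := (hnd.getElem_inj_iff).1 h
    omega

namespace IsCyc

theorem pos (h : IsCyc G m f) : 0 < m := by have := h.two_le; omega

theorem apply_mod (h : IsCyc G m f) (i : ℕ) : f (i % m) = f i :=
  Function.Periodic.map_mod_nat (f := f) h.per i

theorem mod_eq (h : IsCyc G m f) {i j : ℕ} (hij : f i = f j) : i % m = j % m :=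
  h.inj _ _ (Nat.mod_lt _ h.pos) (Nat.mod_lt _ h.pos) (by rw [h.apply_mod, h.apply_mod, hij])

theorem ne (h : IsCyc G m f) {i j : ℕ} (hij : i < j) (hj : j < i + m) : f i ≠ f j := fun e => by
  have h1 := h.mod_eq e
  have h2 := (Nat.modEq_iff_dvd' hij.le).1 h1
  exact absurd (Nat.le_of_dvd (by omega) h2) (by omega)

theorem shift (h : IsCyc G m f) (s : ℕ) : IsCyc G m (fun i => f (i + s)) where
  two_le := h.two_le
  adj i := by simpa [Nat.add_right_comm] using h.adj (i + s)
  per i := by simpa [Nat.add_right_comm] using h.per (i + s)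
  inj i j hi hj e := by
    rcases Nat.lt_trichotomy i j with h1 | h1 | h1
    · exact absurd e (h.ne (by omega) (by omega))
    · exact h1
    · exact absurd e.symm (h.ne (by omega) (by omega))

theorem hasSubCopy (h : IsCyc G m f) (hm : 3 ≤ m) : HasSubCopy (cycleGraph m) G := by
  obtain ⟨n, rfl⟩ : ∃ n, m = n + 2 := ⟨m - 2, by omega⟩
  have key (u : Fin (n + 2)) : G.Adj (f u) (f (u + 1 : Fin (n + 2))) := by
    rw [Fin.val_add, h.apply_mod]
    simpa using h.adj u
  refine ⟨⟨fun i => f i, ?_⟩, ?_⟩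
  · intro a b hab
    rw [cycleGraph_adj] at hab
    rcases hab with hab | hab
    · rw [sub_eq_iff_eq_add'] at hab
      subst hab
      simpa [add_comm] using (key b).symm
    · rw [sub_eq_iff_eq_add'] at hab
      subst hab
      simpa [add_comm] using key a
  · intro a b hab
    exact Fin.ext (h.inj _ _ a.2 b.2 hab)

end IsCyc

end Cycles

section Bondy

open Finset
open scoped Classical

variable {V : Type*} {G : SimpleGraph V} {m c : ℕ} {f : ℕ → V}

/-- The number of neighbours of `v` in `U`. -/
noncomputable def degIn (G : SimpleGraph V) (U : Finset V) (v : V) : ℕ := #{w ∈ U | G.Adj v w}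

/-- The number of ordered pairs of adjacent vertices in `U`. -/
noncomputable def pairs (G : SimpleGraph V) (U : Finset V) : ℕ := ∑ v ∈ U, degIn G U v

/-- The set of the first `m` values of `f`. -/
noncomputable def verts (f : ℕ → V) (m : ℕ) : Finset V := (range m).image f

theorem card_verts (h : IsCyc G c f) : #(verts f c) = c := by
  rw [verts, card_image_of_injOn, card_range]
  intro i hi j hj e
  exact h.inj i j (by simpa using hi) (by simpa using hj) e

theorem mem_verts (h : IsCyc G c f) (i : ℕ) : f i ∈ verts f c :=
  mem_image.2 ⟨i % c, by simpa using Nat.mod_lt _ h.pos, h.apply_mod i⟩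

theorem exists_of_mem_verts (h : IsCyc G c f) {x : V} (hx : x ∈ verts f c) (s : ℕ) :
    ∃ i, s ≤ i ∧ i < s + c ∧ f i = x := by
  obtain ⟨i, hi, rfl⟩ := mem_image.1 hx
  rw [mem_range] at hi
  refine ⟨s + (i + c * s - s) % c, by omega, ?_, ?_⟩
  · have := Nat.mod_lt (i + c * s - s) h.pos; omega
  · have hs : s ≤ c * s := Nat.le_mul_of_pos_left _ h.pos
    rw [← h.apply_mod, Nat.add_mod_mod, show s + (i + c * s - s) = i + c * s by omega,
      Nat.add_mul_mod_self_left, Nat.mod_eq_of_lt hi]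

theorem verts_shift (h : IsCyc G c f) (s : ℕ) : verts (fun i => f (i + s)) c = verts f c := by
  apply eq_of_subset_of_card_le
  · intro x hx
    obtain ⟨i, -, rfl⟩ := mem_image.1 hx
    exact mem_verts h _
  · rw [card_verts h, card_verts (h.shift s)]

/-- The position that Bondy's argument pairs with the position `l` on a cycle of length `c`. -/
def bondyMap (c m l : ℕ) : ℕ := if l + m ≤ c + 2 then l + m - 3 else l + m - 1 - c

theorem IsCyc.exists_of_chords (h : IsCyc G c f) (hm : 3 ≤ m) (hmc : m ≤ c) {l : ℕ} (hl : 2 ≤ l)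
    (hlc : l < c) (h1 : G.Adj (f 1) (f l)) (h0 : G.Adj (f 0) (f (bondyMap c m l))) :
    ∃ g, IsCyc G m g := by
  have hper : f c = f 0 := by simpa using h.per 0
  unfold bondyMap at h0
  split_ifs at h0 with hlm
  · refine ⟨_, IsCyc.of_injOn (m := m)
      (g := fun i => f (if i = 0 then 1 else if i = m - 1 then c else l + i - 1)) (by omega)
      ?_ ?_ ?_⟩
    · intro i hi
      rcases Nat.eq_zero_or_pos i with rfl | hi0
      · simpa [show 1 ≠ m - 1 by omega] using h1
      · rcases Nat.lt_or_ge (i + 2) m with hi2 | hi2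
        · simpa [hi0.ne', show i ≠ m - 1 by omega, show i + 1 ≠ m - 1 by omega,
            show l + (i + 1) - 1 = l + i - 1 + 1 by omega] using h.adj (l + i - 1)
        · simpa [hi0.ne', show i ≠ m - 1 by omega, show i + 1 = m - 1 by omega, hper,
            show m - 1 ≠ 0 by omega,
            show l + i - 1 = l + m - 3 by omega] using h0.symm
    · simpa [show m - 1 ≠ 0 by omega, hper] using h.adj 0
    · intro i j hij hj
      have := h.two_le
      rcases Nat.lt_trichotomy (if i = 0 then 1 else if i = m - 1 then c else l + i - 1)
        (if j = 0 then 1 else if j = m - 1 then c else l + j - 1) with hlt | heq | hgt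
      · exact h.ne hlt (by split_ifs <;> omega)
      · split_ifs at heq <;> omega
      · split_ifs at hgt <;> omega
  · refine ⟨_, IsCyc.of_injOn (m := m)
      (g := fun i => f (if i < l + m - 1 - c then i + 1 else c + (l + m - 1 - c) - i)) (by omega)
      ?_ ?_ ?_⟩
    · intro i hi
      rcases Nat.lt_trichotomy (i + 1) (l + m - 1 - c) with hi2 | hi2 | hi2
      · simpa [hi2, show i < l + m - 1 - c by omega] using h.adj (i + 1)
      · simpa [hi2, show i < l + m - 1 - c by omega, hper] using h0.symm
      · simp only [show ¬ i < l + m - 1 - c by omega, show ¬ i + 1 < l + m - 1 - c by omega,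
          if_false]
        have := h.adj (c + (l + m - 1 - c) - (i + 1))
        rw [show c + (l + m - 1 - c) - (i + 1) + 1 = c + (l + m - 1 - c) - i by omega] at this
        exact this.symm
    · simpa [show ¬ m - 1 < l + m - 1 - c by omega, show 0 < l + m - 1 - c by omega,
        show c + (l + m - 1 - c) - (m - 1) = l by omega] using h1.symm
    · intro i j hij hj
      rcases Nat.lt_trichotomy (if i < l + m - 1 - c then i + 1 else c + (l + m - 1 - c) - i)
        (if j < l + m - 1 - c then j + 1 else c + (l + m - 1 - c) - j) with hlt | heq | hgt
      · exact h.ne hlt (by split_ifs <;> omega)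
      · split_ifs at heq <;> omega
      · exact (h.ne hgt (by split_ifs <;> omega)).symm

theorem IsCyc.degIn_add_le (h : IsCyc G c f) (hm : 3 ≤ m) (hmc : m ≤ c)
    (hno : ¬ ∃ g, IsCyc G m g) :
    degIn G (verts f c) (f 0) + degIn G (verts f c) (f 1) ≤
      2 + #{l ∈ Ico 2 c | G.Adj (f 1) (f l) ∨ G.Adj (f 0) (f (bondyMap c m l))} := by
  have hd : Disjoint {l ∈ Ico 2 c | G.Adj (f 1) (f l)}
      {l ∈ Ico 2 c | G.Adj (f 0) (f (bondyMap c m l))} := by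
    rw [disjoint_filter]
    intro l hl h1 h0
    rw [mem_Ico] at hl
    exact hno (h.exists_of_chords hm hmc hl.1 hl.2 h1 h0)
  have e1 : degIn G (verts f c) (f 1) ≤ 1 + #{l ∈ Ico 2 c | G.Adj (f 1) (f l)} := by
    have : {w ∈ verts f c | G.Adj (f 1) w} ⊆
        insert (f 0) ({l ∈ Ico 2 c | G.Adj (f 1) (f l)}.image f) := by
      intro w hw
      rw [mem_filter] at hw
      obtain ⟨l, -, hl, rfl⟩ := exists_of_mem_verts h hw.1 0
      rw [mem_insert, mem_image]
      rcases Nat.eq_zero_or_pos l with rfl | hl0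
      · exact Or.inl rfl
      · have : l ≠ 1 := by rintro rfl; exact hw.2.ne rfl
        exact Or.inr ⟨l, by simp [hw.2]; omega, rfl⟩
    calc _ ≤ _ := card_le_card this
      _ ≤ _ := card_insert_le _ _
      _ ≤ _ := by rw [add_comm]; exact Nat.add_le_add_left card_image_le _
  have e0 : degIn G (verts f c) (f 0) ≤
      1 + #{l ∈ Ico 2 c | G.Adj (f 0) (f (bondyMap c m l))} := by
    have : {w ∈ verts f c | G.Adj (f 0) w} ⊆ insert (f 1)
        ({l ∈ Ico 2 c | G.Adj (f 0) (f (bondyMap c m l))}.image (fun l => f (bondyMap c m l))) := by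
      intro w hw
      rw [mem_filter] at hw
      obtain ⟨j, -, hj, rfl⟩ := exists_of_mem_verts h hw.1 0
      rw [mem_insert, mem_image]
      have : j ≠ 0 := by rintro rfl; exact hw.2.ne rfl
      by_cases hj1 : j = 1
      · exact Or.inl (by rw [hj1])
      · obtain ⟨l, hl, hlc, hlj⟩ : ∃ l, 2 ≤ l ∧ l < c ∧ bondyMap c m l = j := by
          rcases Nat.lt_or_ge j (m - 1) with hjm | hjm
          · exact ⟨j + c + 1 - m, by omega, by omega, by unfold bondyMap; split_ifs <;> omega⟩
          · exact ⟨j + 3 - m, by omega, by omega, by unfold bondyMap; split_ifs <;> omega⟩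
        exact Or.inr ⟨l, by simp [hlj, hw.2]; omega, by rw [hlj]⟩
    calc _ ≤ _ := card_le_card this
      _ ≤ _ := card_insert_le _ _
      _ ≤ _ := by rw [add_comm]; exact Nat.add_le_add_left card_image_le _
  rw [filter_or, card_union_of_disjoint hd]
  omega

theorem IsCyc.two_mul_pairs (h : IsCyc G c f) : 2 * pairs G (verts f c) =
    ∑ i ∈ range c, (degIn G (verts f c) (f i) + degIn G (verts f c) (f (i + 1))) := by
  have h1 : pairs G (verts f c) = ∑ i ∈ range c, degIn G (verts f c) (f i) := by
    rw [pairs]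
    conv_lhs => rw [verts]
    refine sum_image fun i hi j hj e => ?_
    exact h.inj i j (by simpa using hi) (by simpa using hj) e
  have h2 : ∑ i ∈ range c, degIn G (verts f c) (f (i + 1)) =
      ∑ i ∈ range c, degIn G (verts f c) (f i) := by
    have e1 := sum_range_succ (fun i => degIn G (verts f c) (f i)) c
    have e2 := sum_range_succ' (fun i => degIn G (verts f c) (f i)) c
    have e3 : f c = f 0 := by simpa using h.per 0
    simp only [e3] at e1
    omega
  rw [sum_add_distrib, h2, h1, two_mul]

theorem IsCyc.degIn_succ_add_le (h : IsCyc G c f) (hm : 3 ≤ m) (hmc : m ≤ c)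
    (hno : ¬ ∃ g, IsCyc G m g) (i : ℕ) :
    degIn G (verts f c) (f i) + degIn G (verts f c) (f (i + 1)) ≤ 2 +
      #{l ∈ Ico 2 c | G.Adj (f (i + 1)) (f (i + l)) ∨ G.Adj (f i) (f (i + bondyMap c m l))} := by
  have := (h.shift i).degIn_add_le hm hmc hno
  rw [verts_shift h] at this
  simpa [add_comm] using this

theorem IsCyc.degIn_succ_add_le_length (h : IsCyc G c f) (hm : 3 ≤ m) (hmc : m ≤ c)
    (hno : ¬ ∃ g, IsCyc G m g) (i : ℕ) :
    degIn G (verts f c) (f i) + degIn G (verts f c) (f (i + 1)) ≤ c := by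
  have h1 := h.degIn_succ_add_le hm hmc hno i
  have h2 := card_filter_le (Ico 2 c)
    (fun l => G.Adj (f (i + 1)) (f (i + l)) ∨ G.Adj (f i) (f (i + bondyMap c m l)))
  rw [Nat.card_Ico] at h2
  have := h.two_le
  omega

/-- A graph with a Hamiltonian cycle of length `c` and no cycle of length `m` has at most `c² / 4`
edges. -/
theorem IsCyc.two_mul_pairs_le (h : IsCyc G c f) (hm : 3 ≤ m) (hmc : m ≤ c)
    (hno : ¬ ∃ g, IsCyc G m g) : 2 * pairs G (verts f c) ≤ c * c := by
  rw [h.two_mul_pairs]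
  calc _ ≤ ∑ i ∈ range c, c := sum_le_sum fun i _ => h.degIn_succ_add_le_length hm hmc hno i
    _ = c * c := by simp

/-- In the case of equality in `IsCyc.two_mul_pairs_le`, chords are complementary. -/
theorem IsCyc.adj_or_adj (h : IsCyc G c f) (hm : 3 ≤ m) (hmc : m ≤ c)
    (hno : ¬ ∃ g, IsCyc G m g) (heq : c * c ≤ 2 * pairs G (verts f c)) (i l : ℕ) (hl : 2 ≤ l)
    (hlc : l < c) : G.Adj (f (i + 1)) (f (i + l)) ↔ ¬ G.Adj (f i) (f (i + bondyMap c m l)) := by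
  constructor
  · intro h1 h0
    refine hno ((h.shift i).exists_of_chords hm hmc hl hlc ?_ ?_)
    · simpa [add_comm] using h1
    · simpa [add_comm] using h0
  · intro h0
    by_contra h1
    have hlt : #{l ∈ Ico 2 c | G.Adj (f (i + 1)) (f (i + l)) ∨
        G.Adj (f i) (f (i + bondyMap c m l))} < #(Ico 2 c) := by
      apply card_lt_card
      rw [filter_ssubset]
      exact ⟨l, by simp [hl, hlc], by tauto⟩
    rw [Nat.card_Ico] at hlt
    have h2 := h.degIn_succ_add_le hm hmc hno i
    have hlow : 2 * pairs G (verts f c) < ∑ _i ∈ range c, c := by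
      rw [h.two_mul_pairs]
      refine sum_lt_sum (fun i _ => h.degIn_succ_add_le_length hm hmc hno i)
        ⟨i % c, by simpa using Nat.mod_lt _ h.pos, ?_⟩
      have e : f (i % c + 1) = f (i + 1) := by
        rw [← h.apply_mod (i % c + 1), Nat.mod_add_mod, h.apply_mod]
      rw [h.apply_mod, e]
      omega
    simp at hlow
    omega

end Bondy

section Equality

variable {V : Type*} {G : SimpleGraph V} {k : ℕ} {f : ℕ → V}

theorem IsCyc.adj_add_iff_of_equality (h : IsCyc G (4 * k) f) (hk : 2 ≤ k)
    (hno : ¬ ∃ g, IsCyc G (2 * k + 1) g)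
    (heq : 4 * k * (4 * k) ≤ 2 * pairs G (verts f (4 * k))) (i s : ℕ) (hs : 2 ≤ s)
    (hsk : s < 2 * k) :
    (G.Adj (f i) (f (i + s)) ↔ G.Adj (f 0) (f s)) ∧
      (G.Adj (f i) (f (i + s)) ↔ ¬ G.Adj (f i) (f (i + (2 * k + 1 - s)))) := by
  have R1 (i t : ℕ) (ht : 1 ≤ t) (htk : t ≤ 2 * k) :
      G.Adj (f (i + 1)) (f (i + 1 + t)) ↔ ¬ G.Adj (f i) (f (i + (t + 2 * k - 1))) := by
    have := h.adj_or_adj (m := 2 * k + 1) (by omega) (by omega) hno heq i (t + 1) (by omega)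
      (by omega)
    rwa [bondyMap, if_pos (by omega), show i + (t + 1) = i + 1 + t by omega,
      show t + 1 + (2 * k + 1) - 3 = t + 2 * k - 1 by omega] at this
  have R2 (i s : ℕ) (hs : 2 ≤ s) (hsk : s < 2 * k) :
      G.Adj (f (i + 1)) (f (i + (s + 2 * k))) ↔ ¬ G.Adj (f i) (f (i + s)) := by
    have := h.adj_or_adj (m := 2 * k + 1) (by omega) (by omega) hno heq i (s + 2 * k) (by omega)
      (by omega)
    rwa [bondyMap, if_neg (by omega),
      show s + 2 * k + (2 * k + 1) - 1 - 4 * k = s by omega] at this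
  have S (i s : ℕ) (hs : 2 ≤ s) (hsk : s < 2 * k) : G.Adj (f i) (f (i + s)) ↔
      ¬ G.Adj (f (i + s + 2 * k)) (f (i + s + 2 * k + (2 * k + 1 - s))) := by
    have e : f (i + s + 2 * k + (2 * k + 1 - s)) = f (i + 1) := by
      rw [← h.per (i + 1)]; congr 1; omega
    rw [e, G.adj_comm (f (i + s + 2 * k)), add_assoc i s, R2 i s hs hsk, not_not]
  have T2 (i : ℕ) (s : ℕ) (hs : 2 ≤ s) (hsk : s < 2 * k) :
      G.Adj (f i) (f (i + s)) ↔ G.Adj (f (i + 2)) (f (i + 2 + s)) := by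
    have h1 := R1 (i + 1) s (by omega) (by omega)
    have h2 := R2 i s hs hsk
    rw [show i + 1 + (s + 2 * k - 1) = i + (s + 2 * k) by omega] at h1
    rw [show i + 2 = i + 1 + 1 by omega]
    tauto
  have T2' (i j : ℕ) (s : ℕ) (hs : 2 ≤ s) (hsk : s < 2 * k) :
      G.Adj (f i) (f (i + s)) ↔ G.Adj (f (i + 2 * j)) (f (i + 2 * j + s)) := by
    induction j with
    | zero => simp
    | succ j ih => rw [ih, T2 _ s hs hsk]; simp [mul_add, add_assoc]
  have T1 (i : ℕ) (s : ℕ) (hs : 2 ≤ s) (hsk : s < 2 * k) :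
      G.Adj (f i) (f (i + s)) ↔ G.Adj (f (i + 1)) (f (i + 1 + s)) := by
    have h1 := S i s hs hsk
    have h2 := S (i + s + 2 * k) (2 * k + 1 - s) (by omega) (by omega)
    have h3 := T2' (i + 1) k s hs hsk
    have e1 : f (i + s + 2 * k + (2 * k + 1 - s) + 2 * k) = f (i + 1 + 2 * k) := by
      rw [← h.per (i + 1 + 2 * k)]; congr 1; omega
    have e2 : f (i + s + 2 * k + (2 * k + 1 - s) + 2 * k + (2 * k + 1 - (2 * k + 1 - s))) =
        f (i + 1 + 2 * k + s) := by
      rw [← h.per (i + 1 + 2 * k + s)]; congr 1; omega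
    rw [e1, e2] at h2
    tauto
  have T0 (i : ℕ) (s : ℕ) (hs : 2 ≤ s) (hsk : s < 2 * k) :
      G.Adj (f i) (f (i + s)) ↔ G.Adj (f 0) (f s) := by
    induction i with
    | zero => simp
    | succ i ih => rw [← T1 i s hs hsk, ih]
  refine ⟨T0 i s hs hsk, ?_⟩
  rw [S i s hs hsk, T0 i _ (by omega) (by omega), T0 _ _ (by omega) (by omega)]

theorem IsCyc.exists_of_chords_two (h : IsCyc G (4 * k) f) (hk : 2 ≤ k)
    (h2 : ∀ i, G.Adj (f i) (f (i + 2))) : ∃ g, IsCyc G (2 * k + 1) g := by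
  refine ⟨_, IsCyc.of_injOn (g := fun i => f (if i ≤ k then 2 * i else 4 * k + 1 - 2 * i))
    (by omega) ?_ ?_ ?_⟩
  · intro i hi
    rcases Nat.lt_trichotomy i k with hik | hik | hik
    · simpa [hik.le, show i + 1 ≤ k by omega, mul_add] using h2 (2 * i)
    · subst hik
      have := h.adj (2 * i - 1)
      rw [show 2 * i - 1 + 1 = 2 * i by omega] at this
      simpa [show 4 * i + 1 - 2 * (i + 1) = 2 * i - 1 by omega] using this.symm
    · have := h2 (4 * k + 1 - 2 * (i + 1))
      rw [show 4 * k + 1 - 2 * (i + 1) + 2 = 4 * k + 1 - 2 * i by omega] at this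
      simpa [show ¬ i ≤ k by omega, show ¬ i + 1 ≤ k by omega] using this.symm
  · simpa [show ¬ 2 * k ≤ k by omega, show 4 * k + 1 - 2 * (2 * k) = 1 by omega] using
      (h.adj 0).symm
  · intro i j hij hj
    rcases Nat.lt_trichotomy (if i ≤ k then 2 * i else 4 * k + 1 - 2 * i)
      (if j ≤ k then 2 * j else 4 * k + 1 - 2 * j) with hlt | heq | hgt
    · exact h.ne hlt (by split_ifs <;> omega)
    · split_ifs at heq <;> omega
    · exact (h.ne hgt (by split_ifs <;> omega)).symm

theorem IsCyc.exists_of_chords_even (h : IsCyc G (4 * k) f) {r : ℕ} (hr : 2 ≤ r)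
    (hrk : r < k) (h1 : G.Adj (f 0) (f (2 * r)))
    (h2 : G.Adj (f (r + 1)) (f (r + 1 + (2 * k - 1)))) : ∃ g, IsCyc G (2 * k + 1) g := by
  have hper : f (4 * k) = f 0 := by simpa using h.per 0
  refine ⟨_, IsCyc.of_injOn
    (g := fun i => f (if i ≤ r - 1 then 2 * r - i else 2 * k + i)) (by omega) ?_ ?_ ?_⟩
  · intro i hi
    rcases Nat.lt_trichotomy i (r - 1) with hir | hir | hir
    · have := h.adj (2 * r - (i + 1))
      rw [show 2 * r - (i + 1) + 1 = 2 * r - i by omega] at this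
      simpa [hir.le, show i + 1 ≤ r - 1 by omega] using this.symm
    · simpa [hir.le, show ¬ i + 1 ≤ r - 1 by omega, show 2 * r - i = r + 1 by omega,
        show 2 * k + (i + 1) = r + 1 + (2 * k - 1) by omega] using h2
    · simpa [show ¬ i ≤ r - 1 by omega, show ¬ i + 1 ≤ r - 1 by omega, add_assoc] using
        h.adj (2 * k + i)
  · simpa [show ¬ 2 * k ≤ r - 1 by omega, show 2 * k + 2 * k = 4 * k by omega, hper] using h1
  · intro i j hij hj
    rcases Nat.lt_trichotomy (if i ≤ r - 1 then 2 * r - i else 2 * k + i)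
      (if j ≤ r - 1 then 2 * r - j else 2 * k + j) with hlt | heq | hgt
    · exact h.ne hlt (by split_ifs <;> omega)
    · split_ifs at heq <;> omega
    · exact (h.ne hgt (by split_ifs <;> omega)).symm

/-- A Hamiltonian graph on `4k` vertices with at least `4k²` edges and no cycle of length `2k + 1`
is complete bipartite. -/
theorem IsCyc.adj_iff_odd_of_equality (h : IsCyc G (4 * k) f) (hk : 2 ≤ k)
    (hno : ¬ ∃ g, IsCyc G (2 * k + 1) g)
    (heq : 4 * k * (4 * k) ≤ 2 * pairs G (verts f (4 * k))) (i j : ℕ) (hi : i < 4 * k)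
    (hj : j < 4 * k) : G.Adj (f i) (f j) ↔ (i + j) % 2 = 1 := by
  have key := h.adj_add_iff_of_equality hk hno heq
  have n2 : ¬ G.Adj (f 0) (f 2) := fun h2 =>
    hno (h.exists_of_chords_two hk fun i => ((key i 2 le_rfl (by omega)).1).2 h2)
  have odd_last (i : ℕ) : G.Adj (f i) (f (i + (2 * k - 1))) := by
    by_contra hc
    have := (key 0 2 le_rfl (by omega)).2
    rw [zero_add, zero_add, show 2 * k + 1 - 2 = 2 * k - 1 by omega,
      ← (key i (2 * k - 1) (by omega) (by omega)).1] at this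
    exact n2 (this.2 hc)
  have even_chord (r : ℕ) (hr : 1 ≤ r) (hrk : r < k) : ¬ G.Adj (f 0) (f (2 * r)) := by
    rcases Nat.eq_or_lt_of_le hr with rfl | hr2
    · exact n2
    · exact fun h1 => hno (h.exists_of_chords_even hr2 hrk h1 (odd_last _))
  have diam (i : ℕ) : ¬ G.Adj (f i) (f (i + 2 * k)) := by
    have := h.adj_or_adj (m := 2 * k + 1) (by omega) (by omega) hno heq i 2 le_rfl (by omega)
    rw [bondyMap, if_pos (by omega), show 2 + (2 * k + 1) - 3 = 2 * k by omega] at this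
    exact this.1 (h.adj (i + 1))
  have main (i s : ℕ) (hs : 1 ≤ s) (hsk : s ≤ 2 * k) :
      G.Adj (f i) (f (i + s)) ↔ s % 2 = 1 := by
    rcases Nat.eq_or_lt_of_le hs with rfl | hs2
    · simpa using h.adj i
    rcases Nat.eq_or_lt_of_le hsk with rfl | hsk2
    · simpa using diam i
    rcases Nat.mod_two_eq_zero_or_one s with he | ho
    · have := even_chord (s / 2) (by omega) (by omega)
      rw [show 2 * (s / 2) = s by omega] at this
      rw [(key i s hs2 hsk2).1]
      simp [this, he]
    · have := even_chord ((2 * k + 1 - s) / 2) (by omega) (by omega)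
      rw [show 2 * ((2 * k + 1 - s) / 2) = 2 * k + 1 - s by omega] at this
      rw [(key i s hs2 hsk2).2, (key i _ (by omega) (by omega)).1]
      simp [this, ho]
  have lt_case (i j : ℕ) (hij : i < j) (hj : j < 4 * k) :
      G.Adj (f i) (f j) ↔ (i + j) % 2 = 1 := by
    rcases Nat.lt_or_ge (2 * k) (j - i) with hlong | hshort
    · have := main j (i + 4 * k - j) (by omega) (by omega)
      rw [show j + (i + 4 * k - j) = i + 4 * k by omega, h.per, G.adj_comm] at this
      rw [this]; omega
    · have := main i (j - i) (by omega) hshort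
      rw [show i + (j - i) = j by omega] at this
      rw [this]; omega
  rcases Nat.lt_trichotomy i j with hij | rfl | hij
  · exact lt_case i j hij hj
  · simp; omega
  · rw [G.adj_comm, lt_case j i hij hi, add_comm]

end Equality

section LongestCycle

open Finset
open scoped Classical

variable {V : Type*} {G : SimpleGraph V} {c p : ℕ} {f : ℕ → V}

theorem exists_maximal_nat {P : ℕ → Prop} (hP : ∃ n, P n) (N : ℕ) (hN : ∀ n, P n → n ≤ N) :
    ∃ n, P n ∧ ∀ m, P m → m ≤ n := by
  obtain ⟨n, hn⟩ := hP
  exact ⟨Nat.findGreatest P N, Nat.findGreatest_spec (hN n hn) hn,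
    fun m hm => Nat.le_findGreatest (hN m hm) hm⟩

/-- If two sets of residues mod `c` are not both contained in one common singleton, and distinct
elements of them are more than `p` apart, then they are small. -/
theorem card_add_card_le_of_far {A B : ℕ → Prop} (hp : 1 ≤ p)
    (hperB : ∀ i, B (i + c) ↔ B i)
    (hBA : ∀ i j, B i → A (i + j) → 1 ≤ j → j < c → p < j)
    (hAB : ∀ i j, A i → B (i + j) → 1 ≤ j → j < c → p < j)
    (h0 : B 0) {q : ℕ} (hq : 0 < q) (hqc : q < c) (hA : A q) :
    #{i ∈ Icc 1 c | A i} + #{i ∈ Icc 1 c | B (i - 1)} + 2 * (p - 1) ≤ c := by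
  obtain ⟨w, ⟨hw, hwq⟩, hwmax⟩ := exists_maximal_nat (P := fun i => B i ∧ i < q) ⟨0, h0, hq⟩ q
    fun n hn => hn.2.le
  obtain ⟨u, ⟨hu, huc⟩, humax⟩ := exists_maximal_nat (P := fun i => A i ∧ i < c) ⟨q, hA, hqc⟩ c
    fun n hn => hn.2.le
  have hqu := humax q ⟨hA, hqc⟩
  have hwp : p < q - w := hBA w (q - w) hw (by rwa [Nat.add_sub_cancel' hwq.le]) (by omega)
    (by omega)
  have hup : p < c - u := hAB u (c - u) hu
    (by rw [Nat.add_sub_cancel' huc.le]; simpa using (hperB 0).2 h0) (by omega) (by omega)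
  have d1 : Disjoint {i ∈ Icc 1 c | A i} {i ∈ Icc 1 c | B (i - 1)} := by
    rw [disjoint_filter]
    intro i hi h1 h2
    rw [mem_Icc] at hi
    have := hBA (i - 1) 1 h2 (by rwa [Nat.sub_add_cancel hi.1]) le_rfl (by omega)
    omega
  have notA (i : ℕ) (h1 : i ∈ Icc (w + 2) (w + p) ∪ Icc (u + 2) (u + p)) : ¬ A i := by
    intro hAi
    rw [mem_union, mem_Icc, mem_Icc] at h1
    rcases h1 with h1 | h1
    · have := hBA w (i - w) hw (by rwa [Nat.add_sub_cancel' (by omega)]) (by omega) (by omega)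
      omega
    · have := humax i ⟨hAi, by omega⟩
      omega
  have notB (i : ℕ) (h1 : i ∈ Icc (w + 2) (w + p) ∪ Icc (u + 2) (u + p)) : ¬ B (i - 1) := by
    intro hBi
    rw [mem_union, mem_Icc, mem_Icc] at h1
    rcases h1 with h1 | h1
    · have := hwmax (i - 1) ⟨hBi, by omega⟩
      omega
    · have := hAB u (i - 1 - u) hu (by rwa [Nat.add_sub_cancel' (by omega)]) (by omega) (by omega)
      omega
  have d2 : Disjoint (Icc (w + 2) (w + p)) (Icc (u + 2) (u + p)) := by
    rw [Finset.disjoint_left]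
    intro i h1 h2
    rw [mem_Icc] at h1 h2
    omega
  have d3 : Disjoint ({i ∈ Icc 1 c | A i} ∪ {i ∈ Icc 1 c | B (i - 1)})
      (Icc (w + 2) (w + p) ∪ Icc (u + 2) (u + p)) := by
    rw [Finset.disjoint_left]
    intro i h1 h2
    rw [mem_union, mem_filter, mem_filter] at h1
    rcases h1 with h1 | h1
    · exact notA i h2 h1.2
    · exact notB i h2 h1.2
  have hsub : ({i ∈ Icc 1 c | A i} ∪ {i ∈ Icc 1 c | B (i - 1)}) ∪
      (Icc (w + 2) (w + p) ∪ Icc (u + 2) (u + p)) ⊆ Icc 1 c := by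
    intro i hi
    simp only [mem_union, mem_filter, mem_Icc] at hi ⊢
    omega
  have := card_le_card hsub
  rw [card_union_of_disjoint d3, card_union_of_disjoint d1, card_union_of_disjoint d2] at this
  simp only [Nat.card_Icc] at this
  omega

theorem IsCyc.length_lt_of_adj (h : IsCyc G c f) (hmax : ∀ m g, IsCyc G m g → m ≤ c) {l : List V}
    (hne : l ≠ []) (hnd : l.Nodup) (hch : l.IsChain G.Adj) (hl : ∀ x ∈ l, x ∉ verts f c) (i j : ℕ)
    (hi : G.Adj (l.getLast hne) (f i)) (hj : G.Adj (l.head hne) (f (i + j))) (hj1 : 1 ≤ j)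
    (hjc : j < c) : l.length < j := by
  set s : List V := (List.range (c - j + 1)).map (fun t => f (i + j + t)) with hs
  have hsne : s ≠ [] := by simp [hs]
  have hshead : s.head hsne = f (i + j) := by simp [hs, List.head_eq_getElem]
  have hslast : s.getLast hsne = f i := by
    rw [← h.per i]
    simp only [hs, List.getLast_eq_getElem, List.getElem_map, List.getElem_range, List.length_map,
      List.length_range]
    congr 1; omega
  have hsch : s.IsChain G.Adj := by
    rw [List.isChain_iff_getElem]
    intro t ht
    simpa [hs, add_assoc] using h.adj (i + j + t)
  have hsnd : s.Nodup := by
    refine List.Nodup.map_on ?_ List.nodup_range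
    intro a ha b hb e
    rw [List.mem_range] at ha hb
    rcases Nat.lt_trichotomy a b with hab | hab | hab
    · exact absurd e (h.ne (by omega) (by omega))
    · exact hab
    · exact absurd e.symm (h.ne (by omega) (by omega))
  have hsmem : ∀ x ∈ s, x ∈ verts f c := by
    intro x hx
    obtain ⟨t, -, rfl⟩ := List.mem_map.1 hx
    exact mem_verts h _
  have hrch : l.reverse.IsChain G.Adj := by
    rw [List.isChain_reverse]
    exact hch.imp fun a b hab => hab.symm
  have hrne : l.reverse ≠ [] := by simpa using hne
  obtain ⟨g, hg⟩ := IsCyc.of_list (G := G) (l := s ++ l.reverse)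
    (by have := List.length_pos_iff.2 hne; simp [hs]; omega)
    (by
      rw [List.nodup_append]
      refine ⟨hsnd, by simpa using hnd, ?_⟩
      rintro a ha b hb rfl
      exact hl a (by simpa using hb) (hsmem a ha))
    (by
      rw [List.isChain_append]
      refine ⟨hsch, hrch, ?_⟩
      intro x hx y hy
      rw [List.getLast?_eq_getLast_of_ne_nil hsne, hslast] at hx
      rw [List.head?_eq_some_head hrne, List.head_reverse] at hy
      simp only [Option.mem_def, Option.some.injEq] at hx hy
      subst hx; subst hy
      exact hi.symm)
    (by simp [hsne])
    (by
      rw [List.getLast_append_of_ne_nil _ hrne, List.getLast_reverse,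
        List.head_append_of_ne_nil hsne, hshead]
      exact hj)
  have := hmax _ _ hg
  simp [hs] at this
  omega

theorem IsCyc.degIn_le_card_filter (h : IsCyc G c f) (v : V) (s : ℕ) :
    degIn G (verts f c) v ≤ #{i ∈ Ico s (s + c) | G.Adj v (f i)} := by
  have : {w ∈ verts f c | G.Adj v w} ⊆ {i ∈ Ico s (s + c) | G.Adj v (f i)}.image f := by
    intro w hw
    rw [mem_filter] at hw
    obtain ⟨i, h1, h2, rfl⟩ := exists_of_mem_verts h hw.1 s
    exact mem_image.2 ⟨i, by simp [h1, h2, hw.2], rfl⟩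
  exact (card_le_card this).trans card_image_le

/-- The end vertices of a path outside a longest cycle have few neighbours on the cycle. -/
theorem IsCyc.degIn_head_add_degIn_getLast_le (h : IsCyc G c f)
    (hmax : ∀ m g, IsCyc G m g → m ≤ c) {l : List V} (hne : l ≠ []) (hnd : l.Nodup)
    (hch : l.IsChain G.Adj) (hl : ∀ x ∈ l, x ∉ verts f c) {u w : V} (huw : u ≠ w)
    (hu : u ∈ verts f c) (hw : w ∈ verts f c) (hu' : G.Adj (l.head hne) u)
    (hw' : G.Adj (l.getLast hne) w) :
    degIn G (verts f c) (l.head hne) + degIn G (verts f c) (l.getLast hne) + 2 * (l.length - 1)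
      ≤ c := by
  obtain ⟨i₀, -, -, rfl⟩ := exists_of_mem_verts h hw 0
  obtain ⟨j, hj, hjc, rfl⟩ := exists_of_mem_verts h hu i₀
  have hij : j ≠ i₀ := by rintro rfl; exact huw rfl
  have hsh := h.shift i₀
  rw [← verts_shift h i₀] at hl ⊢
  have hrne : l.reverse ≠ [] := by simpa using hne
  have hrch : l.reverse.IsChain G.Adj := by
    rw [List.isChain_reverse]
    exact hch.imp fun a b hab => hab.symm
  have main := card_add_card_le_of_far (c := c) (p := l.length)
    (A := fun i => G.Adj (l.head hne) (f (i + i₀))) (B := fun i => G.Adj (l.getLast hne) (f (i + i₀)))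
    (List.length_pos_iff.2 hne) (fun i => by rw [hsh.per i])
    (fun i t hi ht h1 h2 => hsh.length_lt_of_adj hmax hne hnd hch hl i t hi ht h1 h2)
    (fun i t hi ht h1 h2 => by
      have := hsh.length_lt_of_adj hmax hrne (by simpa using hnd) hrch (by simpa using hl) i t
        (by rwa [List.getLast_reverse]) (by rwa [List.head_reverse]) h1 h2
      simpa using this)
    (by simpa using hw') (q := j - i₀) (by omega) (by omega)
    (by rwa [Nat.sub_add_cancel hj])
  have e1 := hsh.degIn_le_card_filter (l.head hne) 1
  have e2 := hsh.degIn_le_card_filter (l.getLast hne) 0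
  have e3 : Ico 1 (1 + c) = Icc 1 c := by ext; simp; omega
  have e4 : #{i ∈ Ico 0 (0 + c) | G.Adj (l.getLast hne) (f (i + i₀))} =
      #{i ∈ Icc 1 c | G.Adj (l.getLast hne) (f (i - 1 + i₀))} := by
    refine card_bij (fun i _ => i + 1) ?_ ?_ ?_
    · intro i hi
      simp at hi ⊢
      exact ⟨by omega, hi.2⟩
    · intro a _ b _ e
      simpa using e
    · intro b hb
      simp at hb
      exact ⟨b - 1, by simp [hb]; omega, by omega⟩
  rw [e3] at e1
  omega

end LongestCycle

section Rotation

open Finset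
open scoped Classical

variable {V : Type*} {G : SimpleGraph V} {c : ℕ} {f : ℕ → V} {U : Finset V}

theorem degIn_eq_add (G : SimpleGraph V) {S : Finset V} (hS : S ⊆ U) (v : V) :
    degIn G U v = degIn G (U \ S) v + degIn G S v := by
  rw [degIn, degIn, degIn, ← card_union_of_disjoint, ← filter_union, sdiff_union_of_subset hS]
  exact disjoint_filter_filter sdiff_disjoint

theorem pairs_eq_add (G : SimpleGraph V) {S : Finset V} (hS : S ⊆ U) :
    pairs G U = pairs G (U \ S) + (∑ v ∈ S, degIn G U v + ∑ v ∈ S, degIn G (U \ S) v) := by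
  have h1 : ∑ v ∈ U \ S, degIn G S v = ∑ v ∈ S, degIn G (U \ S) v := by
    have := sum_card_bipartiteAbove_eq_sum_card_bipartiteBelow (s := U \ S) (t := S) G.Adj
    simp only [bipartiteAbove, bipartiteBelow, G.adj_comm] at this
    simp only [degIn]
    rw [this]
  rw [pairs, ← sum_sdiff hS, pairs, sum_congr rfl fun v _ => degIn_eq_add G hS v,
    sum_add_distrib, h1]
  omega

/-- If a family of paths is closed under rotation about the last vertex and contains all
neighbours of its first vertices, then some nonempty set `X` of first vertices meets few edges. -/
theorem exists_sum_degIn_le_of_rotation (hc : 2 ≤ c) (hmax : ∀ m g, IsCyc G m g → m ≤ c)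
    {F : Set (List V)} (hF : ∃ v l, v :: l ∈ F) (hnd : ∀ l ∈ F, l.Nodup)
    (hch : ∀ l ∈ F, l.IsChain G.Adj)
    (hrot : ∀ v a b w, (v :: a) ++ w :: b ∈ F → G.Adj v w → (v :: a).reverse ++ w :: b ∈ F)
    (hcl : ∀ v l, v :: l ∈ F → ∀ w ∈ U, G.Adj v w → w ∈ l) :
    ∃ X : Finset V, X.Nonempty ∧ (∀ x ∈ X, ∃ l, x :: l ∈ F) ∧
      ∑ x ∈ X, degIn G U x + ∑ x ∈ X, degIn G (U \ X) x ≤ c * #X := by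
  have hsplit : ∀ v l, v :: l ∈ F → ∀ w ∈ U, G.Adj v w →
      ∃ a x b, v :: l = a ++ x :: w :: b ∧ a.length + 2 ≤ c := by
    intro v l hl w hw hvw
    obtain ⟨a, b, rfl⟩ := List.append_of_mem (hcl v l hl w hw hvw)
    obtain ⟨a', x, hax⟩ : ∃ a' x, v :: a = a' ++ [x] :=
      ⟨_, _, (List.dropLast_concat_getLast (List.cons_ne_nil v a)).symm⟩
    refine ⟨a', x, b, by rw [← List.cons_append, hax]; simp, ?_⟩
    have hlen := congrArg List.length hax
    have h1 := hnd _ hl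
    have h2 := hch _ hl
    rw [show v :: (a ++ w :: b) = (v :: a ++ [w]) ++ b by simp] at h1 h2
    obtain ⟨g, hg⟩ := IsCyc.of_list (G := G) (l := v :: a ++ [w]) (by simp)
      (List.nodup_append.1 h1).1 (List.isChain_append.1 h2).1 (by simp)
      (by simpa using hvw.symm)
    have := hmax _ _ hg
    simp at this hlen
    omega
  obtain ⟨d, ⟨v, l, hl, rfl⟩, hd⟩ := exists_maximal_nat
    (P := fun d => ∃ v l, v :: l ∈ F ∧ degIn G U v = d)
    (by obtain ⟨v, l, hl⟩ := hF; exact ⟨_, v, l, hl, rfl⟩) #U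
    (by rintro n ⟨v, l, -, rfl⟩; exact card_filter_le _ _)
  rcases Nat.eq_zero_or_pos (degIn G U v) with h0 | hpos
  · refine ⟨{v}, by simp, by simpa using ⟨l, hl⟩, ?_⟩
    have : degIn G (U \ {v}) v ≤ degIn G U v :=
      card_le_card (filter_subset_filter _ sdiff_subset)
    simp
    omega
  set N : Finset V := {w ∈ U | G.Adj v w} with hN
  set T : Finset V := ((v :: l).take c).toFinset with hT
  have hTc : #T ≤ c := (List.toFinset_card_le _).trans (by simp)
  have hsplit' : ∀ w, ∃ x, w ∈ N → ∃ a b, v :: l = a ++ x :: w :: b ∧ a.length + 2 ≤ c := by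
    intro w
    by_cases hw : w ∈ N
    · have hw' := hw
      rw [hN, mem_filter] at hw'
      obtain ⟨a, x, b, h⟩ := hsplit v l hl w hw'.1 hw'.2
      exact ⟨x, fun _ => ⟨a, b, h⟩⟩
    · exact ⟨w, fun h => absurd h hw⟩
  choose pred hpred using hsplit'
  have hinj : Set.InjOn pred N := by
    intro w hw w' hw' e
    obtain ⟨a, b, h, -⟩ := hpred w hw
    obtain ⟨a', b', h', -⟩ := hpred w' hw'
    rw [e] at h
    have hnd' := hnd _ hl
    rw [h'] at hnd'
    have hx := List.nodup_middle.1 hnd'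
    rw [List.nodup_cons, List.mem_append, not_or] at hx
    rw [h', List.append_cons_inj_of_notMem] at h
    · exact (List.cons.inj h.2.2).1.symm
    · exact hx.1.1
    · exact hx.1.2
  have hXcard : #(N.image pred) = degIn G U v := card_image_of_injOn hinj
  have hroteq : ∀ w ∈ N, ∃ l', pred w :: l' ∈ F ∧
      ∀ y, y ∈ (pred w :: l').take c → y ∈ T := by
    intro w hw
    obtain ⟨a, b, h, hac⟩ := hpred w hw
    have hl' := hl
    rw [h] at hl'
    refine ⟨a.reverse ++ w :: b, ?_, ?_⟩
    · rcases a with - | ⟨z, a⟩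
      · simpa using hl'
      · simp at h
        have hz : v = z := h.1
        subst hz
        have := hrot v (a ++ [pred w]) b w (by simpa using hl') (by
          rw [hN, mem_filter] at hw; exact hw.2)
        simpa using this
    · intro y hy
      obtain ⟨e, rfl⟩ := Nat.exists_eq_add_of_le hac
      rw [hT, h, List.mem_toFinset]
      rw [show a.length + 2 + e = a.length + (e + 2) by omega] at hy ⊢
      rw [show a.length + (e + 2) = a.length + (e + 1) + 1 by omega, List.take_succ_cons] at hy
      have hr : a.reverse.take (a.length + (e + 1)) = a.reverse :=
        List.take_of_length_le (by simp)
      have ha : a.take (a.length + (e + 2)) = a := List.take_of_length_le (by omega)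
      simp [List.take_append, hr, ha, List.take_succ_cons] at hy ⊢
      tauto
  refine ⟨N.image pred, by
    rw [image_nonempty]; exact card_pos.1 hpos, ?_, ?_⟩
  · intro x hx
    obtain ⟨w, hw, rfl⟩ := mem_image.1 hx
    obtain ⟨l', hl', -⟩ := hroteq w hw
    exact ⟨l', hl'⟩
  · have hXT : N.image pred ⊆ T := by
      intro x hx
      obtain ⟨w, hw, rfl⟩ := mem_image.1 hx
      obtain ⟨l', hl', hT'⟩ := hroteq w hw
      exact hT' _ (by rw [List.take_cons (by omega)]; simp)
    have hnbr : ∀ x ∈ N.image pred, ∀ y ∈ U, G.Adj x y → y ∈ T := by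
      intro x hx y hy hxy
      obtain ⟨w, hw, rfl⟩ := mem_image.1 hx
      obtain ⟨l', hl', hT'⟩ := hroteq w hw
      apply hT'
      obtain ⟨a, z, b, h, hac⟩ := hsplit _ _ hl' y hy hxy
      obtain ⟨e, rfl⟩ := Nat.exists_eq_add_of_le hac
      rw [h, show a.length + 2 + e = a.length + (e + 2) by omega]
      simp [List.take_append]
    have s1 : ∑ x ∈ N.image pred, degIn G U x ≤ #(N.image pred) * degIn G U v := by
      rw [← smul_eq_mul]
      refine sum_le_card_nsmul _ _ _ ?_
      intro x hx
      obtain ⟨w, hw, rfl⟩ := mem_image.1 hx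
      obtain ⟨l', hl', -⟩ := hroteq w hw
      exact hd _ ⟨_, _, hl', rfl⟩
    have s2 : ∑ x ∈ N.image pred, degIn G (U \ N.image pred) x ≤
        #(N.image pred) * (c - degIn G U v) := by
      rw [← smul_eq_mul]
      refine sum_le_card_nsmul _ _ _ ?_
      intro x hx
      have : {y ∈ U \ N.image pred | G.Adj x y} ⊆ T \ N.image pred := by
        intro y hy
        rw [mem_filter, mem_sdiff] at hy
        exact mem_sdiff.2 ⟨hnbr x hx y hy.1.1 hy.2, hy.1.2⟩
      calc _ ≤ _ := card_le_card this
        _ = #T - degIn G U v := by rw [card_sdiff_of_subset hXT, hXcard]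
        _ ≤ _ := Nat.sub_le_sub_right hTc _
    have hle : degIn G U v ≤ c := by
      rw [← hXcard]; exact (card_le_card hXT).trans hTc
    calc _ ≤ _ := Nat.add_le_add s1 s2
      _ = c * #(N.image pred) := by
        rw [← Nat.mul_add, Nat.add_sub_cancel' hle, mul_comm]

end Rotation

section LongestPath

open Finset
open scoped Classical

variable {V : Type*} {G : SimpleGraph V} {c : ℕ} {f : ℕ → V} {U H : Finset V}

/-- `l` is a longest path of `G` inside `H`, given by the list of its vertices. -/
structure IsLongestPath (G : SimpleGraph V) (H : Finset V) (l : List V) : Prop where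
  ne_nil : l ≠ []
  nodup : l.Nodup
  chain : l.IsChain G.Adj
  mem : ∀ x ∈ l, x ∈ H
  length_le : ∀ l' : List V, l'.Nodup → l'.IsChain G.Adj → (∀ x ∈ l', x ∈ H) →
    l'.length ≤ l.length

theorem exists_isLongestPath (G : SimpleGraph V) (hH : H.Nonempty) : ∃ l, IsLongestPath G H l := by
  obtain ⟨v, hv⟩ := hH
  obtain ⟨p, ⟨l, h1, h2, h3, rfl⟩, hp⟩ := exists_maximal_nat
    (P := fun p => ∃ l : List V, l.Nodup ∧ l.IsChain G.Adj ∧ (∀ x ∈ l, x ∈ H) ∧ l.length = p)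
    ⟨1, [v], by simp [hv]⟩ #H (by
      rintro n ⟨l, h1, -, h3, rfl⟩
      rw [← List.toFinset_card_of_nodup h1]
      exact card_le_card fun x hx => h3 x (List.mem_toFinset.1 hx))
  refine ⟨l, ?_, h1, h2, h3, fun l' a1 a2 a3 => hp _ ⟨l', a1, a2, a3, rfl⟩⟩
  rintro rfl
  have := hp 1 ⟨[v], by simp [hv]⟩
  simp at this

theorem isChain_adj_reverse {l : List V} (h : l.IsChain G.Adj) : l.reverse.IsChain G.Adj := by
  rw [List.isChain_reverse]
  simpa only [flip, G.adj_comm] using h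

theorem isChain_adj_rotate {v w : V} {a b : List V} (h : ((v :: a) ++ w :: b).IsChain G.Adj)
    (hvw : G.Adj v w) : ((v :: a).reverse ++ w :: b).IsChain G.Adj := by
  rw [List.isChain_append] at h ⊢
  refine ⟨isChain_adj_reverse h.1, h.2.1, ?_⟩
  simpa using hvw

namespace IsLongestPath

theorem of_perm {l l' : List V} (h : IsLongestPath G H l) (hp : l'.Perm l)
    (hch : l'.IsChain G.Adj) : IsLongestPath G H l' where
  ne_nil := fun e => h.ne_nil (by subst e; simpa using hp)
  nodup := hp.nodup_iff.2 h.nodup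
  chain := hch
  mem x hx := h.mem x (hp.mem_iff.1 hx)
  length_le := by rw [hp.length_eq]; exact h.length_le

theorem reverse {l : List V} (h : IsLongestPath G H l) : IsLongestPath G H l.reverse :=
  h.of_perm l.reverse_perm (isChain_adj_reverse h.chain)

theorem rotate {v w : V} {a b : List V} (h : IsLongestPath G H ((v :: a) ++ w :: b))
    (hvw : G.Adj v w) : IsLongestPath G H ((v :: a).reverse ++ w :: b) :=
  h.of_perm ((v :: a).reverse_perm.append_right _) (isChain_adj_rotate h.chain hvw)

theorem mem_of_adj {v x : V} {l : List V} (h : IsLongestPath G H (v :: l)) (hx : x ∈ H)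
    (hvx : G.Adj v x) : x ∈ l := by
  by_contra hxl
  have := h.length_le (x :: v :: l)
    (List.nodup_cons.2 ⟨by simpa [hxl] using hvx.ne', h.nodup⟩)
    (by simpa [hvx.symm] using h.chain) (by simpa [hx] using h.mem)
  simp at this

theorem degIn_le {v : V} {l : List V} (h : IsLongestPath G H (v :: l)) :
    degIn G H v ≤ l.length := by
  refine (card_le_card fun x hx => ?_).trans (List.toFinset_card_le l)
  rw [mem_filter] at hx
  exact List.mem_toFinset.2 (h.mem_of_adj hx.1 hx.2)

end IsLongestPath

theorem IsCyc.exists_sum_degIn_le_of_ends (h : IsCyc G c f) (hmax : ∀ m g, IsCyc G m g → m ≤ c)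
    (hU : verts f c ⊆ U) {l : List V} (hl : IsLongestPath G (U \ verts f c) l) {u w : V}
    (huw : u ≠ w) (hu : u ∈ verts f c) (hw : w ∈ verts f c)
    (hu' : G.Adj (l.head hl.ne_nil) u) (hw' : G.Adj (l.getLast hl.ne_nil) w) :
    ∃ S ⊆ U \ verts f c, S.Nonempty ∧
      ∑ v ∈ S, degIn G U v + ∑ v ∈ S, degIn G (U \ S) v ≤ c * #S := by
  have key := h.degIn_head_add_degIn_getLast_le hmax hl.ne_nil hl.nodup hl.chain
    (fun x hx => (mem_sdiff.1 (hl.mem x hx)).2) huw hu hw hu' hw'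
  have hhead : degIn G (U \ verts f c) (l.head hl.ne_nil) ≤ l.length - 1 := by
    have := hl
    rw [← List.cons_head_tail hl.ne_nil] at this
    simpa using this.degIn_le
  have hlast : degIn G (U \ verts f c) (l.getLast hl.ne_nil) ≤ l.length - 1 := by
    have := hl.reverse
    rw [← List.cons_head_tail this.ne_nil] at this
    simpa using this.degIn_le
  have e1 := degIn_eq_add G hU (l.head hl.ne_nil)
  have e2 := degIn_eq_add G hU (l.getLast hl.ne_nil)
  have hle (S : Finset V) : ∑ v ∈ S, degIn G (U \ S) v ≤ ∑ v ∈ S, degIn G U v :=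
    sum_le_sum fun v _ => card_le_card (filter_subset_filter _ sdiff_subset)
  have hlen : l.length = 1 ∨ l.head hl.ne_nil ≠ l.getLast hl.ne_nil := by
    rcases l with - | ⟨v, - | ⟨z, l⟩⟩
    · exact absurd rfl hl.ne_nil
    · simp
    · right
      have := hl.nodup
      simp only [List.head_cons]
      rw [List.getLast_cons (by simp)]
      exact fun e => (List.nodup_cons.1 this).1 (e ▸ List.getLast_mem _)
  by_cases heq : l.head hl.ne_nil = l.getLast hl.ne_nil
  · refine ⟨{l.head hl.ne_nil}, by simpa using hl.mem _ (List.head_mem _), by simp, ?_⟩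
    have := hle {l.head hl.ne_nil}
    rw [← heq] at key
    simp at this hlen heq ⊢
    have : l.length = 1 := hlen.resolve_right (by simpa using heq)
    omega
  · refine ⟨{l.head hl.ne_nil, l.getLast hl.ne_nil}, ?_, by simp, ?_⟩
    · intro x hx
      rw [mem_insert, mem_singleton] at hx
      rcases hx with rfl | rfl
      · exact hl.mem _ (List.head_mem _)
      · exact hl.mem _ (List.getLast_mem _)
    · have := hle {l.head hl.ne_nil, l.getLast hl.ne_nil}
      rw [sum_pair heq, sum_pair heq] at *
      rw [card_pair heq]
      omega

/-- Outside a longest cycle there is a nonempty set of vertices meeting few edges. -/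
theorem IsCyc.exists_sum_degIn_le (h : IsCyc G c f) (hmax : ∀ m g, IsCyc G m g → m ≤ c)
    (hU : verts f c ⊆ U) (hne : (U \ verts f c).Nonempty) :
    ∃ S ⊆ U \ verts f c, S.Nonempty ∧
      ∑ v ∈ S, degIn G U v + ∑ v ∈ S, degIn G (U \ S) v ≤ c * #S := by
  by_cases hgood : ∃ l, ∃ hl : IsLongestPath G (U \ verts f c) l, ∃ u ∈ verts f c,
      ∃ w ∈ verts f c, u ≠ w ∧ G.Adj (l.head hl.ne_nil) u ∧ G.Adj (l.getLast hl.ne_nil) w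
  · obtain ⟨l, hl, u, hu, w, hw, huw, hu', hw'⟩ := hgood
    exact h.exists_sum_degIn_le_of_ends hmax hU hl huw hu hw hu' hw'
  have hgood' : ∀ l, ∀ hl : IsLongestPath G (U \ verts f c) l, ∀ u ∈ verts f c,
      ∀ w ∈ verts f c, G.Adj (l.head hl.ne_nil) u → G.Adj (l.getLast hl.ne_nil) w → u = w := by
    intro l hl u hu w hw h1 h2
    by_contra huw
    exact hgood ⟨l, hl, u, hu, w, hw, huw, h1, h2⟩
  obtain ⟨l₀, hl₀⟩ := exists_isLongestPath G hne
  by_cases hatt : ∃ l, ∃ hl : IsLongestPath G (U \ verts f c) l, ∃ u ∈ verts f c,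
      G.Adj (l.getLast hl.ne_nil) u
  · obtain ⟨l₁, hl₁, u, hu, hu₁⟩ := hatt
    have huH : u ∉ U \ verts f c := by simp [hu]
    obtain ⟨X, hX, hXF, hsum⟩ := exists_sum_degIn_le_of_rotation (U := U) h.two_le hmax
      (F := {l' | l'.IsChain G.Adj ∧ ∃ l, l' = l ++ [u] ∧ IsLongestPath G (U \ verts f c) l})
      (by
        obtain ⟨v, l, rfl⟩ := List.exists_cons_of_ne_nil hl₁.ne_nil
        refine ⟨v, l ++ [u], ?_, v :: l, by simp, hl₁⟩
        rw [← List.cons_append, List.isChain_append]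
        refine ⟨hl₁.chain, by simp, ?_⟩
        rw [List.getLast?_eq_some_getLast hl₁.ne_nil]
        simpa using hu₁)
      (by
        rintro _ ⟨-, l, rfl, hl⟩
        refine List.nodup_append.2 ⟨hl.nodup, by simp, ?_⟩
        rintro x hx y hy rfl
        rw [List.mem_singleton] at hy
        exact huH (hy ▸ hl.mem _ hx))
      (fun l hl => hl.1)
      (by
        rintro v a b w ⟨hch, l, he, hl⟩ hvw
        refine ⟨isChain_adj_rotate hch hvw, ?_⟩
        rcases List.eq_nil_or_concat b with rfl | ⟨b', z, rfl⟩
        · obtain ⟨h1, h2⟩ := List.append_inj' he rfl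
          subst h1
          exact ⟨_, by rw [h2], hl.reverse⟩
        · have he' : (v :: a ++ w :: b') ++ [z] = l ++ [u] := by rw [← he]; simp
          obtain ⟨h1, h2⟩ := List.append_inj' he' rfl
          subst h1
          exact ⟨_, by rw [← h2]; simp, hl.rotate hvw⟩)
      (by
        rintro v l ⟨hch, m, he, hm⟩ w hw hvw
        obtain ⟨v', m', rfl⟩ := List.exists_cons_of_ne_nil hm.ne_nil
        rw [List.cons_append] at he
        obtain ⟨rfl, rfl⟩ := List.cons.inj he
        rw [List.mem_append, List.mem_singleton]
        by_cases hwC : w ∈ verts f c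
        · right
          refine hgood' _ hm w hwC u hu (by simpa using hvw) ?_
          rw [← List.cons_append, List.isChain_append] at hch
          exact hch.2.2 _ (List.getLast?_eq_some_getLast hm.ne_nil) _ rfl
        · exact Or.inl (hm.mem_of_adj (mem_sdiff.2 ⟨hw, hwC⟩) hvw))
    refine ⟨X, ?_, hX, hsum⟩
    intro x hx
    obtain ⟨l, -, m, he, hm⟩ := hXF x hx
    obtain ⟨v', m', rfl⟩ := List.exists_cons_of_ne_nil hm.ne_nil
    rw [List.cons_append] at he
    rw [(List.cons.inj he).1]
    exact hm.mem _ (by simp)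
  · obtain ⟨X, hX, hXF, hsum⟩ := exists_sum_degIn_le_of_rotation (U := U) h.two_le hmax
      (F := {l | IsLongestPath G (U \ verts f c) l})
      (by
        obtain ⟨v, l, rfl⟩ := List.exists_cons_of_ne_nil hl₀.ne_nil
        exact ⟨v, l, hl₀⟩)
      (fun l hl => IsLongestPath.nodup hl) (fun l hl => IsLongestPath.chain hl)
      (fun v a b w hl hvw => IsLongestPath.rotate hl hvw)
      (by
        intro v l hl w hw hvw
        refine IsLongestPath.mem_of_adj hl (mem_sdiff.2 ⟨hw, fun hwC => hatt ?_⟩) hvw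
        exact ⟨_, IsLongestPath.reverse hl, w, hwC, by simpa using hvw⟩)
    refine ⟨X, fun x hx => ?_, hX, hsum⟩
    obtain ⟨l, hl⟩ := hXF x hx
    exact IsLongestPath.mem hl _ (by simp)

/-- Few edges have an end outside a longest cycle. -/
theorem IsCyc.pairs_le (h : IsCyc G c f) (hmax : ∀ m g, IsCyc G m g → m ≤ c)
    (hU : verts f c ⊆ U) : pairs G U ≤ pairs G (verts f c) + c * (#U - c) := by
  induction U using Finset.strongInduction with
  | H U ih =>
    rcases (U \ verts f c).eq_empty_or_nonempty with he | hne
    · rw [sdiff_eq_empty_iff_subset] at he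
      rw [he.antisymm hU]
      omega
    · obtain ⟨S, hS, hSne, hsum⟩ := h.exists_sum_degIn_le hmax hU hne
      have hSU : S ⊆ U := hS.trans sdiff_subset
      have hsub : verts f c ⊆ U \ S := fun x hx =>
        mem_sdiff.2 ⟨hU hx, fun hxS => (mem_sdiff.1 (hS hxS)).2 hx⟩
      have h1 := ih _ (sdiff_ssubset hSU hSne) hsub
      have h2 := card_le_card hsub
      rw [card_sdiff_of_subset hSU] at h1 h2
      rw [card_verts h] at h2
      have h3 := card_le_card hSU
      have h4 := pairs_eq_add G hSU
      have h5 : c * (#U - #S - c) + c * #S = c * (#U - c) := by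
        rw [← mul_add]; congr 1; have := hSne.card_pos; omega
      omega

end LongestPath

section Extremal

open Finset
open scoped Classical

variable {V : Type*} {G : SimpleGraph V} {k : ℕ}

theorem pairs_le_mul_pred (G : SimpleGraph V) (U : Finset V) : pairs G U ≤ #U * (#U - 1) := by
  rw [← smul_eq_mul]
  refine sum_le_card_nsmul _ _ _ fun v hv => ?_
  rw [← card_erase_of_mem hv]
  refine card_le_card fun x hx => ?_
  rw [mem_filter] at hx
  exact mem_erase.2 ⟨hx.2.ne', hx.1⟩

theorem exists_longest_isCyc [Fintype V] (hG : pairs G univ ≠ 0) :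
    ∃ c f, IsCyc G c f ∧ ∀ m g, IsCyc G m g → m ≤ c := by
  obtain ⟨a, -, ha⟩ := exists_ne_zero_of_sum_ne_zero hG
  obtain ⟨b, hb⟩ := card_ne_zero.1 ha
  rw [mem_filter] at hb
  obtain ⟨f, hf⟩ := IsCyc.of_list (G := G) (l := [a, b]) (by simp) (by simpa using hb.2.ne)
    (by simpa using hb.2) (by simp) (by simpa using hb.2.symm)
  obtain ⟨c, ⟨g, hg⟩, hc⟩ := exists_maximal_nat (P := fun c => ∃ f, IsCyc G c f) ⟨_, f, hf⟩
    (Fintype.card V) (by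
      rintro n ⟨g, hg⟩
      rw [← card_verts hg]
      exact card_le_univ _)
  exact ⟨c, g, hg, fun m g' hg' => hc m ⟨g', hg'⟩⟩

/-- A dense graph without `C_{2k+1}` has a cycle missing at most one vertex, and a Hamiltonian
cycle if it has `n² / 4` edges. -/
theorem exists_isCyc_sq_le [Fintype V] (hk : 2 ≤ k) (hn : 4 * k ≤ Fintype.card V)
    (hno : ¬ ∃ g, IsCyc G (2 * k + 1) g)
    (he : Fintype.card V * Fintype.card V ≤ 2 * pairs G univ + 1) :
    ∃ c f, IsCyc G c f ∧ c ≤ Fintype.card V ∧ 2 * pairs G univ +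
      (Fintype.card V - c) * (Fintype.card V - c) ≤ Fintype.card V * Fintype.card V := by
  obtain ⟨c, f, hf, hmax⟩ := exists_longest_isCyc (G := G) (by
    intro h0
    rw [h0] at he
    nlinarith)
  have hle := hf.pairs_le hmax (subset_univ _)
  have hcn : c ≤ Fintype.card V := by
    rw [← card_verts hf]
    exact card_le_univ _
  rw [card_univ] at hle
  obtain ⟨d, hd⟩ := Nat.exists_eq_add_of_le hcn
  rw [hd] at hn he hle hcn
  rw [hd]
  rw [Nat.add_sub_cancel_left] at hle
  have hc : 2 * k + 1 ≤ c := by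
    by_contra hlt
    have h1 := pairs_le_mul_pred G (verts f c)
    rw [card_verts hf] at h1
    obtain ⟨c', rfl⟩ : ∃ c', c = c' + 1 := ⟨c - 1, by have := hf.two_le; omega⟩
    rw [Nat.add_sub_cancel] at h1
    nlinarith
  have h2 := hf.two_mul_pairs_le (by omega) hc hno
  exact ⟨c, f, hf, hcn, by rw [Nat.add_sub_cancel_left]; nlinarith⟩

theorem two_mul_pairs_univ_le [Fintype V] (hk : 2 ≤ k) (hn : 4 * k ≤ Fintype.card V)
    (hno : ¬ ∃ g, IsCyc G (2 * k + 1) g) :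
    2 * pairs G univ ≤ Fintype.card V * Fintype.card V := by
  by_contra hlt
  obtain ⟨c, f, -, -, h⟩ := exists_isCyc_sq_le hk hn hno (by omega)
  omega

theorem exists_injOn_of_mem {A : Finset V} {a : V} (ha : a ∈ A) :
    ∃ α : ℕ → V, α 0 = a ∧ (∀ i < #A, α i ∈ A) ∧ Set.InjOn α (Set.Iio #A) := by
  have hnd : (a :: (A.erase a).toList).Nodup := List.nodup_cons.2 ⟨by simp, nodup_toList _⟩
  have hlen : (a :: (A.erase a).toList).length = #A := by
    have := card_pos.2 ⟨a, ha⟩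
    simp [card_erase_of_mem ha]
    omega
  refine ⟨fun i => (a :: (A.erase a).toList).getD i a, by simp, ?_, ?_⟩
  · intro i hi
    rw [← hlen] at hi
    have := List.getElem_mem hi
    rw [List.mem_cons, mem_toList, mem_erase] at this
    simp only [List.getD, List.getElem?_eq_getElem hi, Option.getD_some]
    rcases this with h | h
    · rwa [h]
    · exact h.2
  · intro i hi j hj e
    rw [Set.mem_Iio, ← hlen] at hi hj
    simp only [List.getD, List.getElem?_eq_getElem hi, List.getElem?_eq_getElem hj,
      Option.getD_some] at e
    exact (hnd.getElem_inj_iff).1 e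

/-- A vertex joined to both sides of a large complete bipartite graph lies on a `C_{2k+1}`. -/
theorem exists_isCyc_of_completeBipartite {A B : Finset V} (hAB : ∀ x ∈ A, ∀ y ∈ B, G.Adj x y)
    (hk : 1 ≤ k) (hkA : k ≤ #A) (hkB : k ≤ #B) {v a b : V} (hvA : v ∉ A) (hvB : v ∉ B)
    (ha : a ∈ A) (hb : b ∈ B) (hva : G.Adj v a) (hvb : G.Adj v b) :
    ∃ g, IsCyc G (2 * k + 1) g := by
  obtain ⟨α, hα0, hα, hαi⟩ := exists_injOn_of_mem ha
  obtain ⟨β, hβ0, hβ, hβi⟩ := exists_injOn_of_mem hb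
  refine ⟨_, IsCyc.of_injOn (g := fun i => if i = 0 then v else
    if i % 2 = 1 then α (i / 2) else β (k - i / 2)) (by omega) ?_ ?_ ?_⟩
  · intro i hi
    simp only [Nat.add_eq_zero_iff, one_ne_zero, and_false, if_false]
    split_ifs with h0 h1 h2
    · subst h0; simpa [hα0] using hva
    · omega
    · omega
    · exact hAB _ (hα _ (by omega)) _ (hβ _ (by omega))
    · exact (hAB _ (hα _ (by omega)) _ (hβ _ (by omega))).symm
    · omega
  · simpa [show 2 * k ≠ 0 by omega, hβ0] using hvb.symm
  · intro i j hij hj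
    simp only [show j ≠ 0 by omega, if_false]
    split_ifs with h0 h1 h2 h3 h4
    · exact fun e => hvA (e ▸ hα _ (by omega))
    · exact fun e => hvB (e ▸ hβ _ (by omega))
    · intro e
      have := hαi (show i / 2 < #A by omega) (show j / 2 < #A by omega) e
      omega
    · exact (hAB _ (hα _ (by omega)) _ (hβ _ (by omega))).ne
    · exact (hAB _ (hα _ (by omega)) _ (hβ _ (by omega))).ne'
    · intro e
      have := hβi (show k - i / 2 < #B by omega) (show k - j / 2 < #B by omega) e
      omega

theorem pairs_comap {W : Type*} (G : SimpleGraph V) (e : W ↪ V) (T : Finset W) :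
    pairs (G.comap e) T = pairs G (T.map e) := by
  simp [pairs, degIn, filter_map]

theorem IsCyc.map {W : Type*} {e : W ↪ V} {m : ℕ} {g : ℕ → W}
    (h : IsCyc (G.comap e) m g) : IsCyc G m (fun i => e (g i)) where
  two_le := h.two_le
  adj := h.adj
  per i := congrArg e (h.per i)
  inj i j hi hj hij := h.inj i j hi hj (e.injective hij)

theorem adj_iff_of_insert {A B : Finset V} {v : V} (hvA : v ∉ A) (hvB : v ∉ B)
    (hcov : ∀ x, x ≠ v → (x ∈ B ↔ x ∉ A))
    (hadj : ∀ x y, x ≠ v → y ≠ v → (G.Adj x y ↔ (x ∈ A ↔ y ∉ A)))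
    (hN : ∀ y, G.Adj v y ↔ y ∈ B) (x y : V) :
    G.Adj x y ↔ (x ∈ insert v A ↔ y ∉ insert v A) := by
  rw [mem_insert, mem_insert]
  by_cases hx : x = v <;> by_cases hy : y = v
  · subst hx; subst hy; simp
  · subst hx; simp [hN, hy, hcov y hy]
  · subst hy; simp [G.adj_comm x, hN, hx, hcov x hx]
  · simp [hx, hy, hadj x y hx hy]

theorem exists_degIn_univ_le [Fintype V] [Nonempty V]
    (h : 2 * pairs G univ ≤ Fintype.card V * Fintype.card V) :
    ∃ v, degIn G univ v ≤ Fintype.card V / 2 := by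
  by_contra! hcon
  have h1 : #(univ : Finset V) • (Fintype.card V / 2 + 1) ≤ pairs G univ :=
    card_nsmul_le_sum _ _ _ fun v _ => hcon v
  rw [card_univ, smul_eq_mul] at h1
  have h2 : 0 < Fintype.card V := Fintype.card_pos
  have h3 : Fintype.card V + 1 ≤ 2 * (Fintype.card V / 2 + 1) := by omega
  nlinarith

theorem exists_bipartition_of_card_eq [Fintype V] (hk : 2 ≤ k) (hn : Fintype.card V = 4 * k)
    (hno : ¬ ∃ g, IsCyc G (2 * k + 1) g)
    (he : Fintype.card V * Fintype.card V ≤ 2 * pairs G univ + 1) :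
    ∃ A : Finset V, #A = (Fintype.card V + 1) / 2 ∧
      ∀ x y, G.Adj x y ↔ (x ∈ A ↔ y ∉ A) := by
  obtain ⟨c, f, hf, hc, h⟩ := exists_isCyc_sq_le hk hn.ge hno he
  obtain ⟨d, hd⟩ := Nat.exists_eq_add_of_le hc
  have hsq : Fintype.card V * Fintype.card V = 2 * (8 * (k * k)) := by rw [hn]; ring
  have hd0 : d = 0 := by
    rw [hd, Nat.add_sub_cancel_left, ← hd] at h
    by_contra h0
    have : 1 ≤ d * d := Nat.mul_pos (by omega) (by omega)
    omega
  obtain rfl : c = 4 * k := by omega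
  have hV : verts f (4 * k) = univ := by
    rw [← card_eq_iff_eq_univ, card_verts hf, hn]
  have hadj := hf.adj_iff_odd_of_equality hk hno (by rw [hV, ← hn]; omega)
  have hmem (i : ℕ) (hi : i < 4 * k) :
      f i ∈ (range (2 * k)).image (fun i => f (2 * i)) ↔ i % 2 = 0 := by
    constructor
    · intro h
      obtain ⟨j, hj, e⟩ := mem_image.1 h
      rw [mem_range] at hj
      have := hf.inj _ _ (by omega) hi e
      omega
    · intro h
      exact mem_image.2 ⟨i / 2, by rw [mem_range]; omega, congrArg f (by omega)⟩
  refine ⟨(range (2 * k)).image fun i => f (2 * i), ?_, ?_⟩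
  · rw [card_image_of_injOn, card_range]
    · omega
    · intro i hi j hj e
      rw [mem_coe, mem_range] at hi hj
      have := hf.inj _ _ (by omega) (by omega) e
      omega
  · intro x y
    obtain ⟨i, hi, rfl⟩ := mem_image.1 (hV ▸ mem_univ x)
    obtain ⟨j, hj, rfl⟩ := mem_image.1 (hV ▸ mem_univ y)
    rw [mem_range] at hi hj
    rw [hadj i j hi hj, hmem i hi, hmem j hj]
    omega

theorem eq_half_and_sq_le_of_sq_le {n p q d d' : ℕ} (hq : (n + 1) * (n + 1) ≤ 2 * q + 1)
    (hp : 2 * p ≤ n * n) (hd : d ≤ (n + 1) / 2) (hd' : d' ≤ d) (hqp : q = p + (d + d')) :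
    d = (n + 1) / 2 ∧ n * n ≤ 2 * p + 1 := by
  rcases Nat.even_or_odd' n with ⟨m, rfl | rfl⟩
  · have h1 : (2 * m + 1) * (2 * m + 1) = 4 * (m * m) + 4 * m + 1 := by ring
    have h2 : 2 * m * (2 * m) = 4 * (m * m) := by ring
    omega
  · have h1 : (2 * m + 1 + 1) * (2 * m + 1 + 1) = 4 * (m * m) + 8 * m + 4 := by ring
    have h2 : (2 * m + 1) * (2 * m + 1) = 4 * (m * m) + 4 * m + 1 := by ring
    omega

theorem exists_bipartition [Fintype V] (hk : 2 ≤ k) (hn : 4 * k ≤ Fintype.card V)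
    (hno : ¬ ∃ g, IsCyc G (2 * k + 1) g)
    (he : Fintype.card V * Fintype.card V ≤ 2 * pairs G univ + 1) :
    ∃ A : Finset V, #A = (Fintype.card V + 1) / 2 ∧
      ∀ x y, G.Adj x y ↔ (x ∈ A ↔ y ∉ A) := by
  obtain ⟨t, ht⟩ := Nat.exists_eq_add_of_le hn
  induction t generalizing V with
  | zero => exact exists_bipartition_of_card_eq hk ht hno he
  | succ t ih =>
    have : Nonempty V := Fintype.card_pos_iff.1 (by omega)
    have hub := two_mul_pairs_univ_le hk hn hno
    obtain ⟨v, hv⟩ := exists_degIn_univ_le hub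
    let e : {x // x ≠ v} ↪ V := Function.Embedding.subtype _
    have hW : Fintype.card {x // x ≠ v} = 4 * k + t := by
      rw [Fintype.card_subtype_compl, Fintype.card_subtype_eq]
      omega
    have hmap : (univ : Finset {x // x ≠ v}).map e = univ \ {v} := by
      ext x
      simp [e]
    have hnoW : ¬ ∃ g, IsCyc (G.comap e) (2 * k + 1) g :=
      fun ⟨g, hg⟩ => hno ⟨_, hg.map⟩
    have hubW := two_mul_pairs_univ_le hk (by omega) hnoW
    have hadd := pairs_eq_add G (subset_univ {v})
    rw [sum_singleton, sum_singleton, ← hmap, ← pairs_comap] at hadd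
    have hle : degIn G (univ.map e) v ≤ degIn G univ v :=
      card_le_card (filter_subset_filter _ (subset_univ _))
    rw [ht] at he hub hv
    rw [hW] at hubW
    have hdeg : degIn G univ v = (4 * k + (t + 1)) / 2 ∧
        (4 * k + t) * (4 * k + t) ≤ 2 * pairs (G.comap e) univ + 1 :=
      eq_half_and_sq_le_of_sq_le he hubW hv hle (by omega)
    obtain ⟨A', hA', hadj'⟩ := ih (V := {x // x ≠ v}) (G := G.comap e) (by omega) hnoW
      (by rw [hW]; exact hdeg.2) hW
    rw [hW] at hA'
    set A := A'.map e with hA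
    set B := A'ᶜ.map e with hB
    have hAc : #A = (4 * k + t + 1) / 2 := by rw [hA, card_map, hA']
    have hBc : #B = (4 * k + t) / 2 := by
      rw [hB, card_map, card_compl, hW, hA']; omega
    have hmemA (x : V) (hx : x ≠ v) : x ∈ A ↔ (⟨x, hx⟩ : {x // x ≠ v}) ∈ A' := by
      simp [hA, e, hx]
    have hvA : v ∉ A := by simp [hA, e]
    have hvB : v ∉ B := by simp [hB, e]
    have hcov (x : V) (hx : x ≠ v) : x ∈ B ↔ x ∉ A := by
      rw [hmemA x hx]; simp [hB, e, hx]
    have hadj (x y : V) (hx : x ≠ v) (hy : y ≠ v) : G.Adj x y ↔ (x ∈ A ↔ y ∉ A) := by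
      rw [hmemA x hx, hmemA y hy, ← hadj']
      simp [e]
    have hAne (x : V) (hx : x ∈ A) : x ≠ v := fun h => hvA (h ▸ hx)
    have hBne (x : V) (hx : x ∈ B) : x ≠ v := fun h => hvB (h ▸ hx)
    have hside : (∀ x ∈ ({w ∈ univ | G.Adj v w} : Finset V), x ∈ A) ∨
        ∀ x ∈ ({w ∈ univ | G.Adj v w} : Finset V), x ∈ B := by
      by_contra! hcon
      obtain ⟨⟨b, hb, hbA⟩, a, ha, haB⟩ := hcon
      rw [mem_filter] at ha hb
      refine hno (exists_isCyc_of_completeBipartite (A := A) (B := B) ?_ (by omega) (by omega)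
        (by omega) hvA hvB (a := a) (b := b) ?_ ?_ ha.2 hb.2)
      · intro x hx y hy
        have := (hcov y (hBne y hy)).1 hy
        rw [hadj x y (hAne x hx) (hBne y hy)]
        tauto
      · by_contra h
        exact haB ((hcov a ha.2.ne').2 h)
      · exact (hcov b hb.2.ne').2 hbA
    have hdeg1 : #({w ∈ univ | G.Adj v w} : Finset V) = (4 * k + (t + 1)) / 2 := hdeg.1
    rw [ht]
    rcases hside with hs | hs
    · have hN := eq_of_subset_of_card_le (fun x hx => hs x hx) (by omega)
      refine ⟨insert v B, by rw [card_insert_of_notMem hvB]; omega,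
        adj_iff_of_insert hvB hvA ?_ ?_ ?_⟩
      · intro x hx; rw [hcov x hx]; tauto
      · intro x y hx hy; rw [hadj x y hx hy, hcov x hx, hcov y hy]; tauto
      · intro y; rw [← hN]; simp
    · have hcard := card_le_card (fun x hx => hs x hx)
      have hN := eq_of_subset_of_card_le (fun x hx => hs x hx) (by omega)
      refine ⟨insert v A, by rw [card_insert_of_notMem hvA]; omega,
        adj_iff_of_insert hvA hvB hcov hadj ?_⟩
      intro y; rw [← hN]; simp

end Extremal

section Transfer

open Finset
open scoped Classical

variable {V : Type*}

theorem pairs_univ [Fintype V] (G : SimpleGraph V) : pairs G univ = 2 * G.edgeSet.ncard := by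
  rw [← coe_edgeFinset, Set.ncard_coe_finset, ← sum_degrees_eq_twice_card_edges, pairs]
  refine sum_congr rfl fun v _ => ?_
  rw [degIn, ← card_neighborFinset_eq_degree, neighborFinset_eq_filter]

theorem pairs_completeBipartiteGraph (a b : ℕ) :
    pairs (completeBipartiteGraph (Fin a) (Fin b)) univ = 2 * (a * b) := by
  simp only [pairs, degIn, card_filter, Fintype.sum_sum_type]
  simp
  ring

theorem half_mul_half (n : ℕ) : (n + 1) / 2 * (n / 2) = n ^ 2 / 4 := by
  rcases Nat.even_or_odd' n with ⟨m, rfl | rfl⟩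
  · rw [show (2 * m + 1) / 2 = m by omega, show 2 * m / 2 = m by omega,
      show (2 * m) ^ 2 = 4 * (m * m) by ring]
    omega
  · rw [show (2 * m + 1 + 1) / 2 = m + 1 by omega, show (2 * m + 1) / 2 = m by omega,
      show (2 * m + 1) ^ 2 = 4 * ((m + 1) * m) + 1 by ring]
    omega

theorem CycleFree.of_colorable {G : SimpleGraph V} (hG : G.Colorable 2) {k : ℕ} (hk : 1 ≤ k) :
    CycleFree (2 * k + 1) G := by
  rintro ⟨f, -⟩
  obtain ⟨C⟩ := hG
  have h1 : (cycleGraph (2 * k + 1)).Colorable 2 := ⟨C.comp f⟩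
  have h2 := h1.chromaticNumber_le
  rw [chromaticNumber_cycleGraph_of_odd _ (by omega) (odd_two_mul_add_one k)] at h2
  exact absurd h2 (by decide)

theorem CycleFree.not_exists_isCyc {G : SimpleGraph V} {m : ℕ} (h : CycleFree m G) (hm : 3 ≤ m) :
    ¬ ∃ g, IsCyc G m g :=
  fun ⟨_, hg⟩ => h (hg.hasSubCopy hm)

theorem nonempty_iso_completeBipartiteGraph [Fintype V] {G : SimpleGraph V} {A : Finset V}
    (hadj : ∀ x y, G.Adj x y ↔ (x ∈ A ↔ y ∉ A)) {a b : ℕ} (ha : #A = a) (hb : Fintype.card V - #A = b) :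
    Nonempty (G ≃g completeBipartiteGraph (Fin a) (Fin b)) := by
  have e₁ : {x // x ∈ A} ≃ Fin a := Fintype.equivFinOfCardEq (by simpa using ha)
  have e₂ : {x // x ∉ A} ≃ Fin b := Fintype.equivFinOfCardEq (by
    rw [Fintype.card_subtype_compl]; simpa using hb)
  refine ⟨⟨(Equiv.sumCompl (· ∈ A)).symm.trans (Equiv.sumCongr e₁ e₂), ?_⟩⟩
  intro x y
  rw [hadj]
  by_cases hx : x ∈ A <;> by_cases hy : y ∈ A <;>
    simp [hx, hy, Equiv.sumCompl_symm_apply_of_pos, Equiv.sumCompl_symm_apply_of_neg]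

end Transfer

/-- For `k ≥ 2` and `n ≥ 4k`: every `C_{2k+1}`-free graph on `n` vertices has at most
`⌊n²/4⌋` edges, this bound is attained, and every `C_{2k+1}`-free graph on `n` vertices
with exactly `⌊n²/4⌋` edges is isomorphic to `K_{⌈n/2⌉, ⌊n/2⌋}`. -/
theorem stmt_11 (k n : ℕ) (hk : 2 ≤ k) (hn : 4 * k ≤ n) :
    (∀ G : SimpleGraph (Fin n), CycleFree (2 * k + 1) G →
      G.edgeSet.ncard ≤ n ^ 2 / 4) ∧
    (∃ G : SimpleGraph (Fin n), CycleFree (2 * k + 1) G ∧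
      G.edgeSet.ncard = n ^ 2 / 4) ∧
    (∀ G : SimpleGraph (Fin n), CycleFree (2 * k + 1) G →
      G.edgeSet.ncard = n ^ 2 / 4 →
      Nonempty (G ≃g completeBipartiteGraph (Fin ((n + 1) / 2)) (Fin (n / 2)))) := by
  refine ⟨fun G hG => ?_, ?_, fun G hG he => ?_⟩
  · have h := two_mul_pairs_univ_le hk (by simpa using hn) (hG.not_exists_isCyc (by omega))
    rw [pairs_univ, Fintype.card_fin, ← sq] at h
    omega
  · have e : Fin n ≃ Fin ((n + 1) / 2) ⊕ Fin (n / 2) :=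
      Fintype.equivOfCardEq (by simp; omega)
    let H := completeBipartiteGraph (Fin ((n + 1) / 2)) (Fin (n / 2))
    refine ⟨H.comap e.toEmbedding, .of_colorable ?_ (by omega), ?_⟩
    · have h : H.Colorable 2 := (CompleteBipartiteGraph.bicoloring _ _).colorable
      exact h.of_hom (Hom.comap _ H)
    · have h := pairs_comap H e.toEmbedding Finset.univ
      rw [Finset.map_univ_equiv, pairs_univ, pairs_completeBipartiteGraph, half_mul_half] at h
      omega
  · obtain ⟨A, hA, hadj⟩ := exists_bipartition hk (by simpa using hn)
      (hG.not_exists_isCyc (by omega)) (by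
        rw [pairs_univ, he, Fintype.card_fin, ← sq]
        have h : n ^ 2 % 4 ≤ 1 := by
          rcases Nat.even_or_odd' n with ⟨m, rfl | rfl⟩
          · rw [show (2 * m) ^ 2 = 4 * (m * m) by ring]; omega
          · rw [show (2 * m + 1) ^ 2 = 4 * (m * m + m) + 1 by ring]; omega
        omega)
    rw [Fintype.card_fin] at hA
    exact nonempty_iso_completeBipartiteGraph hadj hA (by
      rw [hA, Fintype.card_fin]; omega)
end
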